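/- With the Calderón–Zygmund decomposition and the truncated kernels as in the context, there exist constants η > 0, δ > 0 and C' (depending only on d and the constants C, c₁, c₂) such that for every integer s ≥ 200 and every w ∈ {0,1/2}^d, ‖ sup_{l∈ℤ} | Σ_{K∈𝔇^w : l(K)≥2^l} T_{K,2} b_{k−s} | ‖_{L²(ℝ^d)} ≤ C' (s² 2^{−δs} C_Ω λ ‖f‖_{L¹(ℝ^d)})^{1/2}, where for each K the integer k = k(K) is given by l(K) = 2^k. -/

import Mathlib

open MeasureTheory Metric Set FourierTransform
open scoped ENNReal RealInnerProductSpace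

noncomputable section

abbrev Rd (d : ℕ) : Type := EuclideanSpace ℝ (Fin d)

/-- Surface measure on the unit sphere `S^{d-1}`. -/
def sphereMeasure (d : ℕ) : Measure (sphere (0 : Rd d) 1) :=
  (volume : Measure (Rd d)).toSphere

/-- Integral over the sphere of a function defined on `ℝ^d`. -/
def sphInt (d : ℕ) (g : Rd d → ℝ) : ℝ :=
  ∫ θ : sphere (0 : Rd d) 1, g (θ : Rd d) ∂(sphereMeasure d)

/-- `‖Ω‖₁`, the `L¹(S^{d-1})` norm of `Ω`. -/
def omegaL1 (d : ℕ) (Ω : Rd d → ℝ) : ℝ := sphInt d (fun x => |Ω x|)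

/-- `‖Ω‖_{LlogL(S^{d-1})}`. -/
def omegaLlogL (d : ℕ) (Ω : Rd d → ℝ) : ℝ :=
  sphInt d (fun x => |Ω x| * Real.log (2 + |Ω x|))

/-- The constant `C_Ω`. -/
def constCOmega (d : ℕ) (Ω : Rd d → ℝ) : ℝ :=
  omegaLlogL d Ω +
    sphInt d (fun x => |Ω x| * (1 + max (Real.log (|Ω x| / omegaL1 d Ω)) 0))

/-- `Ω` is homogeneous of degree zero on `ℝ^d ∖ {0}`. -/
def Homogeneous0 (d : ℕ) (Ω : Rd d → ℝ) : Prop :=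
  ∀ x : Rd d, x ≠ 0 → ∀ r : ℝ, 0 < r → Ω (r • x) = Ω x

/-- The hypotheses on `Ω`: homogeneity of degree `0`, integrability on the sphere,
the cancellation condition, and `Ω ∈ L log L(S^{d-1})`. -/
def OmegaHyp (d : ℕ) (Ω : Rd d → ℝ) : Prop :=
  Homogeneous0 d Ω ∧
  Integrable (fun θ : sphere (0 : Rd d) 1 => Ω (θ : Rd d)) (sphereMeasure d) ∧
  (∫ θ : sphere (0 : Rd d) 1, Ω (θ : Rd d) ∂(sphereMeasure d)) = 0 ∧
  Integrable (fun θ : sphere (0 : Rd d) 1 => |Ω (θ : Rd d)| * Real.log (2 + |Ω (θ : Rd d)|))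
    (sphereMeasure d)

/-- `φ` is smooth, supported in the annulus `{2^{-4} < |x| < 2^{-2}}` and
satisfies the partition of unity condition `Σ_j φ(2^{-j} x) = 1` for `x ≠ 0`. -/
def AdmissiblePhi (d : ℕ) (φ : Rd d → ℝ) : Prop :=
  ContDiff ℝ (⊤ : ℕ∞) φ ∧
  tsupport φ ⊆ {x : Rd d | (2:ℝ) ^ (-4 : ℤ) < ‖x‖ ∧ ‖x‖ < (2:ℝ) ^ (-2 : ℤ)} ∧
  ∀ x : Rd d, x ≠ 0 → HasSum (fun j : ℤ => φ ((2:ℝ) ^ (-j) • x)) 1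

/-- The kernel `𝒦_j(x) = φ(2^{-j}x) Ω(x) |x|^{-d}`. -/
def Kker (d : ℕ) (φ Om : Rd d → ℝ) (j : ℤ) (x : Rd d) : ℝ :=
  φ ((2:ℝ) ^ (-j) • x) * Om x * ‖x‖ ^ (-(d : ℤ))

/-- The dyadic operator `T_j f = 𝒦_j * f`. -/
def Tj (d : ℕ) (φ Om : Rd d → ℝ) (j : ℤ) (f : Rd d → ℝ) (x : Rd d) : ℝ :=
  ∫ y, Kker d φ Om j (x - y) * f y

/-- The maximal dyadic truncated operator `T_* f(x) = sup_l |Σ_{j ≥ l} T_j f(x)|`. -/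
def TStar (d : ℕ) (φ Om f : Rd d → ℝ) (x : Rd d) : ℝ≥0∞ :=
  ⨆ l : ℤ, ENNReal.ofReal |∑' j : {j : ℤ // l ≤ j}, Tj d φ Om (j : ℤ) f x|

/-- The dyadic cube `2^k w + ∏_i [m_i 2^k, (m_i+1) 2^k)` in the shifted grid `𝔇^w`. -/
def dcube (d : ℕ) (w : Fin d → ℝ) (k : ℤ) (m : Fin d → ℤ) : Set (Rd d) :=
  {x | ∀ i : Fin d, (2:ℝ) ^ k * (w i + m i) ≤ x i ∧ x i < (2:ℝ) ^ k * (w i + m i + 1)}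

/-- The concentric cube `½K` of half the sidelength. -/
def dhalf (d : ℕ) (w : Fin d → ℝ) (k : ℤ) (m : Fin d → ℤ) : Set (Rd d) :=
  {x | ∀ i : Fin d,
    (2:ℝ) ^ k * (w i + m i + 1/4) ≤ x i ∧ x i < (2:ℝ) ^ k * (w i + m i + 3/4)}

/-- `w ∈ {0, 1/2}^d`. -/
def GridShift (d : ℕ) (w : Fin d → ℝ) : Prop := ∀ i, w i = 0 ∨ w i = 1/2

/-- The Calderón–Zygmund decomposition data at level `λ/C_Ω`: a countable collection
`Qset` of pairwise disjoint standard dyadic cubes and bad functions `b_Q` with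
`supp b_Q ⊆ Q`, `∫ b_Q = 0`, `‖b_Q‖₁ ≤ C⟨f⟩_Q |Q|` and `⟨f⟩_Q ≈ λ/C_Ω`. -/
structure CZData (d : ℕ) (COm Cc c₁ c₂ : ℝ) (f : Rd d → ℝ) (lam : ℝ)
    (Qset : Set (ℤ × (Fin d → ℤ))) (b : ℤ × (Fin d → ℤ) → Rd d → ℝ) : Prop where
  pairwise_disjoint : Qset.Pairwise fun q q' =>
    Disjoint (dcube d 0 q.1 q.2) (dcube d 0 q'.1 q'.2)
  support_subset : ∀ q ∈ Qset, Function.support (b q) ⊆ dcube d 0 q.1 q.2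
  integrable : ∀ q ∈ Qset, Integrable (b q)
  integral_zero : ∀ q ∈ Qset, (∫ x, b q x) = 0
  l1_bound : ∀ q ∈ Qset, (∫ x, |b q x|) ≤ Cc * ∫ x in dcube d 0 q.1 q.2, |f x|
  avg_lower : ∀ q ∈ Qset, c₁ * lam / COm ≤
    (∫ x in dcube d 0 q.1 q.2, |f x|) / (volume (dcube d 0 q.1 q.2)).toReal
  avg_upper : ∀ q ∈ Qset,
    (∫ x in dcube d 0 q.1 q.2, |f x|) / (volume (dcube d 0 q.1 q.2)).toReal ≤ c₂ * lam / COm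

/-- `b_m = Σ_{Q ∈ 𝒬, l(Q) = 2^m} b_Q`. -/
def bsum (d : ℕ) (Qset : Set (ℤ × (Fin d → ℤ))) (b : ℤ × (Fin d → ℤ) → Rd d → ℝ)
    (m : ℤ) (x : Rd d) : ℝ :=
  ∑' mv : Fin d → ℤ, Set.indicator Qset (fun q => b q x) (m, mv)

/-- `Ω₁ = Ω·χ_{{|Ω| ≥ 2^{ηs}‖Ω‖₁}}`. -/
def Omega1 (d : ℕ) (Ω : Rd d → ℝ) (η : ℝ) (s : ℕ) (x : Rd d) : ℝ :=
  if (2:ℝ) ^ (η * s) * omegaL1 d Ω ≤ |Ω x| then Ω x else 0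

/-- `Ω₂ = Ω·χ_{{|Ω| < 2^{ηs}‖Ω‖₁}}`. -/
def Omega2 (d : ℕ) (Ω : Rd d → ℝ) (η : ℝ) (s : ℕ) (x : Rd d) : ℝ :=
  if |Ω x| < (2:ℝ) ^ (η * s) * omegaL1 d Ω then Ω x else 0

/-- `T_K g = 𝒦_k * (g·χ_{½K})`, for `K ∈ 𝔇^w` with `l(K) = 2^k` given by `(k, m)`,
where the kernel is built from the function `Om`. -/
def TKop (d : ℕ) (φ Om : Rd d → ℝ) (w : Fin d → ℝ) (k : ℤ) (m : Fin d → ℤ)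
    (g : Rd d → ℝ) (x : Rd d) : ℝ :=
  ∫ y, Kker d φ Om k (x - y) * Set.indicator (dhalf d w k m) g y

/-- The integral Fourier transform of a function in `L¹ ∩ L²` represents its `L²` Fourier
transform. -/
theorem coeFn_fourier_toLp_ae_eq {d : ℕ} {f : Rd d → ℂ} (hf : Integrable f)
    (hf2 : MemLp f 2) : (𝓕 (hf2.toLp f) : Lp ℂ 2 (volume : Measure (Rd d))) =ᵐ[volume] 𝓕 f := by
  have hcont : Continuous (𝓕 f) :=
    VectorFourier.fourierIntegral_continuous (L := innerₗ (Rd d)) Real.continuous_fourierChar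
      continuous_inner hf
  refine ae_eq_of_integral_contDiff_smul_eq ((Lp.memLp _).locallyIntegrable (by norm_num))
    hcont.locallyIntegrable ?_
  intro g hg hgc
  have hg₁ : HasCompactSupport (Complex.ofRealCLM ∘ g) := hgc.comp_left rfl
  have hg₂ : ContDiff ℝ (⊤ : ℕ∞) (Complex.ofRealCLM ∘ g) := by fun_prop
  set G := hg₁.toSchwartzMap hg₂ with hG
  have h1 : (𝓕 (hf2.toLp f : TemperedDistribution (Rd d) ℂ)) G =
      ((𝓕 (hf2.toLp f) : Lp ℂ 2 (volume : Measure (Rd d))) : TemperedDistribution (Rd d) ℂ) G := by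
    rw [Lp.fourier_toTemperedDistribution_eq]
  rw [TemperedDistribution.fourier_apply, Lp.toTemperedDistribution_apply,
    Lp.toTemperedDistribution_apply] at h1
  have h2 : ∫ ξ, 𝓕 (G : Rd d → ℂ) ξ • f ξ = ∫ x, G x • 𝓕 f x := by
    simpa using! VectorFourier.integral_fourierIntegral_smul_eq_flip (L := innerₗ (Rd d))
      Real.continuous_fourierChar continuous_inner G.integrable hf
  have h3 : ∫ x, (𝓕 G) x • (hf2.toLp f) x = ∫ ξ, 𝓕 (G : Rd d → ℂ) ξ • f ξ := by
    refine integral_congr_ae ?_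
    filter_upwards [hf2.coeFn_toLp] with x hx
    rw [hx, SchwartzMap.fourier_coe]
  calc ∫ x, g x • (𝓕 (hf2.toLp f) : Lp ℂ 2 (volume : Measure (Rd d))) x
      = ∫ x, G x • (𝓕 (hf2.toLp f) : Lp ℂ 2 (volume : Measure (Rd d))) x := by
        simp [hG]
    _ = ∫ x, G x • 𝓕 f x := by rw [← h1, h3, h2]
    _ = ∫ x, g x • 𝓕 f x := by simp [hG]

/-- Plancherel's identity for functions in `L¹ ∩ L²`. -/
theorem lintegral_enorm_fourier_sq {d : ℕ} {f : Rd d → ℂ} (hf : Integrable f)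
    (hf2 : MemLp f 2) : ∫⁻ ξ, ‖𝓕 f ξ‖ₑ ^ 2 = ∫⁻ x, ‖f x‖ₑ ^ 2 := by
  have key : ∀ g : Rd d → ℂ, ∫⁻ x, ‖g x‖ₑ ^ 2 = eLpNorm g 2 volume ^ 2 := by
    intro g
    rw [eLpNorm_eq_lintegral_rpow_enorm_toReal (by norm_num) (by norm_num)]
    simp only [ENNReal.toReal_ofNat, ENNReal.rpow_ofNat]
    rw [← ENNReal.rpow_natCast, ← ENNReal.rpow_mul]
    norm_num
  rw [key, key, ← eLpNorm_congr_ae (coeFn_fourier_toLp_ae_eq hf hf2),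
    ← eLpNorm_congr_ae hf2.coeFn_toLp, ← Lp.enorm_def, ← Lp.enorm_def]
  rw [← ofReal_norm, ← ofReal_norm, Lp.norm_fourier_eq]

/-- The Fourier transform of a real valued function. -/
def fourierR (d : ℕ) (f : Rd d → ℝ) (ξ : Rd d) : ℂ := 𝓕 (fun x => (f x : ℂ)) ξ

/-- The convolution of two real valued functions. -/
def cv (d : ℕ) (K b : Rd d → ℝ) (x : Rd d) : ℝ := ∫ y, K (x - y) * b y

theorem fourierR_eq {d : ℕ} (f : Rd d → ℝ) (ξ : Rd d) :
    fourierR d f ξ = ∫ x, Complex.exp (↑(-2 * Real.pi * ⟪x, ξ⟫) * Complex.I) * (f x : ℂ) := by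
  rw [fourierR, Real.fourier_eq']
  simp

theorem fourierR_continuous {d : ℕ} {f : Rd d → ℝ} (hf : Integrable f) :
    Continuous (fourierR d f) :=
  VectorFourier.fourierIntegral_continuous (L := innerₗ (Rd d)) Real.continuous_fourierChar
      continuous_inner hf.ofReal

theorem integrable_complex_ofReal {d : ℕ} {f : Rd d → ℝ} (hf : Integrable f) :
    Integrable (fun x => (f x : ℂ)) := hf.ofReal

theorem memLp_two_of_bounded {d : ℕ} {f : Rd d → ℝ} (hf : Integrable f) {M : ℝ}
    (hM : ∀ x, |f x| ≤ M) : MemLp f 2 := by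
  rw [memLp_two_iff_integrable_sq_norm hf.aestronglyMeasurable]
  refine (hf.norm.const_mul M).mono' (hf.aestronglyMeasurable.norm.pow 2) ?_
  refine Filter.Eventually.of_forall fun x => ?_
  have := hM x
  simp only [Real.norm_eq_abs, abs_pow, abs_abs]
  nlinarith [abs_nonneg (f x)]

theorem lintegral_fourierR_sq {d : ℕ} {f : Rd d → ℝ} (hf : Integrable f) (hf2 : MemLp f 2) :
    ∫⁻ ξ, ‖fourierR d f ξ‖ₑ ^ 2 = ∫⁻ x, ‖f x‖ₑ ^ 2 := by
  unfold fourierR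
  rw [lintegral_enorm_fourier_sq (integrable_complex_ofReal hf) hf2.ofReal]
  simp [← ofReal_norm]

theorem cv_integrable {d : ℕ} {K b : Rd d → ℝ} (hK : Integrable K) (hb : Integrable b) :
    Integrable (cv d K b) := by
  have := (hb.integrable_convolution (ContinuousLinearMap.mul ℝ ℝ) hK)
  refine this.congr (Filter.Eventually.of_forall fun x => ?_)
  simp only [convolution, cv, ContinuousLinearMap.mul_apply']
  simp_rw [mul_comm]

theorem fourierR_cv {d : ℕ} {K b : Rd d → ℝ} (hK : Integrable K) (hb : Integrable b) (ξ : Rd d) :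
    fourierR d (cv d K b) ξ = fourierR d K ξ * fourierR d b ξ := by
  unfold fourierR
  rw [mul_comm, ← Real.fourier_mul_convolution_eq (integrable_complex_ofReal hb)
    (integrable_complex_ofReal hK)]
  refine congrArg (fun F : Rd d → ℂ => 𝓕 F ξ) (funext fun x => ?_)
  simp only [convolution, cv, ContinuousLinearMap.mul_apply']
  rw [← integral_complex_ofReal]
  congr 1
  ext y
  push_cast
  ring

theorem cv_abs_le {d : ℕ} {K b : Rd d → ℝ} {M : ℝ} (hK : ∀ x, |K x| ≤ M)
    (hb : Integrable b) (x : Rd d) : |cv d K b x| ≤ M * ∫ y, |b y| := by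
  unfold cv
  rw [← integral_const_mul]
  refine norm_integral_le_of_norm_le (G := ℝ) (hb.abs.const_mul M) (Filter.Eventually.of_forall fun y => ?_)
  rw [Real.norm_eq_abs, abs_mul]
  exact mul_le_mul_of_nonneg_right (hK _) (abs_nonneg _)

theorem enorm_cv_le {d : ℕ} (K b : Rd d → ℝ) (x : Rd d) :
    ‖cv d K b x‖ₑ ≤ ∫⁻ y, ‖K (x - y)‖ₑ * ‖b y‖ₑ := by
  refine (enorm_integral_le_lintegral_enorm _).trans_eq ?_
  simp [enorm_mul]

theorem cv_memLp {d : ℕ} {K b : Rd d → ℝ} {M : ℝ} (hKi : Integrable K) (hK : ∀ x, |K x| ≤ M)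
    (hb : Integrable b) : MemLp (cv d K b) 2 :=
  memLp_two_of_bounded (cv_integrable hKi hb) (cv_abs_le hK hb)

theorem fourierR_add {d : ℕ} {f g : Rd d → ℝ} (hf : Integrable f) (hg : Integrable g) (ξ : Rd d) :
    fourierR d (fun x => f x + g x) ξ = fourierR d f ξ + fourierR d g ξ := by
  simp only [fourierR_eq, Complex.ofReal_add, mul_add]
  refine integral_add ?_ ?_
  · have := (Real.fourierIntegral_convergent_iff (μ := volume) ξ).2 (integrable_complex_ofReal hf)
    simpa [Circle.smul_def, Real.fourierChar_apply, mul_assoc] using this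
  · have := (Real.fourierIntegral_convergent_iff (μ := volume) ξ).2 (integrable_complex_ofReal hg)
    simpa [Circle.smul_def, Real.fourierChar_apply, mul_assoc] using this

theorem fourierR_sum {d : ℕ} {ι : Type*} (s : Finset ι) {f : ι → Rd d → ℝ}
    (hf : ∀ i ∈ s, Integrable (f i)) (ξ : Rd d) :
    fourierR d (fun x => ∑ i ∈ s, f i x) ξ = ∑ i ∈ s, fourierR d (f i) ξ := by
  classical
  induction s using Finset.induction_on with
  | empty => simp [fourierR_eq]
  | insert a s ha ih =>
    simp only [Finset.sum_insert ha]
    rw [fourierR_add (hf a (by simp)) (integrable_finsetSum s fun i hi => hf i (by simp [hi])),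
      ih fun i hi => hf i (by simp [hi])]

/-- The radial part `φ(x) |x|^{-d}` of the kernels at unit scale. -/
def profile (d : ℕ) (φ : Rd d → ℝ) (x : Rd d) : ℝ := φ x * ‖x‖ ^ (-(d : ℤ))

theorem Kker_eq_profile {d : ℕ} (φ Om : Rd d → ℝ) (k : ℤ) (x : Rd d) :
    Kker d φ Om k x = (2:ℝ) ^ (-(k * d)) * (profile d φ ((2:ℝ) ^ (-k) • x) * Om x) := by
  have h2 : (0:ℝ) < (2:ℝ) ^ (-k) := by positivity
  have : ‖(2:ℝ) ^ (-k) • x‖ ^ (-(d : ℤ)) = (2:ℝ) ^ (k * d) * ‖x‖ ^ (-(d : ℤ)) := by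
    rw [norm_smul, Real.norm_of_nonneg h2.le, mul_zpow, ← zpow_mul]
    congr 2
    ring
  rw [Kker, profile, this, zpow_neg _ (k * (d:ℤ))]
  have h3 : (2:ℝ) ^ (k * (d:ℤ)) ≠ 0 := by positivity
  generalize (2:ℝ) ^ (k * (d:ℤ)) = a at *
  field_simp

section Profile

variable {d : ℕ} {φ : Rd d → ℝ}

theorem profile_support (hφ : AdmissiblePhi d φ) {x : Rd d} (hx : profile d φ x ≠ 0) :
    1 / 16 < ‖x‖ ∧ ‖x‖ < 1 / 4 := by
  have h1 : φ x ≠ 0 := fun h => hx (by simp [profile, h])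
  have := hφ.2.1 (subset_tsupport φ h1)
  norm_num at this
  exact this

theorem profile_contDiff (hφ : AdmissiblePhi d φ) : ContDiff ℝ (⊤ : ℕ∞) (profile d φ) := by
  rw [contDiff_iff_contDiffAt]
  intro x
  by_cases hx : x ∈ tsupport φ
  · have h0 : x ≠ 0 := by
      rintro rfl
      have := hφ.2.1 hx
      norm_num at this
    have : profile d φ = fun x => φ x * (‖x‖ ^ d)⁻¹ := by
      ext y
      simp [profile]
    rw [this]
    exact hφ.1.contDiffAt.mul (((contDiffAt_norm ℝ h0).pow d).inv (pow_ne_zero _ (by simpa using h0)))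
  · rw [notMem_tsupport_iff_eventuallyEq] at hx
    refine contDiffAt_const (c := (0:ℝ)) |>.congr_of_eventuallyEq ?_
    filter_upwards [hx] with y hy
    simp [profile, hy]

theorem profile_hasCompactSupport (hφ : AdmissiblePhi d φ) :
    HasCompactSupport (profile d φ) :=
  HasCompactSupport.intro (isCompact_closedBall (0 : Rd d) 1) fun x hx => by
    by_contra h
    exact hx (by simpa using (profile_support hφ h).2.le.trans (by norm_num))

theorem exists_profile_bound (hφ : AdmissiblePhi d φ) :
    ∃ C : ℝ, 0 < C ∧ ∀ x, |profile d φ x| ≤ C := by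
  obtain ⟨C, hC⟩ := (profile_hasCompactSupport hφ).exists_bound_of_continuous
    (profile_contDiff hφ).continuous
  exact ⟨max C 1, by positivity, fun x => (hC x).trans (le_max_left _ _)⟩

theorem Kker_support (hφ : AdmissiblePhi d φ) {Om : Rd d → ℝ} {k : ℤ} {x : Rd d}
    (hx : Kker d φ Om k x ≠ 0) :
    x ≠ 0 ∧ Om x ≠ 0 ∧ ‖(2:ℝ) ^ (-k) • x‖ < 1 / 4 := by
  rw [Kker_eq_profile] at hx
  have h1 : profile d φ ((2:ℝ) ^ (-k) • x) ≠ 0 := fun h => hx (by rw [h]; ring)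
  have h2 : Om x ≠ 0 := fun h => hx (by rw [h]; ring)
  have h3 := profile_support hφ h1
  refine ⟨?_, h2, h3.2⟩
  rintro rfl
  norm_num at h3

theorem abs_Kker_le {Om : Rd d → ℝ} {H C : ℝ} (hC : ∀ x, |profile d φ x| ≤ C)
    (hH : ∀ x, |Om x| ≤ H) (k : ℤ) (x : Rd d) :
    |Kker d φ Om k x| ≤ C * H * (2:ℝ) ^ (-(k * d)) := by
  have hC0 : 0 ≤ C := (abs_nonneg _).trans (hC 0)
  rw [Kker_eq_profile, abs_mul, abs_mul, abs_of_pos (by positivity : (0:ℝ) < 2 ^ (-(k * (d:ℤ))))]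
  rw [mul_comm]
  gcongr
  · exact hC _
  · exact hH _

theorem Kker_aestronglyMeasurable (hφ : AdmissiblePhi d φ) {Om : Rd d → ℝ}
    (hOm : AEStronglyMeasurable Om volume) (k : ℤ) :
    AEStronglyMeasurable (Kker d φ Om k) volume := by
  have : Kker d φ Om k = fun x => (2:ℝ) ^ (-(k * d)) *
      (profile d φ ((2:ℝ) ^ (-k) • x) * Om x) := funext fun x => Kker_eq_profile φ Om k x
  rw [this]
  have hc := (profile_contDiff hφ).continuous
  have : Continuous fun x : Rd d => profile d φ ((2:ℝ) ^ (-k) • x) := by fun_prop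
  exact (this.aestronglyMeasurable.mul hOm).const_mul _

theorem Kker_integrable (hφ : AdmissiblePhi d φ) {Om : Rd d → ℝ} {H : ℝ}
    (hOm : AEStronglyMeasurable Om volume) (hH : ∀ x, |Om x| ≤ H) (k : ℤ) :
    Integrable (Kker d φ Om k) := by
  obtain ⟨C, -, hC⟩ := exists_profile_bound hφ
  have hsupp : Function.support (Kker d φ Om k) ⊆ closedBall 0 (2 ^ k) := by
    intro x hx
    have := (Kker_support hφ hx).2.2
    rw [norm_smul, Real.norm_of_nonneg (by positivity), zpow_neg] at this
    have h2 : (0:ℝ) < 2 ^ k := by positivity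
    rw [mem_closedBall_zero_iff]
    rw [inv_mul_lt_iff₀ h2] at this
    nlinarith
  rw [← integrableOn_iff_integrable_of_support_subset hsupp]
  refine Integrable.mono' (g := fun _ => C * H * (2:ℝ) ^ (-(k * d))) ?_
    (Kker_aestronglyMeasurable hφ hOm k).restrict
    (Filter.Eventually.of_forall fun x => abs_Kker_le hC hH k x)
  exact integrableOn_const (isCompact_closedBall _ _).measure_lt_top.ne

theorem Kker_scaling {Om : Rd d → ℝ} (hφ : AdmissiblePhi d φ) (hOm : Homogeneous0 d Om) (k : ℤ)
    (x : Rd d) :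
    Kker d φ Om k x = (2:ℝ) ^ (-(k * d)) * Kker d φ Om 0 ((2:ℝ) ^ (-k) • x) := by
  rw [Kker_eq_profile, Kker_eq_profile]
  rcases eq_or_ne x 0 with rfl | hx
  · have : profile d φ 0 = 0 := by
      by_contra h
      have := profile_support hφ h
      norm_num at this
    simp [this]
  · rw [hOm x hx _ (by positivity : (0:ℝ) < 2 ^ (-k))]
    simp

theorem fourierR_Kker {Om : Rd d → ℝ} (hφ : AdmissiblePhi d φ) (hOm : Homogeneous0 d Om) (k : ℤ)
    (ξ : Rd d) :
    fourierR d (Kker d φ Om k) ξ = fourierR d (Kker d φ Om 0) ((2:ℝ) ^ k • ξ) := by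
  rw [fourierR_eq, fourierR_eq]
  have h := Measure.integral_comp_smul (volume : Measure (Rd d))
    (fun x => Complex.exp (↑(-2 * Real.pi * ⟪x, (2:ℝ) ^ k • ξ⟫) * Complex.I) *
      (Kker d φ Om 0 x : ℂ)) ((2:ℝ) ^ (-k))
  have h2 : |(((2:ℝ) ^ (-k)) ^ Module.finrank ℝ (Rd d))⁻¹| = (2:ℝ) ^ (k * d) := by
    rw [abs_of_pos (by positivity)]
    simp [zpow_mul]
  rw [h2] at h
  have h3 : (2:ℝ) ^ (k * (d:ℤ)) ≠ 0 := by positivity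
  rw [← inv_smul_eq_iff₀ h3, ← integral_smul] at h
  rw [← h]
  congr 1
  ext x
  have h5 : -2 * Real.pi * ⟪(2:ℝ) ^ (-k) • x, (2:ℝ) ^ k • ξ⟫ = -2 * Real.pi * ⟪x, ξ⟫ := by
    rw [real_inner_smul_left, real_inner_smul_right, ← mul_assoc ((2:ℝ) ^ (-k)),
      ← zpow_add₀ (two_ne_zero' ℝ), neg_add_cancel, zpow_zero, one_mul]
  rw [Kker_scaling hφ hOm k x, h5, zpow_neg _ (k * (d:ℤ)), Complex.real_smul]
  push_cast
  ring

end Profile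

theorem fourier_decay_uniform {E : Type*} [NormedAddCommGroup E] [NormedSpace ℝ E] (N : ℕ) :
    ∀ G : ℝ × E → ℂ, ContDiff ℝ (⊤ : ℕ∞) G → HasCompactSupport G →
      ∃ C : ℝ, 0 ≤ C ∧ ∀ (y : E) (t : ℝ), |t| ^ N * ‖𝓕 (fun ρ : ℝ => G (ρ, y)) t‖ ≤ C := by
  induction N with
  | zero =>
    intro G hG hGc
    obtain ⟨M, hM⟩ := hGc.exists_bound_of_continuous hG.continuous
    obtain ⟨R, hR⟩ := hGc.isCompact.isBounded.subset_closedBall (0 : ℝ × E)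
    have hz : ∀ (y : E) (ρ : ℝ), ρ ∉ Icc (-R) R → G (ρ, y) = 0 := by
      intro y ρ hρ
      by_contra h
      have := hR (subset_tsupport _ h)
      rw [mem_closedBall_zero_iff] at this
      have h2 : |ρ| ≤ R := (le_max_left _ _).trans this
      exact hρ (abs_le.1 h2)
    have hM0 : 0 ≤ M := (norm_nonneg _).trans (hM (0, 0))
    refine ⟨M * volume.real (Icc (-R) R), by positivity, fun y t => ?_⟩
    rw [pow_zero, one_mul]
    refine (VectorFourier.norm_fourierIntegral_le_integral_norm _ _ _ _ _).trans ?_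
    rw [← setIntegral_eq_integral_of_forall_compl_eq_zero (s := Icc (-R) R)
      (fun ρ hρ => by rw [hz y ρ hρ, norm_zero])]
    refine (Real.le_norm_self _).trans ?_
    refine norm_setIntegral_le_of_norm_le_const (by simp) fun ρ _ => ?_
    simpa using hM _
  | succ N ih =>
    intro G hG hGc
    have hG' : ContDiff ℝ (⊤ : ℕ∞) (fun p => fderiv ℝ G p (1, 0)) :=
      (hG.fderiv_right (m := (⊤ : ℕ∞)) (by simp)).clm_apply contDiff_const
    have hGc' : HasCompactSupport (fun p => fderiv ℝ G p (1, 0)) :=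
      (hGc.fderiv ℝ).comp_left (g := fun L : ℝ × E →L[ℝ] ℂ => L (1, 0)) (by simp)
    obtain ⟨C, hC0, hC⟩ := ih _ hG' hGc'
    refine ⟨C, hC0, fun y t => ?_⟩
    have hder : ∀ ρ, HasDerivAt (fun ρ : ℝ => G (ρ, y)) (fderiv ℝ G (ρ, y) (1, 0)) ρ := by
      intro ρ
      have h1 : HasFDerivAt G (fderiv ℝ G (ρ, y)) (ρ, y) :=
        ((hG.differentiable (by simp)) _).hasFDerivAt
      exact h1.comp_hasDerivAt ρ ((hasDerivAt_id ρ).prodMk (hasDerivAt_const ρ y))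
    have hcs : ∀ F : ℝ × E → ℂ, Continuous F → HasCompactSupport F →
        Integrable (fun ρ : ℝ => F (ρ, y)) := by
      intro F hF hFc
      refine Continuous.integrable_of_hasCompactSupport (by fun_prop) ?_
      refine HasCompactSupport.intro (hFc.isCompact.image continuous_fst) fun ρ hρ => ?_
      by_contra h
      exact hρ ⟨(ρ, y), subset_tsupport _ h, rfl⟩
    have hd : deriv (fun ρ : ℝ => G (ρ, y)) = fun ρ => fderiv ℝ G (ρ, y) (1, 0) :=
      funext fun ρ => (hder ρ).deriv
    have key := congrFun (Real.fourier_deriv (hcs G hG.continuous hGc)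
      (fun ρ => (hder ρ).differentiableAt) (hd ▸ hcs _ hG'.continuous hGc')) t
    have h2 := hC y t
    rw [hd] at key
    rw [key, norm_smul] at h2
    refine le_trans ?_ h2
    have h3 : |t| ≤ ‖(2 * Real.pi * Complex.I * t : ℂ)‖ := by
      simp only [norm_mul, Complex.norm_I, Complex.norm_real, Complex.norm_ofNat, mul_one,
        Real.norm_eq_abs]
      have := Real.pi_gt_three
      rw [abs_of_pos Real.pi_pos]
      nlinarith [abs_nonneg t]
    rw [pow_succ, mul_assoc]
    gcongr

theorem exists_unit_bump : ∃ α : ℝ → ℝ, ContDiff ℝ (⊤ : ℕ∞) α ∧ tsupport α ⊆ Icc 1 2 ∧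
    ∫ ρ, α ρ = 1 := by
  let B : ContDiffBump (3 / 2 : ℝ) := ⟨1 / 4, 1 / 2, by norm_num, by norm_num⟩
  refine ⟨B.normed volume, B.contDiff_normed, ?_, B.integral_normed⟩
  rw [B.tsupport_normed_eq, Real.closedBall_eq_Icc]
  norm_num [B]

/-- The profile dilated by `ρ`, cut off in `ρ`. -/
def dilatedProfile (d : ℕ) (φ : Rd d → ℝ) (α : ℝ → ℝ) (p : ℝ × Rd d) : ℂ :=
  ((α p.1 * p.1 ^ d * profile d φ (p.1 • p.2) : ℝ) : ℂ)

section Decay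

variable {d : ℕ} {φ : Rd d → ℝ} {α : ℝ → ℝ}

theorem dilatedProfile_contDiff (hφ : AdmissiblePhi d φ) (hα : ContDiff ℝ (⊤ : ℕ∞) α) :
    ContDiff ℝ (⊤ : ℕ∞) (dilatedProfile d φ α) := by
  refine Complex.ofRealCLM.contDiff.comp ?_
  refine ((hα.comp contDiff_fst).mul (contDiff_fst.pow d)).mul ?_
  exact (profile_contDiff hφ).comp (contDiff_fst.smul contDiff_snd)

theorem dilatedProfile_support (hφ : AdmissiblePhi d φ) (hα : tsupport α ⊆ Icc 1 2)
    {p : ℝ × Rd d} (hp : dilatedProfile d φ α p ≠ 0) :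
    p.1 ∈ Icc (1:ℝ) 2 ∧ 1 / 32 ≤ ‖p.2‖ ∧ ‖p.2‖ ≤ 1 := by
  have h1 : α p.1 ≠ 0 := fun h => hp (by simp [dilatedProfile, h])
  have h2 : profile d φ (p.1 • p.2) ≠ 0 := fun h => hp (by simp [dilatedProfile, h])
  have h3 := hα (subset_tsupport _ h1)
  have h4 := profile_support hφ h2
  rw [norm_smul, Real.norm_of_nonneg (by linarith [h3.1])] at h4
  refine ⟨h3, ?_, ?_⟩ <;> nlinarith [h3.1, h3.2, norm_nonneg p.2]

theorem dilatedProfile_hasCompactSupport (hφ : AdmissiblePhi d φ) (hα : tsupport α ⊆ Icc 1 2) :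
    HasCompactSupport (dilatedProfile d φ α) :=
  HasCompactSupport.intro ((isCompact_Icc (a := (1:ℝ)) (b := 2)).prod
    (isCompact_closedBall (0 : Rd d) 1)) fun p hp => by
    by_contra h
    have := dilatedProfile_support hφ hα h
    exact hp ⟨this.1, by simpa using this.2.2⟩

theorem fourierR_Kker_zero_dilate {Om : Rd d → ℝ} (hOm : Homogeneous0 d Om)
    (ξ : Rd d) {ρ : ℝ} (hρ : 0 < ρ) :
    fourierR d (Kker d φ Om 0) ξ =
      ∫ y, Complex.exp (↑(-2 * Real.pi * (ρ * ⟪y, ξ⟫)) * Complex.I) *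
        ((ρ ^ d * profile d φ (ρ • y) * Om y : ℝ) : ℂ) := by
  rw [fourierR_eq]
  have h := Measure.integral_comp_smul (volume : Measure (Rd d))
    (fun x => Complex.exp (↑(-2 * Real.pi * ⟪x, ξ⟫) * Complex.I) *
      (Kker d φ Om 0 x : ℂ)) ρ
  have h2 : |(ρ ^ Module.finrank ℝ (Rd d))⁻¹| = (ρ ^ d)⁻¹ := by
    rw [abs_of_pos (by positivity)]
    simp
  have h3 : (ρ ^ d)⁻¹ ≠ 0 := by positivity
  rw [h2, ← inv_smul_eq_iff₀ h3, ← integral_smul] at h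
  rw [← h]
  congr 1
  ext y
  have h4 : profile d φ (ρ • y) * Om (ρ • y) = profile d φ (ρ • y) * Om y := by
    rcases eq_or_ne y 0 with rfl | hy
    · simp
    · rw [hOm y hy ρ hρ]
  rw [Kker_eq_profile, real_inner_smul_left, inv_inv, Complex.real_smul]
  simp only [neg_zero, zero_mul, zpow_zero, one_smul, one_mul]
  rw [h4]
  push_cast
  ring

/-- Averaging over dilations turns the Fourier transform of the kernel into a superposition of
one-dimensional Fourier transforms. -/
theorem fourierR_Kker_zero_eq_average {Om : Rd d → ℝ} (hOm : Homogeneous0 d Om)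
    (hφ : AdmissiblePhi d φ) (hα : ContDiff ℝ (⊤ : ℕ∞) α) (hαs : tsupport α ⊆ Icc 1 2)
    (hα1 : ∫ ρ, α ρ = 1) (hm : AEStronglyMeasurable Om volume) {H : ℝ} (hH : ∀ x, |Om x| ≤ H)
    (ξ : Rd d) :
    fourierR d (Kker d φ Om 0) ξ =
      ∫ y, (Om y : ℂ) * 𝓕 (fun ρ : ℝ => dilatedProfile d φ α (ρ, y)) ⟪y, ξ⟫ := by
  have h1 : fourierR d (Kker d φ Om 0) ξ =
      ∫ ρ, (α ρ : ℂ) * fourierR d (Kker d φ Om 0) ξ := by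
    rw [integral_mul_const, integral_complex_ofReal, hα1]
    simp
  have h2 : ∀ ρ, (α ρ : ℂ) * fourierR d (Kker d φ Om 0) ξ =
      ∫ y, Complex.exp (↑(-2 * Real.pi * (ρ * ⟪y, ξ⟫)) * Complex.I) *
        (dilatedProfile d φ α (ρ, y) * (Om y : ℂ)) := by
    intro ρ
    by_cases hρ : α ρ = 0
    · simp [dilatedProfile, hρ]
    have : 0 < ρ := by linarith [(hαs (subset_tsupport _ hρ)).1]
    rw [fourierR_Kker_zero_dilate hOm ξ this, ← integral_const_mul]
    congr 1
    ext y
    simp only [dilatedProfile]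
    push_cast
    ring
  rw [h1]
  simp_rw [h2]
  rw [integral_integral_swap]
  · congr 1
    ext y
    rw [Real.fourier_eq', ← integral_const_mul]
    congr 1
    ext ρ
    have : ⟪ρ, ⟪y, ξ⟫⟫ = ρ * ⟪y, ξ⟫ := by simp [mul_comm]
    rw [this, smul_eq_mul]
    ring
  · have hGc := (dilatedProfile_contDiff (d := d) hφ hα).continuous
    obtain ⟨M, hM⟩ := (dilatedProfile_hasCompactSupport (d := d) hφ hαs).exists_bound_of_continuous
      hGc
    have hM0 : 0 ≤ M := (norm_nonneg _).trans (hM 0)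
    have hH0 : 0 ≤ H := (abs_nonneg _).trans (hH 0)
    set S : Set (ℝ × Rd d) := Icc (1:ℝ) 2 ×ˢ closedBall (0 : Rd d) 1 with hS
    have hSc : IsCompact S := isCompact_Icc.prod (isCompact_closedBall _ _)
    have hi : Integrable (S.indicator fun _ => M * H) (volume.prod volume) :=
      (integrable_indicator_iff hSc.measurableSet).2
        (integrableOn_const hSc.measure_lt_top.ne)
    refine hi.mono' ?_ (Filter.Eventually.of_forall fun p => ?_)
    · have hO : AEStronglyMeasurable (fun p : ℝ × Rd d => (Om p.2 : ℂ)) (volume.prod volume) :=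
        Complex.continuous_ofReal.comp_aestronglyMeasurable hm.comp_snd
      have he : Continuous fun p : ℝ × Rd d =>
          Complex.exp (↑(-2 * Real.pi * (p.1 * ⟪p.2, ξ⟫)) * Complex.I) := by fun_prop
      exact he.aestronglyMeasurable.mul (hGc.aestronglyMeasurable.mul hO)
    · simp only [Function.uncurry]
      rw [norm_mul, Complex.norm_exp_ofReal_mul_I, one_mul, norm_mul, Complex.norm_real]
      by_cases hp : dilatedProfile d φ α p = 0
      · simp only [hp, norm_zero, zero_mul]
        exact indicator_nonneg (fun _ _ => by positivity) _
      · have h5 := dilatedProfile_support hφ hαs hp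
        rw [indicator_of_mem (show p ∈ S from ⟨h5.1, by simpa using h5.2.2⟩)]
        exact mul_le_mul (hM _) (hH _) (norm_nonneg _) hM0

end Decay

theorem exists_kernel_decay {d : ℕ} {φ : Rd d → ℝ} (hφ : AdmissiblePhi d φ) (N : ℕ) :
    ∃ C : ℝ, 0 < C ∧ ∀ Om : Rd d → ℝ, Homogeneous0 d Om → AEStronglyMeasurable Om volume →
      ∀ H : ℝ, (∀ x, |Om x| ≤ H) → ∀ (ξ : Rd d) (w : ℝ), 0 ≤ w →
      (∀ x, Om x ≠ 0 → w * ‖x‖ * ‖ξ‖ ≤ |⟪x, ξ⟫|) →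
      ‖fourierR d (Kker d φ Om 0) ξ‖ * (w * ‖ξ‖) ^ N ≤ C * H := by
  obtain ⟨α, hα, hαs, hα1⟩ := exists_unit_bump
  obtain ⟨C, hC0, hC⟩ := fourier_decay_uniform N _ (dilatedProfile_contDiff hφ hα)
    (dilatedProfile_hasCompactSupport hφ hαs)
  set V := volume.real (closedBall (0 : Rd d) 1) with hV
  refine ⟨(32 ^ N * C + 1) * (V + 1), by positivity, fun Om hOm hm H hH ξ w hw hlow => ?_⟩
  have hH0 : 0 ≤ H := (abs_nonneg _).trans (hH 0)
  rw [fourierR_Kker_zero_eq_average hOm hφ hα hαs hα1 hm hH]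
  have hb : ∀ y, ‖((w * ‖ξ‖) ^ N : ℝ) • ((Om y : ℂ) *
      𝓕 (fun ρ : ℝ => dilatedProfile d φ α (ρ, y)) ⟪y, ξ⟫)‖ ≤
      (closedBall (0 : Rd d) 1).indicator (fun _ => 32 ^ N * C * H) y := by
    intro y
    by_cases hy : 1 / 32 ≤ ‖y‖ ∧ ‖y‖ ≤ 1
    · rw [indicator_of_mem (by simpa using hy.2)]
      by_cases hO : Om y = 0
      · simp only [hO, Complex.ofReal_zero, zero_mul, smul_zero, norm_zero]
        positivity
      have h1 := hlow y hO
      have h2 : w * ‖ξ‖ ≤ 32 * |⟪y, ξ⟫| := by nlinarith [mul_nonneg hw (norm_nonneg ξ)]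
      have h3 := hC y ⟪y, ξ⟫
      rw [norm_smul, norm_mul, Real.norm_of_nonneg (by positivity), Complex.norm_real]
      calc (w * ‖ξ‖) ^ N * (‖Om y‖ * ‖𝓕 (fun ρ : ℝ => dilatedProfile d φ α (ρ, y)) ⟪y, ξ⟫‖)
          ≤ (32 * |⟪y, ξ⟫|) ^ N *
            (H * ‖𝓕 (fun ρ : ℝ => dilatedProfile d φ α (ρ, y)) ⟪y, ξ⟫‖) := by
            gcongr
            exact hH y
        _ = 32 ^ N * H *
            (|⟪y, ξ⟫| ^ N * ‖𝓕 (fun ρ : ℝ => dilatedProfile d φ α (ρ, y)) ⟪y, ξ⟫‖) := by ring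
        _ ≤ 32 ^ N * H * C := by gcongr
        _ = _ := by ring
    · have : (fun ρ : ℝ => dilatedProfile d φ α (ρ, y)) = fun _ => 0 := by
        ext ρ
        by_contra h
        exact hy (dilatedProfile_support hφ hαs h).2
      rw [this]
      have h0 : 𝓕 (fun _ : ℝ => (0:ℂ)) ⟪y, ξ⟫ = 0 := by simp [Real.fourier_eq']
      rw [h0]
      simp only [mul_zero, smul_zero, norm_zero]
      exact indicator_nonneg (fun _ _ => by positivity) _
  have hi : Integrable ((closedBall (0 : Rd d) 1).indicator fun _ => 32 ^ N * C * H) :=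
    (integrable_indicator_iff measurableSet_closedBall).2
      (integrableOn_const (isCompact_closedBall (0 : Rd d) 1).measure_lt_top.ne)
  have h4 := norm_integral_le_of_norm_le hi (Filter.Eventually.of_forall hb)
  rw [integral_smul, norm_smul, Real.norm_of_nonneg (by positivity), integral_indicator_const _
    measurableSet_closedBall, ← hV, smul_eq_mul] at h4
  rw [mul_comm]
  refine h4.trans ?_
  have hV0 : 0 ≤ V := measureReal_nonneg
  have : 0 ≤ 32 ^ N * C * H := by positivity
  nlinarith [mul_nonneg hV0 hH0]

section Cubes

variable {d : ℕ}

theorem measurableSet_dcube (w : Fin d → ℝ) (k : ℤ) (m : Fin d → ℤ) :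
    MeasurableSet (dcube d w k m) := by
  simp only [dcube, ofPred_forall]
  refine MeasurableSet.iInter fun i => ?_
  have hc : Continuous fun x : Rd d => x i := by fun_prop
  exact (measurableSet_le measurable_const hc.measurable).inter
    (measurableSet_lt hc.measurable measurable_const)

theorem volume_dcube (w : Fin d → ℝ) (k : ℤ) (m : Fin d → ℤ) :
    volume (dcube d w k m) = ENNReal.ofReal ((2:ℝ) ^ (k * d)) := by
  have h1 : dcube d w k m = (MeasurableEquiv.toLp 2 (Fin d → ℝ)).symm ⁻¹'
      (univ.pi fun i => Ico ((2:ℝ) ^ k * (w i + m i)) ((2:ℝ) ^ k * (w i + m i + 1))) := by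
    ext x
    simp [dcube, mem_pi]
  rw [h1, (EuclideanSpace.volume_preserving_symm_measurableEquiv_toLp (Fin d)).measure_preimage
    (MeasurableSet.univ_pi fun i => measurableSet_Ico).nullMeasurableSet, Real.volume_pi_Ico]
  have h2 : ∀ i, (2:ℝ) ^ k * (w i + m i + 1) - (2:ℝ) ^ k * (w i + m i) = (2:ℝ) ^ k := by
    intro i; ring
  simp only [h2, Finset.prod_const, Finset.card_univ, Fintype.card_fin]
  rw [← ENNReal.ofReal_pow (by positivity), zpow_mul, zpow_natCast]

theorem norm_le_sqrt_mul_of_abs_le {x : Rd d} {a : ℝ} (ha : 0 ≤ a) (h : ∀ i, |x i| ≤ a) :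
    ‖x‖ ≤ Real.sqrt d * a := by
  rw [EuclideanSpace.norm_eq]
  have h1 : ∑ i, ‖x i‖ ^ 2 ≤ d * a ^ 2 := by
    refine (Finset.sum_le_sum fun i _ => pow_le_pow_left₀ (norm_nonneg _) (h i) 2).trans ?_
    simp
  refine (Real.sqrt_le_sqrt h1).trans ?_
  rw [Real.sqrt_mul (by positivity), Real.sqrt_sq ha]

theorem norm_sub_le_of_mem_dcube {w : Fin d → ℝ} {k : ℤ} {m : Fin d → ℤ} {x y : Rd d}
    (hx : x ∈ dcube d w k m) (hy : y ∈ dcube d w k m) : ‖x - y‖ ≤ Real.sqrt d * (2:ℝ) ^ k := by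
  refine norm_le_sqrt_mul_of_abs_le (by positivity) fun i => ?_
  have h1 := hx i
  have h2 := hy i
  rw [PiLp.sub_apply, abs_le]
  constructor <;> nlinarith

theorem lintegral_dilate {F : Rd d → ℝ≥0∞} (k : ℤ) (y : Rd d) :
    ∫⁻ x, F ((2:ℝ) ^ (-k) • (x - y)) = ENNReal.ofReal ((2:ℝ) ^ (k * d)) * ∫⁻ x, F x := by
  rw [lintegral_sub_right_eq_self (fun x => F ((2:ℝ) ^ (-k) • x))]
  have h0 : (2:ℝ) ^ (-k) ≠ 0 := by positivity
  have h := (Measure.map_addHaar_smul (volume : Measure (Rd d)) h0)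
  have h2 : ∫⁻ x, F ((2:ℝ) ^ (-k) • x) =
      ∫⁻ x, F x ∂(Measure.map (fun x : Rd d => (2:ℝ) ^ (-k) • x) volume) :=
    ((Homeomorph.smulOfNeZero _ h0).toMeasurableEquiv.measurableEmbedding.lintegral_map F).symm
  rw [h2, h, lintegral_smul_measure, smul_eq_mul]
  congr 2
  rw [abs_of_pos (by positivity)]
  simp [zpow_mul]

end Cubes

/-- A finite family of pairwise disjoint dyadic cubes with functions of mean zero on them whose
averages are controlled by `A`. -/
structure BadFamily (d : ℕ) (𝒬 : Finset (ℤ × (Fin d → ℤ)))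
    (b : ℤ × (Fin d → ℤ) → Rd d → ℝ) (A : ℝ) : Prop where
  disj : ∀ q ∈ 𝒬, ∀ q' ∈ 𝒬, q ≠ q' → Disjoint (dcube d 0 q.1 q.2) (dcube d 0 q'.1 q'.2)
  meas : ∀ q ∈ 𝒬, Measurable (b q)
  supp : ∀ q ∈ 𝒬, ∀ x, b q x ≠ 0 → x ∈ dcube d 0 q.1 q.2
  integ : ∀ q ∈ 𝒬, Integrable (b q)
  mean : ∀ q ∈ 𝒬, ∫ x, b q x = 0
  l1 : ∀ q ∈ 𝒬, ∫ x, |b q x| ≤ A * (2:ℝ) ^ (q.1 * d)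

/-- The total volume of a family of dyadic cubes. -/
def cubeSum (d : ℕ) (𝒬 : Finset (ℤ × (Fin d → ℤ))) : ℝ≥0∞ :=
  ∑ q ∈ 𝒬, volume (dcube d 0 q.1 q.2)

namespace BadFamily

variable {d : ℕ} {𝒬 : Finset (ℤ × (Fin d → ℤ))} {b : ℤ × (Fin d → ℤ) → Rd d → ℝ} {A : ℝ}

theorem mono (h : BadFamily d 𝒬 b A) {𝒬' : Finset (ℤ × (Fin d → ℤ))} (hs : 𝒬' ⊆ 𝒬) :
    BadFamily d 𝒬' b A where
  disj q hq q' hq' := h.disj q (hs hq) q' (hs hq')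
  meas q hq := h.meas q (hs hq)
  supp q hq := h.supp q (hs hq)
  integ q hq := h.integ q (hs hq)
  mean q hq := h.mean q (hs hq)
  l1 q hq := h.l1 q (hs hq)

theorem lintegral_enorm_le (h : BadFamily d 𝒬 b A) (hA : 0 ≤ A) {q} (hq : q ∈ 𝒬) :
    ∫⁻ x, ‖b q x‖ₑ ≤ ENNReal.ofReal A * volume (dcube d 0 q.1 q.2) := by
  rw [volume_dcube, ← ENNReal.ofReal_mul hA, ← ofReal_integral_norm_eq_lintegral_enorm
    (h.integ q hq)]
  exact ENNReal.ofReal_le_ofReal (h.l1 q hq)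

theorem sum_volume_le (h : BadFamily d 𝒬 b A) {S : Set (Rd d)}
    (hS : ∀ q ∈ 𝒬, dcube d 0 q.1 q.2 ⊆ S) : cubeSum d 𝒬 ≤ volume S := by
  rw [cubeSum, ← measure_biUnion_finset (fun q hq q' hq' hne => h.disj q hq q' hq' hne)
    (fun q _ => measurableSet_dcube _ _ _)]
  exact measure_mono (iUnion₂_subset hS)

end BadFamily

/-- The sum of the squares is controlled by the ordered pairs. -/
theorem sq_sum_le_two_mul_sum_filter {ι : Type*} (s : Finset ι) (r : ι → ℤ) (a : ι → ℝ≥0∞) :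
    (∑ i ∈ s, a i) ^ 2 ≤ 2 * ∑ i ∈ s, a i * ∑ j ∈ s.filter (fun j => r j ≤ r i), a j := by
  have h1 : (∑ i ∈ s, a i) ^ 2 ≤ ∑ i ∈ s, ∑ j ∈ s,
      ((if r j ≤ r i then a i * a j else 0) + (if r i ≤ r j then a j * a i else 0)) := by
    rw [sq, Finset.sum_mul_sum]
    refine Finset.sum_le_sum fun i _ => Finset.sum_le_sum fun j _ => ?_
    rcases le_total (r j) (r i) with h | h
    · rw [if_pos h]; exact le_self_add
    · rw [if_pos h, mul_comm]; exact le_add_self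
  refine h1.trans_eq ?_
  simp_rw [Finset.sum_add_distrib]
  rw [Finset.sum_comm (f := fun i j => if r i ≤ r j then a j * a i else 0), ← two_mul]
  simp_rw [Finset.mul_sum, Finset.sum_filter, mul_ite, mul_zero]

/-- The normalised indicator of `2^k D` as a convolution kernel. -/
def avgKer (d : ℕ) (D : Set (Rd d)) (k : ℤ) (x y : Rd d) : ℝ≥0∞ :=
  ENNReal.ofReal ((2:ℝ) ^ (-(k * d))) * D.indicator (fun _ => 1) ((2:ℝ) ^ (-k) • (x - y))

/-- The averages of `|β|` over the sets `x - 2^k D`. -/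
def avgOver (d : ℕ) (D : Set (Rd d)) (k : ℤ) (β : Rd d → ℝ) (x : Rd d) : ℝ≥0∞ :=
  ∫⁻ y, avgKer d D k x y * ‖β y‖ₑ

theorem measurable_avgKer {d : ℕ} {D : Set (Rd d)} (hD : MeasurableSet D) (k : ℤ) :
    Measurable fun p : Rd d × Rd d => avgKer d D k p.1 p.2 := by
  have h1 : Measurable (D.indicator (fun _ => (1:ℝ≥0∞))) := measurable_const.indicator hD
  have h2 : Measurable fun p : Rd d × Rd d => (2:ℝ) ^ (-k) • (p.1 - p.2) :=
    Continuous.measurable (by fun_prop)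
  exact (h1.comp h2).const_mul _

theorem measurable_avgOver {d : ℕ} {D : Set (Rd d)} (hD : MeasurableSet D) (k : ℤ)
    {β : Rd d → ℝ} (hβ : Measurable β) : Measurable (avgOver d D k β) :=
  ((measurable_avgKer hD k).mul (hβ.comp measurable_snd).enorm).lintegral_prod_right'

theorem lintegral_kernel_mul_le {X : Type*} [MeasurableSpace X] {μ : Measure X} [SFinite μ]
    {κ : X → X → ℝ≥0∞} (hκ : Measurable fun p : X × X => κ p.1 p.2)
    {β R : X → ℝ≥0∞} (hβ : Measurable β) (hR : Measurable R) {M : ℝ≥0∞}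
    (hM : ∀ y, β y ≠ 0 → ∫⁻ x, κ x y * R x ∂μ ≤ M) :
    ∫⁻ x, (∫⁻ y, κ x y * β y ∂μ) * R x ∂μ ≤ M * ∫⁻ y, β y ∂μ := by
  have h1 : ∀ x, Measurable fun y => κ x y := fun x => hκ.comp measurable_prodMk_left
  have h2 : ∀ y, Measurable fun x => κ x y := fun y => hκ.comp measurable_prodMk_right
  calc ∫⁻ x, (∫⁻ y, κ x y * β y ∂μ) * R x ∂μ
      = ∫⁻ x, ∫⁻ y, (κ x y * β y) * R x ∂μ ∂μ := by
        refine lintegral_congr fun x => ?_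
        rw [lintegral_mul_const _ ((h1 x).fun_mul hβ)]
    _ = ∫⁻ y, ∫⁻ x, (κ x y * β y) * R x ∂μ ∂μ :=
        lintegral_lintegral_swap
          ((hκ.mul (hβ.comp measurable_snd)).mul (hR.comp measurable_fst)).aemeasurable
    _ = ∫⁻ y, β y * ∫⁻ x, κ x y * R x ∂μ ∂μ := by
        refine lintegral_congr fun y => ?_
        rw [← lintegral_const_mul _ ((h2 y).fun_mul hR)]
        exact lintegral_congr fun x => by ring
    _ ≤ ∫⁻ y, M * β y ∂μ := by
        refine lintegral_mono fun y => ?_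
        by_cases hy : β y = 0
        · simp [hy]
        · exact (mul_le_mul_right (hM y hy) _).trans_eq (mul_comm _ _)
    _ = M * ∫⁻ y, β y ∂μ := lintegral_const_mul _ hβ

theorem lintegral_avgOver_mul_le {d : ℕ} {D : Set (Rd d)} (hD : MeasurableSet D) (k : ℤ)
    {β : Rd d → ℝ} (hβ : Measurable β) {R : Rd d → ℝ≥0∞} (hR : Measurable R) (M : ℝ≥0∞)
    (hM : ∀ y, β y ≠ 0 →
      ∫⁻ x, D.indicator (fun _ => 1) ((2:ℝ) ^ (-k) • (x - y)) * R x ≤ M) :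
    ∫⁻ x, avgOver d D k β x * R x ≤
      ENNReal.ofReal ((2:ℝ) ^ (-(k * d))) * M * ∫⁻ y, ‖β y‖ₑ := by
  refine lintegral_kernel_mul_le (measurable_avgKer hD k) hβ.enorm hR fun y hy => ?_
  have hm : Measurable fun x : Rd d => D.indicator (fun _ => (1:ℝ≥0∞)) ((2:ℝ) ^ (-k) • (x - y)) :=
    (measurable_const.indicator hD).comp (Continuous.measurable (by fun_prop))
  simp only [avgKer, mul_assoc]
  rw [lintegral_const_mul _ (hm.fun_mul hR)]
  exact mul_le_mul_right (hM y (by simpa using hy)) _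

theorem ofReal_two_zpow_mul_cancel (a : ℤ) :
    ENNReal.ofReal ((2:ℝ) ^ (-a)) * ENNReal.ofReal ((2:ℝ) ^ a) = 1 := by
  rw [← ENNReal.ofReal_mul (by positivity), ← zpow_add₀ two_ne_zero]
  simp

theorem volume_dilate_preimage {d : ℕ} (T : Set (Rd d)) (k : ℤ) (y : Rd d) :
    volume ((fun x : Rd d => (2:ℝ) ^ (-k) • (x - y)) ⁻¹' T) =
      ENNReal.ofReal ((2:ℝ) ^ (k * d)) * volume T := by
  have h1 : (fun x : Rd d => (2:ℝ) ^ (-k) • (x - y)) ⁻¹' T =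
      (fun x => x - y) ⁻¹' ((fun x : Rd d => (2:ℝ) ^ (-k) • x) ⁻¹' T) := rfl
  rw [h1]
  simp_rw [sub_eq_add_neg]
  rw [measure_preimage_add_right, Measure.addHaar_preimage_smul _ (by positivity)]
  congr 2
  rw [abs_of_pos (by positivity)]
  simp [zpow_mul]

theorem lintegral_indicator_mul_sum_avgOver_le {d : ℕ} {𝒬 : Finset (ℤ × (Fin d → ℤ))}
    {b : ℤ × (Fin d → ℤ) → Rd d → ℝ} {A : ℝ} (h : BadFamily d 𝒬 b A) (hA : 0 ≤ A) (s : ℕ)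
    {D T : Set (Rd d)} (hD : MeasurableSet D)
    (hDT : ∀ u ∈ D, ∀ u' ∈ D, ∀ r : ℝ, 0 < r → r ≤ 1 → ∀ z : Rd d,
      ‖z‖ ≤ Real.sqrt d * (2:ℝ) ^ (-(s:ℤ)) → u - r • u' + z ∈ T) (m : ℤ)
    (hm : ∀ q ∈ 𝒬, q.1 ≤ m) (y' : Rd d) :
    ∫⁻ x, D.indicator (fun _ => (1:ℝ≥0∞)) ((2:ℝ) ^ (-(m + s)) • (x - y')) *
        ∑ q ∈ 𝒬, avgOver d D (q.1 + s) (b q) x ≤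
      ENNReal.ofReal A * volume D * (ENNReal.ofReal ((2:ℝ) ^ ((m + s) * d)) * volume T) := by
  classical
  have hone : Measurable (D.indicator (fun _ => (1:ℝ≥0∞))) := measurable_const.indicator hD
  set S : Set (Rd d) := (fun x : Rd d => (2:ℝ) ^ (-(m + s)) • (x - y')) ⁻¹' T with hS
  set R : Rd d → ℝ≥0∞ := fun x =>
    D.indicator (fun _ => (1:ℝ≥0∞)) ((2:ℝ) ^ (-(m + s)) • (x - y')) with hR
  have hRm : Measurable R := hone.comp (Continuous.measurable (by fun_prop))
  have hone_le : ∀ u, D.indicator (fun _ => (1:ℝ≥0∞)) u ≤ 1 := fun u =>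
    indicator_le_self' (fun _ _ => zero_le) u
  have hterm : ∀ q ∈ 𝒬, ∫⁻ x, avgOver d D (q.1 + s) (b q) x * R x ≤
      ENNReal.ofReal A * volume D *
        (if dcube d 0 q.1 q.2 ⊆ S then volume (dcube d 0 q.1 q.2) else 0) := by
    intro q hq
    by_cases hsub : dcube d 0 q.1 q.2 ⊆ S
    · rw [if_pos hsub]
      refine (lintegral_avgOver_mul_le hD (q.1 + s) (h.meas q hq) hRm
        (ENNReal.ofReal ((2:ℝ) ^ ((q.1 + s) * d)) * volume D) fun y _ => ?_).trans ?_
      · calc ∫⁻ x, D.indicator (fun _ => 1) ((2:ℝ) ^ (-(q.1 + s)) • (x - y)) * R x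
            ≤ ∫⁻ x, D.indicator (fun _ => 1) ((2:ℝ) ^ (-(q.1 + s)) • (x - y)) := by
              refine lintegral_mono fun x => ?_
              exact (mul_le_mul_right (hone_le _) _).trans_eq (mul_one _)
          _ = _ := by
              rw [lintegral_dilate (F := D.indicator (fun _ => 1)), lintegral_indicator hD]
              simp
      · rw [← mul_assoc, ofReal_two_zpow_mul_cancel, one_mul]
        refine (mul_le_mul_right (h.lintegral_enorm_le hA hq) _).trans_eq ?_
        ring
    · rw [if_neg hsub, mul_zero]
      refine (lintegral_avgOver_mul_le hD (q.1 + s) (h.meas q hq) hRm 0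
        fun y hy => ?_).trans (by simp)
      refine (lintegral_eq_zero_of_ae_eq_zero (Filter.Eventually.of_forall fun x => ?_)).le
      by_contra hne
      refine hsub fun y₂ hy₂ => ?_
      have h1 : (2:ℝ) ^ (-(q.1 + s)) • (x - y) ∈ D := by
        by_contra h1
        exact hne (by rw [indicator_of_notMem h1, zero_mul]; rfl)
      have h2 : (2:ℝ) ^ (-(m + s)) • (x - y') ∈ D := by
        by_contra h2
        exact hne (by simp only [hR]; rw [indicator_of_notMem h2, mul_zero]; rfl)
      have h3 := norm_sub_le_of_mem_dcube hy₂ (h.supp q hq y hy)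
      have hqm := hm q hq
      have h4 := hDT _ h2 _ h1 ((2:ℝ) ^ (q.1 - m)) (by positivity)
        (zpow_le_one_of_nonpos₀ (by norm_num) (by omega))
        ((2:ℝ) ^ (-(m + s)) • (y₂ - y)) (by
          rw [norm_smul, Real.norm_of_nonneg (by positivity)]
          calc (2:ℝ) ^ (-(m + s)) * ‖y₂ - y‖
              ≤ (2:ℝ) ^ (-(m + s)) * (Real.sqrt d * (2:ℝ) ^ q.1) := by gcongr
            _ = Real.sqrt d * (2:ℝ) ^ (q.1 - (m + s)) := by
                rw [zpow_sub₀ two_ne_zero, zpow_neg]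
                ring
            _ ≤ _ := by
                gcongr
                · norm_num
                · omega)
      have h5 : (2:ℝ) ^ (-(m + s)) • (x - y') -
          (2:ℝ) ^ (q.1 - m) • (2:ℝ) ^ (-(q.1 + s)) • (x - y) +
          (2:ℝ) ^ (-(m + s)) • (y₂ - y) = (2:ℝ) ^ (-(m + s)) • (y₂ - y') := by
        rw [smul_smul, ← zpow_add₀ two_ne_zero,
          show q.1 - m + -(q.1 + s) = -(m + s) by ring, ← smul_sub, ← smul_add]
        congr 1
        abel
      rw [h5] at h4
      exact h4
  calc ∫⁻ x, R x * ∑ q ∈ 𝒬, avgOver d D (q.1 + s) (b q) x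
      = ∑ q ∈ 𝒬, ∫⁻ x, avgOver d D (q.1 + s) (b q) x * R x := by
        have hmm : ∀ q ∈ 𝒬, Measurable fun x => avgOver d D (q.1 + s) (b q) x * R x :=
          fun q hq => (measurable_avgOver hD (q.1 + s) (h.meas q hq)).mul hRm
        rw [← lintegral_finsetSum _ hmm]
        refine lintegral_congr fun x => ?_
        rw [mul_comm, Finset.sum_mul]
    _ ≤ ∑ q ∈ 𝒬, ENNReal.ofReal A * volume D *
        (if dcube d 0 q.1 q.2 ⊆ S then volume (dcube d 0 q.1 q.2) else 0) :=
        Finset.sum_le_sum hterm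
    _ = ENNReal.ofReal A * volume D *
        cubeSum d (𝒬.filter fun q => dcube d 0 q.1 q.2 ⊆ S) := by
        rw [← Finset.mul_sum, cubeSum, Finset.sum_filter]
    _ ≤ ENNReal.ofReal A * volume D * volume S := by
        gcongr
        exact (h.mono (Finset.filter_subset _ _)).sum_volume_le
          fun q hq => (Finset.mem_filter.1 hq).2
    _ = _ := by rw [hS, volume_dilate_preimage]

theorem lintegral_avgOver_sq_le {d : ℕ} {𝒬 : Finset (ℤ × (Fin d → ℤ))}
    {b : ℤ × (Fin d → ℤ) → Rd d → ℝ} {A : ℝ} (h : BadFamily d 𝒬 b A) (hA : 0 ≤ A) (s : ℕ)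
    {D T : Set (Rd d)} (hD : MeasurableSet D)
    (hDT : ∀ u ∈ D, ∀ u' ∈ D, ∀ r : ℝ, 0 < r → r ≤ 1 → ∀ z : Rd d,
      ‖z‖ ≤ Real.sqrt d * (2:ℝ) ^ (-(s:ℤ)) → u - r • u' + z ∈ T) :
    ∫⁻ x, (∑ q ∈ 𝒬, avgOver d D (q.1 + s) (b q) x) ^ 2 ≤
      2 * ENNReal.ofReal A ^ 2 * volume D * volume T * cubeSum d 𝒬 := by
  have hm : ∀ q ∈ 𝒬, Measurable (avgOver d D (q.1 + s) (b q)) := fun q hq =>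
    measurable_avgOver hD _ (h.meas q hq)
  have hsum : ∀ q' ∈ 𝒬, Measurable fun x =>
      ∑ q ∈ 𝒬.filter (fun q => q.1 ≤ q'.1), avgOver d D (q.1 + s) (b q) x := fun q' _ =>
    Finset.measurable_sum _ fun q hq => hm q (Finset.mem_filter.1 hq).1
  have houter : ∀ q' ∈ 𝒬, ∫⁻ x, avgOver d D (q'.1 + s) (b q') x *
      ∑ q ∈ 𝒬.filter (fun q => q.1 ≤ q'.1), avgOver d D (q.1 + s) (b q) x ≤
      ENNReal.ofReal A ^ 2 * volume D * volume T * volume (dcube d 0 q'.1 q'.2) := by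
    intro q' hq'
    have hin := lintegral_indicator_mul_sum_avgOver_le
        (h.mono (Finset.filter_subset (fun q => q.1 ≤ q'.1) 𝒬)) hA s hD hDT q'.1
        (fun q hq => (Finset.mem_filter.1 hq).2)
    have h1 := lintegral_avgOver_mul_le hD (q'.1 + s) (h.meas q' hq') (hsum q' hq')
      (ENNReal.ofReal A * volume D * (ENNReal.ofReal ((2:ℝ) ^ ((q'.1 + s) * d)) * volume T))
      fun y _ => hin y
    have h2 := ofReal_two_zpow_mul_cancel ((q'.1 + s) * d)
    have h3 := h.lintegral_enorm_le hA hq'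
    revert h1 h2 h3
    generalize ENNReal.ofReal ((2:ℝ) ^ (-((q'.1 + s) * d))) = c
    generalize ENNReal.ofReal ((2:ℝ) ^ ((q'.1 + s) * d)) = c'
    generalize ∫⁻ y, ‖b q' y‖ₑ = B
    intro h1 h2 h3
    refine le_trans h1 ?_
    calc c * (ENNReal.ofReal A * volume D * (c' * volume T)) * B
        = (c * c') * (ENNReal.ofReal A * volume D * volume T) * B := by ring
      _ ≤ 1 * (ENNReal.ofReal A * volume D * volume T) *
          (ENNReal.ofReal A * volume (dcube d 0 q'.1 q'.2)) := by
          rw [h2]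
          exact mul_le_mul_right h3 _
      _ = _ := by ring
  calc ∫⁻ x, (∑ q ∈ 𝒬, avgOver d D (q.1 + s) (b q) x) ^ 2
      ≤ ∫⁻ x, 2 * ∑ q' ∈ 𝒬, avgOver d D (q'.1 + s) (b q') x *
          ∑ q ∈ 𝒬.filter (fun q => q.1 ≤ q'.1), avgOver d D (q.1 + s) (b q) x :=
        lintegral_mono fun x => sq_sum_le_two_mul_sum_filter 𝒬 (fun q => q.1) _
    _ = 2 * ∑ q' ∈ 𝒬, ∫⁻ x, avgOver d D (q'.1 + s) (b q') x *
          ∑ q ∈ 𝒬.filter (fun q => q.1 ≤ q'.1), avgOver d D (q.1 + s) (b q) x := by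
        have hmm : ∀ q' ∈ 𝒬, Measurable fun x => avgOver d D (q'.1 + s) (b q') x *
          ∑ q ∈ 𝒬.filter (fun q => q.1 ≤ q'.1), avgOver d D (q.1 + s) (b q) x :=
          fun q' hq' => (hm q' hq').mul (hsum q' hq')
        rw [lintegral_const_mul _ (Finset.measurable_fun_sum _ hmm), lintegral_finsetSum _ hmm]
    _ ≤ 2 * ∑ q' ∈ 𝒬, ENNReal.ofReal A ^ 2 * volume D * volume T *
          volume (dcube d 0 q'.1 q'.2) := by
        gcongr with q' hq'
        exact houter q' hq'
    _ = _ := by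
        rw [← Finset.mul_sum, cubeSum]
        ring

section Cells

variable {d : ℕ}

/-- A thin slab of the unit ball has small volume. -/
theorem volume_slab_le {e : Rd d} (he : ‖e‖ = 1) {a : ℝ} (ha : 0 < a) :
    volume {x : Rd d | ‖x‖ ≤ 1 ∧ |⟪x, e⟫| ≤ a} ≤
      ENNReal.ofReal a * volume (ball (0 : Rd d) 5) := by
  set S : Set (Rd d) := {x | ‖x‖ ≤ 1 ∧ |⟪x, e⟫| ≤ a} with hS
  have hSm : MeasurableSet S := by
    have hc : Continuous fun x : Rd d => |⟪x, e⟫| := by fun_prop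
    exact (measurableSet_le measurable_norm measurable_const).inter
      (measurableSet_le hc.measurable measurable_const)
  set n : ℕ := ⌈1 / a⌉₊ with hn
  have hna : 1 / a ≤ n := Nat.le_ceil _
  set S' : ℕ → Set (Rd d) := fun i => (fun x : Rd d => x + -((3 * a * i) • e)) ⁻¹' S with hS'
  have hdisj : ∀ i j : ℕ, i < j → Disjoint (S' i) (S' j) := by
    intro i j hij
    rw [Set.disjoint_left]
    intro x hx hx'
    have h1 := abs_le.1 hx.2
    have h2 := abs_le.1 hx'.2
    simp only [inner_add_left, inner_neg_left, inner_smul_left, real_inner_self_eq_norm_sq, he,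
      RCLike.conj_to_real] at h1 h2
    have h3 : (i:ℝ) + 1 ≤ j := by exact_mod_cast hij
    nlinarith
  have hpd : Set.PairwiseDisjoint (↑(Finset.range n)) S' := by
    intro i _ j _ hij
    rcases lt_or_gt_of_ne hij with h | h
    · exact hdisj i j h
    · exact (hdisj j i h).symm
  have hsub : (⋃ i ∈ Finset.range n, S' i) ⊆ ball (0 : Rd d) 5 := by
    refine iUnion₂_subset fun i hi x hx => ?_
    rw [mem_ball_zero_iff]
    have h1 : (i:ℝ) < 1 / a := by
      have := Finset.mem_range.1 hi
      exact Nat.lt_ceil.1 this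
    have h2 : (i:ℝ) * a < 1 := (lt_div_iff₀ ha).1 h1
    have h3 : x = (x + -((3 * a * i) • e)) + (3 * a * i) • e := by abel
    rw [h3]
    refine (norm_add_le _ _).trans_lt ?_
    rw [norm_smul, he, Real.norm_of_nonneg (by positivity)]
    have := hx.1
    nlinarith
  have hvol : (n : ℝ≥0∞) * volume S ≤ volume (ball (0 : Rd d) 5) := by
    refine le_trans (le_of_eq ?_) (measure_mono hsub)
    rw [measure_biUnion_finset hpd fun i _ => (hSm.preimage (by fun_prop))]
    simp [hS', measure_preimage_add_right]
  have hone : 1 ≤ ENNReal.ofReal a * (n : ℝ≥0∞) := by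
    rw [← ENNReal.ofReal_natCast, ← ENNReal.ofReal_mul ha.le, ← ENNReal.ofReal_one]
    refine ENNReal.ofReal_le_ofReal ?_
    rw [div_le_iff₀ ha] at hna
    linarith
  calc volume S ≤ (ENNReal.ofReal a * (n : ℝ≥0∞)) * volume S := le_mul_of_one_le_left' hone
    _ = ENNReal.ofReal a * (n * volume S) := mul_assoc _ _ _
    _ ≤ _ := mul_le_mul_right hvol _

/-- The index of the cell of directions containing `x`, at angular scale `w`. -/
def cellidx (d : ℕ) (w : ℝ) (x : Rd d) : Fin d → ℤ := fun i => ⌊x i / (w * ‖x‖)⌋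

theorem cellidx_smul (w : ℝ) {r : ℝ} (hr : 0 < r) (x : Rd d) :
    cellidx d w (r • x) = cellidx d w x := by
  funext i
  simp only [cellidx, norm_smul, Real.norm_of_nonneg hr.le, PiLp.smul_apply, smul_eq_mul]
  congr 1
  rw [show w * (r * ‖x‖) = r * (w * ‖x‖) by ring, mul_div_mul_left _ _ hr.ne']

theorem measurable_cellidx (w : ℝ) : Measurable (cellidx d w) := by
  refine measurable_pi_lambda _ fun i => Int.measurable_floor.comp ?_
  have h1 : Measurable fun x : Rd d => x i := Continuous.measurable (by fun_prop)
  exact h1.div (measurable_norm.const_mul w)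

/-- A finite set containing the indices of all cells. -/
def cellSet (d : ℕ) (w : ℝ) : Finset (Fin d → ℤ) :=
  Fintype.piFinset fun _ => Finset.Icc ⌊-(1 / w)⌋ ⌊1 / w⌋

theorem abs_coord_le_norm (x : Rd d) (i : Fin d) : |x i| ≤ ‖x‖ := by
  simpa using PiLp.norm_apply_le x i

theorem cellidx_mem_cellSet {w : ℝ} (hw : 0 < w) (x : Rd d) : cellidx d w x ∈ cellSet d w := by
  refine Fintype.mem_piFinset.2 fun i => Finset.mem_Icc.2 ?_
  have h1 : |x i / (w * ‖x‖)| ≤ 1 / w := by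
    rw [abs_div, abs_of_nonneg (by positivity : 0 ≤ w * ‖x‖), ← div_div, div_right_comm]
    gcongr
    exact div_le_one_of_le₀ (abs_coord_le_norm x i) (norm_nonneg _)
  exact ⟨Int.floor_mono (abs_le.1 h1).1, Int.floor_mono (abs_le.1 h1).2⟩

theorem norm_sub_le_of_cellidx_eq {w : ℝ} (hw : 0 < w) {x y : Rd d} (hx : ‖x‖ = 1)
    (hy : ‖y‖ = 1) (h : cellidx d w x = cellidx d w y) : ‖x - y‖ ≤ Real.sqrt d * w := by
  refine norm_le_sqrt_mul_of_abs_le hw.le fun i => ?_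
  have h1 : ⌊x i / w⌋ = ⌊y i / w⌋ := by simpa [cellidx, hx, hy] using congrFun h i
  have h2 := Int.abs_sub_lt_one_of_floor_eq_floor h1
  rw [← sub_div, abs_div, abs_of_pos hw, div_lt_one hw] at h2
  exact h2.le

theorem norm_inv_norm_smul {x : Rd d} (hx : x ≠ 0) : ‖‖x‖⁻¹ • x‖ = 1 := norm_smul_inv_norm hx

theorem cellidx_inv_norm_smul (w : ℝ) {x : Rd d} (hx : x ≠ 0) :
    cellidx d w (‖x‖⁻¹ • x) = cellidx d w x := cellidx_smul w (by positivity) x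

/-- The part of the unit ball with directions in a given cell. -/
def cellSector (d : ℕ) (w : ℝ) (v : Fin d → ℤ) : Set (Rd d) :=
  {x | 0 < ‖x‖ ∧ ‖x‖ ≤ 1 ∧ cellidx d w x = v}

/-- A tube around the segments pointing in the directions of a given cell. -/
def cellTube (d : ℕ) (w : ℝ) (v : Fin d → ℤ) : Set (Rd d) :=
  ⋃ e ∈ {e : Rd d | ‖e‖ = 1 ∧ cellidx d w e = v}, ⋃ t ∈ Icc (-1 : ℝ) 1,
    ball (t • e) (3 * Real.sqrt d * w)

theorem measurableSet_cellSector (w : ℝ) (v : Fin d → ℤ) : MeasurableSet (cellSector d w v) :=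
  (measurableSet_lt measurable_const measurable_norm).inter
    ((measurableSet_le measurable_norm measurable_const).inter
      (measurable_cellidx w (measurableSet_singleton v)))

theorem isOpen_cellTube (w : ℝ) (v : Fin d → ℤ) : IsOpen (cellTube d w v) :=
  isOpen_biUnion fun _ _ => isOpen_biUnion fun _ _ => isOpen_ball

theorem volume_cellSector_ne_top (w : ℝ) (v : Fin d → ℤ) : volume (cellSector d w v) ≠ ⊤ :=
  ((measure_mono fun _ hx => mem_closedBall_zero_iff.2 hx.2.1).trans_lt
    (measure_closedBall_lt_top (x := (0 : Rd d)) (r := 1))).ne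

theorem cellSector_sub_mem_cellTube (hd : 0 < d) {w : ℝ} (hw : 0 < w) {v : Fin d → ℤ} {u u' : Rd d}
    (hu : u ∈ cellSector d w v) (hu' : u' ∈ cellSector d w v) {r : ℝ} (hr : 0 < r) (hr1 : r ≤ 1)
    {z : Rd d} (hz : ‖z‖ ≤ Real.sqrt d * w) : u - r • u' + z ∈ cellTube d w v := by
  have hu0 : u ≠ 0 := norm_pos_iff.1 hu.1
  have hu0' : u' ≠ 0 := norm_pos_iff.1 hu'.1
  simp only [cellTube, mem_iUnion]
  have hun := norm_inv_norm_smul hu0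
  have hun' := norm_inv_norm_smul hu0'
  refine ⟨‖u‖⁻¹ • u, ⟨hun, (cellidx_inv_norm_smul w hu0).trans hu.2.2⟩, ‖u‖ - r * ‖u'‖, ?_, ?_⟩
  · have h1 := hu.2.1
    have h2 := hu'.2.1
    have h3 := hu.1
    have h4 := hu'.1
    have h5 : r * ‖u'‖ ≤ 1 := mul_le_one₀ hr1 h4.le h2
    have h6 : 0 ≤ r * ‖u'‖ := by positivity
    constructor <;> linarith
  · rw [mem_ball, dist_eq_norm]
    have h1 := norm_sub_le_of_cellidx_eq hw hun hun'
      (by rw [cellidx_inv_norm_smul w hu0, cellidx_inv_norm_smul w hu0', hu.2.2, hu'.2.2])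
    have h2 : u - r • u' + z - (‖u‖ - r * ‖u'‖) • ‖u‖⁻¹ • u =
        (r * ‖u'‖) • (‖u‖⁻¹ • u - ‖u'‖⁻¹ • u') + z := by
      rw [sub_smul, smul_inv_smul₀ hu.1.ne', smul_sub, mul_smul r ‖u'‖ (‖u'‖⁻¹ • u'),
        smul_inv_smul₀ hu'.1.ne']
      abel
    rw [h2]
    have h4 : r * ‖u'‖ ≤ 1 := mul_le_one₀ hr1 (norm_nonneg _) hu'.2.1
    have hsd : 0 < Real.sqrt d := Real.sqrt_pos.2 (by exact_mod_cast hd)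
    calc _ ≤ ‖(r * ‖u'‖) • (‖u‖⁻¹ • u - ‖u'‖⁻¹ • u')‖ + ‖z‖ := norm_add_le _ _
      _ ≤ 1 * (Real.sqrt d * w) + Real.sqrt d * w := by
          rw [norm_smul, Real.norm_of_nonneg (by positivity)]
          gcongr
      _ < _ := by nlinarith [mul_pos hsd hw]

/-- The cells containing a direction nearly orthogonal to `ξ`. -/
def goodCell (d : ℕ) (w : ℝ) (ξ : Rd d) (v : Fin d → ℤ) : Prop :=
  ∃ x : Rd d, x ≠ 0 ∧ cellidx d w x = v ∧ |⟪x, ξ⟫| ≤ w * ‖x‖ * ‖ξ‖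

open Classical in
theorem sum_volume_goodCell_le {w : ℝ} (hw : 0 < w) {ξ : Rd d} (hξ : ξ ≠ 0)
    (V : Finset (Fin d → ℤ)) :
    ∑ v ∈ V.filter (goodCell d w ξ), volume (cellSector d w v) ≤
      ENNReal.ofReal ((1 + Real.sqrt d) * w) * volume (ball (0 : Rd d) 5) := by
  have hpd : Set.PairwiseDisjoint (↑(V.filter (goodCell d w ξ))) (cellSector d w) := by
    intro v _ v' _ hne
    exact Set.disjoint_left.2 fun x hx hx' => hne (hx.2.2.symm.trans hx'.2.2)
  rw [← measure_biUnion_finset hpd fun v _ => measurableSet_cellSector w v]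
  refine le_trans (measure_mono ?_)
    (volume_slab_le (norm_inv_norm_smul hξ) (by positivity : 0 < (1 + Real.sqrt d) * w))
  refine iUnion₂_subset fun v hv y hy => ⟨hy.2.1, ?_⟩
  obtain ⟨x, hx, hxv, hxξ⟩ := (Finset.mem_filter.1 hv).2
  have hy0 : y ≠ 0 := norm_pos_iff.1 hy.1
  have h1 := norm_sub_le_of_cellidx_eq hw (norm_inv_norm_smul hy0) (norm_inv_norm_smul hx)
      (by rw [cellidx_inv_norm_smul w hy0, cellidx_inv_norm_smul w hx, hxv, hy.2.2])
  set e := ‖ξ‖⁻¹ • ξ with he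
  have hen : ‖e‖ = 1 := norm_inv_norm_smul hξ
  have h2 : |⟪‖x‖⁻¹ • x, e⟫| ≤ w := by
    rw [he, inner_smul_left, inner_smul_right, RCLike.conj_to_real, abs_mul, abs_mul,
      abs_of_pos (inv_pos.2 (norm_pos_iff.2 hx)), abs_of_pos (inv_pos.2 (norm_pos_iff.2 hξ))]
    calc ‖x‖⁻¹ * (‖ξ‖⁻¹ * |⟪x, ξ⟫|) ≤ ‖x‖⁻¹ * (‖ξ‖⁻¹ * (w * ‖x‖ * ‖ξ‖)) := by gcongr
      _ = w := by
        have := norm_ne_zero_iff.2 hx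
        have := norm_ne_zero_iff.2 hξ
        field_simp
  have h3 : |⟪‖y‖⁻¹ • y - ‖x‖⁻¹ • x, e⟫| ≤ Real.sqrt d * w :=
    (abs_real_inner_le_norm _ _).trans (by rw [hen, mul_one]; exact h1)
  have h4 : y = ‖y‖ • ((‖y‖⁻¹ • y - ‖x‖⁻¹ • x) + ‖x‖⁻¹ • x) := by
    rw [sub_add_cancel, smul_inv_smul₀ hy.1.ne']
  rw [h4, inner_smul_left, RCLike.conj_to_real, inner_add_left, abs_mul, abs_norm]
  calc ‖y‖ * |⟪‖y‖⁻¹ • y - ‖x‖⁻¹ • x, e⟫ + ⟪‖x‖⁻¹ • x, e⟫|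
      ≤ 1 * (Real.sqrt d * w + w) := by
        refine mul_le_mul hy.2.1 ((abs_add_le _ _).trans (add_le_add h3 h2)) (abs_nonneg _)
          zero_le_one
    _ = _ := by ring

/-- A family of sets with bounded overlap inside a set has controlled total measure. -/
theorem sum_measure_le_of_card_le {ι X : Type*} [MeasurableSpace X] (μ : Measure X)
    (V : Finset ι) {S : ι → Set X} (hS : ∀ v ∈ V, MeasurableSet (S v)) {B : Set X}
    (hB : MeasurableSet B) (hSB : ∀ v ∈ V, S v ⊆ B) (N : ℕ)
    (hN : ∀ y, ∀ V' ⊆ V, (∀ v ∈ V', y ∈ S v) → V'.card ≤ N) :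
    ∑ v ∈ V, μ (S v) ≤ N * μ B := by
  classical
  calc ∑ v ∈ V, μ (S v) = ∑ v ∈ V, ∫⁻ y, (S v).indicator (fun _ => (1:ℝ≥0∞)) y ∂μ := by
        refine Finset.sum_congr rfl fun v hv => ?_
        rw [lintegral_indicator (hS v hv)]; simp
    _ = ∫⁻ y, ∑ v ∈ V, (S v).indicator (fun _ => (1:ℝ≥0∞)) y ∂μ :=
        (lintegral_finsetSum _ fun v hv => measurable_const.indicator (hS v hv)).symm
    _ ≤ ∫⁻ y, B.indicator (fun _ => (N:ℝ≥0∞)) y ∂μ := by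
        refine lintegral_mono fun y => ?_
        by_cases hy : y ∈ B
        · rw [indicator_of_mem hy]
          have h1 := hN y (V.filter fun v => y ∈ S v) (Finset.filter_subset _ _)
            fun v hv => (Finset.mem_filter.1 hv).2
          simp only [indicator_apply]
          rw [Finset.sum_ite, Finset.sum_const_zero, add_zero, Finset.sum_const, nsmul_eq_mul,
            mul_one]
          exact_mod_cast h1
        · rw [indicator_of_notMem hy]
          refine (Finset.sum_eq_zero fun v hv => indicator_of_notMem (fun h => ?_) _).le
          exact hy (hSB v hv h)
    _ = N * μ B := by
        rw [lintegral_indicator hB]; simp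

theorem card_le_of_abs_sub_le {V : Finset (Fin d → ℤ)} {R : ℕ}
    (h : ∀ v ∈ V, ∀ v' ∈ V, ∀ i, |v i - v' i| ≤ R) : V.card ≤ (2 * R + 1) ^ d := by
  rcases V.eq_empty_or_nonempty with rfl | ⟨v₀, hv₀⟩
  · simp
  · have hsub : V ⊆ Fintype.piFinset fun i => Finset.Icc (v₀ i - R) (v₀ i + R) := by
      intro v hv
      refine Fintype.mem_piFinset.2 fun i => Finset.mem_Icc.2 ?_
      have := abs_le.1 (h v hv v₀ hv₀ i)
      constructor <;> linarith
    refine (Finset.card_le_card hsub).trans ?_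
    rw [Fintype.card_piFinset]
    refine (Finset.prod_le_pow_card _ _ (2 * R + 1) fun i _ => ?_).trans (by simp)
    rw [Int.card_Icc]
    omega

theorem exists_sum_volume_cellTube_le (d : ℕ) : ∃ C : ℝ, 0 < C ∧ ∀ w : ℝ, 0 < w → w ≤ 1 →
    ∀ V : Finset (Fin d → ℤ), ∑ v ∈ V, volume (cellTube d w v) ≤ ENNReal.ofReal C := by
  classical
  set N : ℕ := (2 * (16 * d + 1) + 1) ^ d with hN
  set B : Set (Rd d) := ball 0 (3 + 4 * d) with hB
  have hBt : (N : ℝ≥0∞) * volume B ≠ ⊤ :=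
    ENNReal.mul_ne_top (ENNReal.natCast_ne_top _) measure_ball_lt_top.ne
  refine ⟨((N : ℝ≥0∞) * volume B).toReal + 1, by positivity, fun w hw hw1 V => ?_⟩
  have hle : (N : ℝ≥0∞) * volume B ≤ ENNReal.ofReal (((N : ℝ≥0∞) * volume B).toReal + 1) := by
    conv_lhs => rw [← ENNReal.ofReal_toReal hBt]
    exact ENNReal.ofReal_le_ofReal (by linarith)
  refine le_trans ?_ hle
  have hsd : Real.sqrt d ≤ d := by
    rcases Nat.eq_zero_or_pos d with rfl | h
    · simp
    · have : (1:ℝ) ≤ d := by exact_mod_cast h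
      rw [Real.sqrt_le_left (by positivity)]
      nlinarith
  -- a direction in each non-empty cell
  have hex : ∃ e : (Fin d → ℤ) → Rd d, ∀ v, (∃ x : Rd d, ‖x‖ = 1 ∧ cellidx d w x = v) →
      ‖e v‖ = 1 ∧ cellidx d w (e v) = v :=
    ⟨fun v => if h : ∃ x : Rd d, ‖x‖ = 1 ∧ cellidx d w x = v then h.choose else 0,
      fun v h => by simp only [dif_pos h]; exact h.choose_spec⟩
  obtain ⟨e, he⟩ := hex
  set S : (Fin d → ℤ) → Set (Rd d) := fun v => (fun x => x + -((2:ℝ) • e v)) ⁻¹' cellTube d w v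
    with hS
  have hSvol : ∀ v, volume (S v) = volume (cellTube d w v) := fun v => by
    simp only [hS, measure_preimage_add_right]
  have hkey : ∀ v, ∀ y ∈ S v, ‖e v‖ = 1 ∧ cellidx d w (e v) = v ∧ ∃ a : ℝ, 1 ≤ a ∧ a ≤ 3 ∧
      ‖y - a • e v‖ < 4 * Real.sqrt d * w := by
    intro v y hy
    simp only [hS, mem_preimage, cellTube, mem_iUnion] at hy
    obtain ⟨x, hx, t, ht, hxt⟩ := hy
    obtain ⟨h1, h2⟩ := he v ⟨x, hx⟩
    refine ⟨h1, h2, 2 + t, by linarith [ht.1], by linarith [ht.2], ?_⟩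
    rw [mem_ball, dist_eq_norm] at hxt
    have h3 := norm_sub_le_of_cellidx_eq hw hx.1 h1 (hx.2.trans h2.symm)
    have h4 : y - (2 + t) • e v = (y + -((2:ℝ) • e v) - t • x) + t • (x - e v) := by
      rw [add_smul, smul_sub]; abel
    rw [h4]
    refine (norm_add_le _ _).trans_lt ?_
    rw [norm_smul, Real.norm_eq_abs]
    have h5 : |t| ≤ 1 := abs_le.2 ht
    nlinarith [norm_nonneg (x - e v), abs_nonneg t]
  calc ∑ v ∈ V, volume (cellTube d w v) = ∑ v ∈ V, volume (S v) := by simp_rw [hSvol]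
    _ ≤ N * volume B := by
      refine sum_measure_le_of_card_le _ _ (fun v _ => ?_) measurableSet_ball (fun v _ y hy => ?_)
        N fun y V' _ hV' => ?_
      · exact (isOpen_cellTube w v).measurableSet.preimage (by fun_prop)
      · obtain ⟨h1, h2, a, ha1, ha3, ha⟩ := hkey v y hy
        rw [mem_ball_zero_iff]
        have h4 : y = (y - a • e v) + a • e v := by abel
        rw [h4]
        refine (norm_add_le _ _).trans_lt ?_
        rw [norm_smul, h1, Real.norm_of_nonneg (by linarith)]
        nlinarith [Real.sqrt_nonneg (d:ℝ)]
      · refine card_le_of_abs_sub_le fun v hv v' hv' i => ?_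
        obtain ⟨h1, h2, a, ha1, ha3, ha⟩ := hkey v y (hV' v hv)
        obtain ⟨h1', h2', a', ha1', ha3', ha'⟩ := hkey v' y (hV' v' hv')
        have h3 : ‖a • e v - a' • e v'‖ ≤ 8 * Real.sqrt d * w := by
          have : a • e v - a' • e v' = (y - a' • e v') - (y - a • e v) := by abel
          rw [this]
          exact (norm_sub_le _ _).trans (by linarith)
        have h4 : |a - a'| ≤ 8 * Real.sqrt d * w := by
          have h5 := (abs_norm_sub_norm_le (a • e v) (a' • e v')).trans h3
          rwa [norm_smul, norm_smul, h1, h1', mul_one, mul_one, Real.norm_of_nonneg (by linarith),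
            Real.norm_of_nonneg (by linarith)] at h5
        have h5 : ‖a • (e v - e v')‖ ≤ 16 * Real.sqrt d * w := by
          have : a • (e v - e v') = (a • e v - a' • e v') + (a' - a) • e v' := by
            rw [smul_sub, sub_smul]; abel
          rw [this]
          refine (norm_add_le _ _).trans ?_
          rw [norm_smul, h1', mul_one, Real.norm_eq_abs, abs_sub_comm]
          linarith
        have h6 : ‖e v - e v'‖ ≤ 16 * Real.sqrt d * w := by
          rw [norm_smul, Real.norm_of_nonneg (by linarith)] at h5
          nlinarith [norm_nonneg (e v - e v')]
        have h7 := (abs_coord_le_norm (e v - e v') i).trans h6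
        have hv1 : ⌊e v i / w⌋ = v i := by simpa [cellidx, h1] using congrFun h2 i
        have hv2 : ⌊e v' i / w⌋ = v' i := by simpa [cellidx, h1'] using congrFun h2' i
        have h8 : |e v i / w - e v' i / w| ≤ 16 * d := by
          rw [← sub_div, abs_div, abs_of_pos hw, div_le_iff₀ hw]
          refine h7.trans ?_
          gcongr
        have h9 := Int.floor_le (e v i / w)
        have h10 := Int.lt_floor_add_one (e v i / w)
        have h11 := Int.floor_le (e v' i / w)
        have h12 := Int.lt_floor_add_one (e v' i / w)
        rw [hv1] at h9 h10
        rw [hv2] at h11 h12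
        have h13 := abs_le.1 h8
        have h14 : |(v i : ℝ) - v' i| ≤ 16 * d + 1 := by
          rw [abs_le]
          constructor <;> linarith
        exact_mod_cast h14

end Cells

/-- The tent function of radius `ρ`. -/
def tent (d : ℕ) (ρ : ℝ) (x : Rd d) : ℝ := max 0 (1 - ‖x‖ / ρ)

section Tent

variable {d : ℕ} {ρ : ℝ}

theorem tent_nonneg (x : Rd d) : 0 ≤ tent d ρ x := le_max_left _ _

theorem tent_le_one (hρ : 0 < ρ) (x : Rd d) : tent d ρ x ≤ 1 :=
  max_le zero_le_one (by have : 0 ≤ ‖x‖ / ρ := by positivity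
                         linarith)

theorem abs_tent_le_one (hρ : 0 < ρ) (x : Rd d) : |tent d ρ x| ≤ 1 := by
  rw [abs_of_nonneg (tent_nonneg x)]
  exact tent_le_one hρ x

theorem tent_support (hρ : 0 < ρ) {x : Rd d} (hx : tent d ρ x ≠ 0) : ‖x‖ < ρ := by
  by_contra h
  refine hx (max_eq_left ?_)
  have : 1 ≤ ‖x‖ / ρ := (one_le_div hρ).2 (not_lt.1 h)
  linarith

theorem tent_sub_le (hρ : 0 < ρ) (x y : Rd d) : |tent d ρ x - tent d ρ y| ≤ ‖x - y‖ / ρ := by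
  unfold tent
  refine (abs_max_sub_max_le_max _ _ _ _).trans ?_
  rw [sub_self, abs_zero]
  refine max_le (by positivity) ?_
  have h1 : 1 - ‖x‖ / ρ - (1 - ‖y‖ / ρ) = (‖y‖ - ‖x‖) / ρ := by ring
  rw [h1, abs_div, abs_of_pos hρ, abs_sub_comm]
  gcongr
  exact abs_norm_sub_norm_le x y

theorem tent_continuous : Continuous (tent d ρ) :=
  continuous_const.max (continuous_const.sub (continuous_norm.div_const ρ))

theorem tent_integrable (hρ : 0 < ρ) : Integrable (tent d ρ) :=
  tent_continuous.integrable_of_hasCompactSupport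
    (HasCompactSupport.intro (isCompact_closedBall (0 : Rd d) ρ) fun x hx => by
      by_contra h
      exact hx (mem_closedBall_zero_iff.2 (tent_support hρ h).le))

theorem le_integral_tent (hρ : 0 < ρ) :
    1 / 2 * volume.real (closedBall (0 : Rd d) (ρ / 2)) ≤ ∫ x, tent d ρ x := by
  have h1 : ∫ x in closedBall (0 : Rd d) (ρ / 2), (1 / 2 : ℝ) ≤
      ∫ x in closedBall (0 : Rd d) (ρ / 2), tent d ρ x := by
    refine setIntegral_mono_on (integrableOn_const measure_closedBall_lt_top.ne)
      (tent_integrable hρ).integrableOn measurableSet_closedBall fun x hx => ?_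
    refine le_max_of_le_right ?_
    have h2 : ‖x‖ / ρ ≤ 1 / 2 := by
      rw [div_le_iff₀ hρ]
      linarith [mem_closedBall_zero_iff.1 hx]
    linarith
  rw [setIntegral_const, smul_eq_mul, mul_comm] at h1
  exact h1.trans (setIntegral_le_integral (tent_integrable hρ)
    (Filter.Eventually.of_forall tent_nonneg))

theorem half_integral_tent_le_norm_fourierR (hρ : 0 < ρ) {ξ : Rd d} (hξ : ‖ξ‖ * (16 * ρ) ≤ 1) :
    (∫ x, tent d ρ x) / 2 ≤ ‖fourierR d (tent d ρ) ξ‖ := by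
  have hInt : Integrable fun x => Complex.exp (↑(-2 * Real.pi * ⟪x, ξ⟫) * Complex.I) *
      (tent d ρ x : ℂ) := by
    refine (integrable_complex_ofReal (tent_integrable hρ)).bdd_mul (c := 1)
      (Continuous.aestronglyMeasurable (by fun_prop)) (Filter.Eventually.of_forall fun x => ?_)
    rw [Complex.norm_exp_ofReal_mul_I]
  have h1 : ‖fourierR d (tent d ρ) ξ - ((∫ x, tent d ρ x : ℝ) : ℂ)‖ ≤ (∫ x, tent d ρ x) / 2 := by
    rw [fourierR_eq, ← integral_complex_ofReal,
      ← integral_sub hInt (integrable_complex_ofReal (tent_integrable hρ)), ← integral_div]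
    refine norm_integral_le_of_norm_le ((tent_integrable hρ).div_const 2)
      (Filter.Eventually.of_forall fun x => ?_)
    rw [← sub_one_mul, norm_mul, Complex.norm_real, Real.norm_of_nonneg (tent_nonneg x)]
    by_cases hx : tent d ρ x = 0
    · simp [hx]
    have h2 := tent_support hρ hx
    have h3 : ‖Complex.exp (↑(-2 * Real.pi * ⟪x, ξ⟫) * Complex.I) - 1‖ ≤ 1 / 2 := by
      rw [mul_comm]
      refine Real.norm_exp_I_mul_ofReal_sub_one_le.trans ?_
      rw [Real.norm_eq_abs, abs_mul, abs_mul, abs_neg, abs_two, abs_of_pos Real.pi_pos]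
      have h4 := abs_real_inner_le_norm x ξ
      have h5 : ‖x‖ * ‖ξ‖ ≤ 1 / 16 := by
        have : ‖x‖ * ‖ξ‖ ≤ ρ * ‖ξ‖ := by gcongr
        linarith
      nlinarith [Real.pi_le_four, Real.pi_pos, abs_nonneg ⟪x, ξ⟫]
    calc _ ≤ 1 / 2 * tent d ρ x := by
          gcongr
          exact tent_nonneg x
      _ = _ := by ring
  have h2 : 0 ≤ ∫ x, tent d ρ x := integral_nonneg tent_nonneg
  have h3 := norm_sub_norm_le ((∫ x, tent d ρ x : ℝ) : ℂ) (fourierR d (tent d ρ) ξ)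
  rw [norm_sub_rev, Complex.norm_real, Real.norm_of_nonneg h2] at h3
  linarith

end Tent

section LowFrequency

variable {d : ℕ} {𝒬 : Finset (ℤ × (Fin d → ℤ))} {b : ℤ × (Fin d → ℤ) → Rd d → ℝ} {A : ℝ}

theorem BadFamily.cv_tent_support (h : BadFamily d 𝒬 b A) {ρ : ℝ} (hρ : 0 < ρ)
    {q} (hq : q ∈ 𝒬) {x : Rd d} (hx : cv d (tent d ρ) (b q) x ≠ 0) :
    dcube d 0 q.1 q.2 ⊆ closedBall x (ρ + Real.sqrt d * (2:ℝ) ^ q.1) := by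
  obtain ⟨y, hy⟩ : ∃ y, tent d ρ (x - y) * b q y ≠ 0 := by
    by_contra! hne
    exact hx (by simp [cv, hne])
  intro z hz
  rw [mem_closedBall, dist_eq_norm]
  have h1 := tent_support hρ (left_ne_zero_of_mul hy)
  have h2 := norm_sub_le_of_mem_dcube hz (h.supp q hq y (right_ne_zero_of_mul hy))
  calc ‖z - x‖ = ‖(z - y) - (x - y)‖ := by congr 1; abel
    _ ≤ ‖z - y‖ + ‖x - y‖ := norm_sub_le _ _
    _ ≤ _ := by linarith

theorem BadFamily.abs_cv_tent_le (h : BadFamily d 𝒬 b A) {ρ : ℝ} (hρ : 0 < ρ)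
    {q} (hq : q ∈ 𝒬) (x : Rd d) :
    |cv d (tent d ρ) (b q) x| ≤
      Real.sqrt d * (2:ℝ) ^ q.1 / ρ * (A * (2:ℝ) ^ (q.1 * d)) := by
  have hb := h.integ q hq
  have hK : Integrable fun y => tent d ρ (x - y) * b q y := by
    refine hb.bdd_mul (c := 1)
      (Continuous.aestronglyMeasurable (tent_continuous.comp (by fun_prop)))
      (Filter.Eventually.of_forall fun y => abs_tent_le_one hρ _)
  rcases eq_or_ne (b q) 0 with hb0 | hb0
  · have hA := h.l1 q hq
    have : cv d (tent d ρ) (b q) x = 0 := by simp [cv, hb0]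
    rw [this, abs_zero]
    have : 0 ≤ ∫ x, |b q x| := integral_nonneg fun _ => abs_nonneg _
    have h3 : 0 ≤ A * (2:ℝ) ^ (q.1 * d) := this.trans hA
    positivity
  obtain ⟨y₀, hy₀⟩ := Function.ne_iff.1 hb0
  have h1 : cv d (tent d ρ) (b q) x =
      ∫ y, (tent d ρ (x - y) - tent d ρ (x - y₀)) * b q y := by
    simp_rw [sub_mul]
    rw [integral_sub hK (hb.const_mul _), integral_const_mul, h.mean q hq, mul_zero, sub_zero]
    rfl
  rw [h1]
  calc _ ≤ ∫ y, Real.sqrt d * (2:ℝ) ^ q.1 / ρ * |b q y| := by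
        refine norm_integral_le_of_norm_le (G := ℝ) (hb.abs.const_mul _)
          (Filter.Eventually.of_forall fun y => ?_)
        rw [norm_mul, Real.norm_eq_abs, Real.norm_eq_abs]
        by_cases hy : b q y = 0
        · simp [hy]
        gcongr
        refine (tent_sub_le hρ _ _).trans ?_
        gcongr
        rw [sub_sub_sub_cancel_left]
        exact norm_sub_le_of_mem_dcube (h.supp q hq _ hy₀) (h.supp q hq _ hy)
    _ ≤ _ := by
        rw [integral_const_mul]
        gcongr
        exact h.l1 q hq

theorem BadFamily.integrable_sum (h : BadFamily d 𝒬 b A) :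
    Integrable fun x => ∑ q ∈ 𝒬, b q x :=
  integrable_finsetSum _ fun q hq => h.integ q hq

theorem cv_finset_sum {ι : Type*} (s : Finset ι) {K : Rd d → ℝ} {f : ι → Rd d → ℝ} (x : Rd d)
    (hf : ∀ i ∈ s, Integrable fun y => K (x - y) * f i y) :
    cv d K (fun y => ∑ i ∈ s, f i y) x = ∑ i ∈ s, cv d K (f i) x := by
  simp only [cv, Finset.mul_sum]
  exact integral_finsetSum s hf

theorem BadFamily.lintegral_cv_tent_sq_le (h : BadFamily d 𝒬 b A) {ρ : ℝ} (hρ : 0 < ρ) (hA : 0 ≤ A)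
    {j : ℤ} (hj : ∀ q ∈ 𝒬, q.1 = j) :
    ∫⁻ x, ‖cv d (tent d ρ) (fun y => ∑ q ∈ 𝒬, b q y) x‖ₑ ^ 2 ≤
      (ENNReal.ofReal (Real.sqrt d * (2:ℝ) ^ j / ρ * A) *
        volume (closedBall (0 : Rd d) (ρ + Real.sqrt d * (2:ℝ) ^ j))) ^ 2 * cubeSum d 𝒬 := by
  classical
  set c := ENNReal.ofReal (Real.sqrt d * (2:ℝ) ^ j / ρ * A) with hc
  set V := volume (closedBall (0 : Rd d) (ρ + Real.sqrt d * (2:ℝ) ^ j)) with hV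
  have hVx : ∀ x : Rd d, volume (closedBall x (ρ + Real.sqrt d * (2:ℝ) ^ j)) = V := fun x =>
    Measure.addHaar_closedBall_center _ _ _
  have hterm : ∀ q ∈ 𝒬, ∀ x, ‖cv d (tent d ρ) (b q) x‖ₑ ≤ c * volume (dcube d 0 q.1 q.2) := by
    intro q hq x
    rw [volume_dcube, hc, ← ENNReal.ofReal_mul (by positivity), Real.enorm_eq_ofReal_abs]
    refine ENNReal.ofReal_le_ofReal ((h.abs_cv_tent_le hρ hq x).trans_eq ?_)
    rw [hj q hq]
    ring
  have hsum : ∀ x, ‖cv d (tent d ρ) (fun y => ∑ q ∈ 𝒬, b q y) x‖ₑ ≤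
      ∑ q ∈ 𝒬, ‖cv d (tent d ρ) (b q) x‖ₑ := by
    intro x
    rw [cv_finset_sum 𝒬 x fun q hq => (h.integ q hq).bdd_mul (c := 1)
      (Continuous.aestronglyMeasurable (tent_continuous.comp (by fun_prop)))
      (Filter.Eventually.of_forall fun y => abs_tent_le_one hρ _)]
    exact enorm_sum_le _ _
  have hsup : ∀ x, ∑ q ∈ 𝒬, ‖cv d (tent d ρ) (b q) x‖ₑ ≤ c * V := by
    intro x
    calc ∑ q ∈ 𝒬, ‖cv d (tent d ρ) (b q) x‖ₑ
        ≤ ∑ q ∈ 𝒬.filter (fun q => cv d (tent d ρ) (b q) x ≠ 0),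
          c * volume (dcube d 0 q.1 q.2) := by
          rw [Finset.sum_filter]
          refine Finset.sum_le_sum fun q hq => ?_
          split_ifs with h0
          · exact hterm q hq x
          · rw [not_not.1 h0]; simp
      _ = c * cubeSum d (𝒬.filter (fun q => cv d (tent d ρ) (b q) x ≠ 0)) :=
          (Finset.mul_sum _ _ _).symm
      _ ≤ c * V := by
          gcongr
          rw [← hVx x]
          refine (h.mono (Finset.filter_subset _ _)).sum_volume_le fun q hq => ?_
          obtain ⟨hq1, hq2⟩ := Finset.mem_filter.1 hq
          rw [← hj q hq1]
          exact h.cv_tent_support hρ hq1 hq2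
  have hInt : ∀ q ∈ 𝒬, ∫⁻ x, ‖cv d (tent d ρ) (b q) x‖ₑ ≤
      c * V * volume (dcube d 0 q.1 q.2) := by
    intro q hq
    rcases isEmpty_or_nonempty (dcube d 0 q.1 q.2) with he | ⟨y₀, hy₀⟩
    · have hb0 : b q = 0 := funext fun x => by
        by_contra hx
        exact he.false ⟨x, h.supp q hq x hx⟩
      simp [cv, hb0]
    calc ∫⁻ x, ‖cv d (tent d ρ) (b q) x‖ₑ
        ≤ ∫⁻ x, (closedBall y₀ (ρ + Real.sqrt d * (2:ℝ) ^ j)).indicator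
          (fun _ => c * volume (dcube d 0 q.1 q.2)) x := by
          refine lintegral_mono fun x => ?_
          by_cases hx : cv d (tent d ρ) (b q) x = 0
          · simp [hx]
          · have := h.cv_tent_support hρ hq hx hy₀
            rw [hj q hq] at this
            rw [indicator_of_mem (mem_closedBall_comm.1 this)]
            exact hterm q hq x
      _ = c * V * volume (dcube d 0 q.1 q.2) := by
          rw [lintegral_indicator measurableSet_closedBall, setLIntegral_const, hVx]
          ring
  calc ∫⁻ x, ‖cv d (tent d ρ) (fun y => ∑ q ∈ 𝒬, b q y) x‖ₑ ^ 2
      ≤ ∫⁻ x, c * V * ∑ q ∈ 𝒬, ‖cv d (tent d ρ) (b q) x‖ₑ := by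
        refine lintegral_mono fun x => ?_
        rw [sq]
        exact mul_le_mul' ((hsum x).trans (hsup x)) (hsum x)
    _ = c * V * ∑ q ∈ 𝒬, ∫⁻ x, ‖cv d (tent d ρ) (b q) x‖ₑ := by
        have hm : ∀ q ∈ 𝒬, AEMeasurable fun x => ‖cv d (tent d ρ) (b q) x‖ₑ := fun q hq =>
          (cv_integrable (tent_integrable hρ) (h.integ q hq)).aestronglyMeasurable.enorm
        rw [lintegral_const_mul'' _ (Finset.aemeasurable_fun_sum _ hm), lintegral_finsetSum' _ hm]
    _ ≤ c * V * ∑ q ∈ 𝒬, c * V * volume (dcube d 0 q.1 q.2) := by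
        gcongr with q hq
        exact hInt q hq
    _ = _ := by
        rw [← Finset.mul_sum, cubeSum]
        ring

theorem lintegral_fourierR_low_le (d : ℕ) : ∃ C : ℝ, 0 < C ∧
    ∀ (𝒬 : Finset (ℤ × (Fin d → ℤ))) (b : ℤ × (Fin d → ℤ) → Rd d → ℝ) (A : ℝ),
      BadFamily d 𝒬 b A → 0 ≤ A → ∀ j : ℤ, (∀ q ∈ 𝒬, q.1 = j) → ∀ t : ℝ, 0 < t →
      ∫⁻ ξ in {ξ : Rd d | ‖ξ‖ * (2:ℝ) ^ j ≤ t}, ‖fourierR d (fun x => ∑ q ∈ 𝒬, b q x) ξ‖ₑ ^ 2 ≤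
        ENNReal.ofReal (C * (t ^ 2 * (1 + t) ^ (2 * d)) * A ^ 2) * cubeSum d 𝒬 := by
  refine ⟨4096 * (d + 1) * (32 * (1 + Real.sqrt d)) ^ (2 * d), by positivity, ?_⟩
  intro 𝒬 b A h hA j hj t ht
  set ρ : ℝ := (2:ℝ) ^ j / t / 16 with hρdef
  have hρ : 0 < ρ := by positivity
  set I := ∫ x, tent d ρ x with hI
  set κ := volume.real (closedBall (0 : Rd d) 1) with hκ
  have hκ0 : 0 < κ := ENNReal.toReal_pos
    (measure_closedBall_pos _ _ one_pos).ne' measure_closedBall_lt_top.ne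
  have hball : ∀ r : ℝ, 0 ≤ r → volume (closedBall (0 : Rd d) r) = ENNReal.ofReal (r ^ d * κ) := by
    intro r hr
    rw [Measure.addHaar_closedBall' _ _ hr, ENNReal.ofReal_mul (by positivity), hκ,
      ofReal_measureReal measure_closedBall_lt_top.ne]
    simp
  have hIlow : 1 / 2 * ((ρ / 2) ^ d * κ) ≤ I := by
    refine le_trans (le_of_eq ?_) (le_integral_tent hρ)
    rw [measureReal_def, hball _ (by positivity), ENNReal.toReal_ofReal (by positivity)]
  have hI0 : 0 < I := lt_of_lt_of_le (by positivity) hIlow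
  set β : Rd d → ℝ := fun x => ∑ q ∈ 𝒬, b q x with hβ
  have hβi : Integrable β := h.integrable_sum
  have hc := cv_memLp (tent_integrable hρ) (abs_tent_le_one hρ) hβi
  have hci := cv_integrable (tent_integrable hρ) hβi
  have hpl := lintegral_fourierR_sq hci hc
  have hmain : ENNReal.ofReal ((I / 2) ^ 2) *
      ∫⁻ ξ in {ξ : Rd d | ‖ξ‖ * (2:ℝ) ^ j ≤ t}, ‖fourierR d β ξ‖ₑ ^ 2 ≤
      ∫⁻ ξ, ‖fourierR d (cv d (tent d ρ) β) ξ‖ₑ ^ 2 := by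
    rw [← lintegral_const_mul' _ _ ENNReal.ofReal_ne_top]
    refine le_trans (setLIntegral_mono' ?_ fun ξ hξ => ?_) (setLIntegral_le_lintegral _ _)
    · exact measurableSet_le (measurable_norm.mul_const _) measurable_const
    · rw [fourierR_cv (tent_integrable hρ) hβi, enorm_mul, mul_pow,
        ENNReal.ofReal_pow (by positivity)]
      gcongr
      rw [← ofReal_norm]
      refine ENNReal.ofReal_le_ofReal (half_integral_tent_le_norm_fourierR hρ ?_)
      have hξ' : ‖ξ‖ * (2:ℝ) ^ j ≤ t := hξ
      rw [hρdef, show ‖ξ‖ * (16 * ((2:ℝ) ^ j / t / 16)) = ‖ξ‖ * (2:ℝ) ^ j / t by ring]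
      exact (div_le_one ht).2 hξ'
  rw [hpl] at hmain
  have hlast := hmain.trans (h.lintegral_cv_tent_sq_le hρ hA hj)
  rw [hball _ (by positivity), ← ENNReal.ofReal_mul (by positivity),
    ← ENNReal.ofReal_pow (by positivity)] at hlast
  have hfin : (Real.sqrt d * (2:ℝ) ^ j / ρ * A * ((ρ + Real.sqrt d * (2:ℝ) ^ j) ^ d * κ)) ^ 2 ≤
      (I / 2) ^ 2 * (4096 * (d + 1) * (32 * (1 + Real.sqrt d)) ^ (2 * d) *
        (t ^ 2 * (1 + t) ^ (2 * d)) * A ^ 2) := by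
    have e1 : Real.sqrt d * (2:ℝ) ^ j / ρ = 16 * Real.sqrt d * t := by
      rw [hρdef]; field_simp
    have e2 : (ρ + Real.sqrt d * (2:ℝ) ^ j) ≤ (ρ / 2) * (32 * (1 + Real.sqrt d) * (1 + t)) := by
      have : (2:ℝ) ^ j = 16 * ρ * t := by rw [hρdef]; field_simp
      rw [this]
      have h1 := Real.sqrt_nonneg (d:ℝ)
      have h2 : 0 ≤ Real.sqrt d * t := by positivity
      nlinarith [mul_nonneg hρ.le h1, mul_nonneg hρ.le ht.le, mul_nonneg hρ.le h2]
    rw [e1]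
    have h3 : (ρ + Real.sqrt d * (2:ℝ) ^ j) ^ d * κ ≤
        4 * (I / 2) * (32 * (1 + Real.sqrt d) * (1 + t)) ^ d := by
      calc (ρ + Real.sqrt d * (2:ℝ) ^ j) ^ d * κ
          ≤ ((ρ / 2) * (32 * (1 + Real.sqrt d) * (1 + t))) ^ d * κ := by gcongr
        _ = 2 * (1 / 2 * ((ρ / 2) ^ d * κ)) * (32 * (1 + Real.sqrt d) * (1 + t)) ^ d := by
            rw [mul_pow]; ring
        _ ≤ 2 * I * (32 * (1 + Real.sqrt d) * (1 + t)) ^ d := by gcongr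
        _ = _ := by ring
    calc (16 * Real.sqrt d * t * A * ((ρ + Real.sqrt d * (2:ℝ) ^ j) ^ d * κ)) ^ 2
        ≤ (16 * Real.sqrt d * t * A *
          (4 * (I / 2) * (32 * (1 + Real.sqrt d) * (1 + t)) ^ d)) ^ 2 := by gcongr
      _ = (I / 2) ^ 2 * (4096 * (Real.sqrt d) ^ 2 * (32 * (1 + Real.sqrt d)) ^ (2 * d) *
        (t ^ 2 * (1 + t) ^ (2 * d)) * A ^ 2) := by
          rw [mul_pow (32 * (1 + Real.sqrt d)) (1 + t) d, mul_comm 2 d, pow_mul, pow_mul]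
          ring
      _ ≤ _ := by
          rw [Real.sq_sqrt (by positivity)]
          gcongr
          linarith
  have hfin' := ENNReal.ofReal_le_ofReal hfin
  rw [ENNReal.ofReal_mul (by positivity)] at hfin'
  have h5 := hlast.trans (mul_le_mul_left hfin' (cubeSum d 𝒬))
  rw [mul_assoc] at h5
  exact (ENNReal.mul_le_mul_iff_right (by positivity) ENNReal.ofReal_ne_top).1 h5

end LowFrequency

section Shells

/-- The loss on the dyadic shell `2^{i-1} < y ≤ 2^i`. -/
def shellWeight (w : ℝ) (N : ℕ) (i : ℤ) : ℝ :=
  if 0 < i then (2:ℝ) ^ i * ((w * (2:ℝ) ^ (i - 1)) ^ (2 * N))⁻¹ else (2:ℝ) ^ (1 - i)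

theorem shellWeight_nonneg {w : ℝ} (hw : 0 < w) (N : ℕ) (i : ℤ) : 0 ≤ shellWeight w N i := by
  unfold shellWeight
  split_ifs <;> positivity

theorem exists_shell {w y m M : ℝ} {N : ℕ} (hw : 0 < w) (hy : 0 < y) (hm : 0 ≤ m) (h1 : m ≤ M)
    (h2 : m * (w * y) ^ N ≤ M) :
    ∃ i : ℤ, y ≤ (2:ℝ) ^ i ∧ m ^ 2 ≤ min y y⁻¹ * (M ^ 2 * shellWeight w N i) := by
  obtain ⟨i', hi⟩ := exists_mem_Ioc_zpow hy (one_lt_two : (1:ℝ) < 2)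
  obtain ⟨i, rfl⟩ : ∃ i, i' = i - 1 := ⟨i' + 1, by ring⟩
  rw [sub_add_cancel] at hi
  refine ⟨i, hi.2, ?_⟩
  have hM : 0 ≤ M := hm.trans h1
  have hyi : ((2:ℝ) ^ i)⁻¹ ≤ y⁻¹ := inv_anti₀ hy hi.2
  unfold shellWeight
  split_ifs with h0
  · have h3 : (1:ℝ) ≤ (2:ℝ) ^ (i - 1) := one_le_zpow₀ one_le_two (by omega)
    have h4 : ((2:ℝ) ^ i)⁻¹ ≤ min y y⁻¹ := by
      refine le_min ?_ hyi
      have : ((2:ℝ) ^ i)⁻¹ ≤ 1 := inv_le_one_of_one_le₀ (one_le_zpow₀ one_le_two (by omega))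
      linarith [hi.1]
    have h5 : m ^ 2 * (w * (2:ℝ) ^ (i - 1)) ^ (2 * N) ≤ M ^ 2 := by
      calc m ^ 2 * (w * (2:ℝ) ^ (i - 1)) ^ (2 * N) = (m * (w * (2:ℝ) ^ (i - 1)) ^ N) ^ 2 := by ring
        _ ≤ M ^ 2 := by
          refine pow_le_pow_left₀ (by positivity) (le_trans ?_ h2) 2
          have := hi.1.le
          gcongr
    calc m ^ 2 ≤ M ^ 2 * ((w * (2:ℝ) ^ (i - 1)) ^ (2 * N))⁻¹ := by
          rw [← div_eq_mul_inv, le_div_iff₀ (by positivity)]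
          exact h5
      _ = ((2:ℝ) ^ i)⁻¹ * (M ^ 2 * ((2:ℝ) ^ i * ((w * (2:ℝ) ^ (i - 1)) ^ (2 * N))⁻¹)) := by
          field_simp
      _ ≤ _ := by gcongr
  · have h4 : (2:ℝ) ^ (i - 1) ≤ min y y⁻¹ := by
      refine le_min hi.1.le (le_trans ?_ hyi)
      rw [← zpow_neg]
      exact zpow_le_zpow_right₀ one_le_two (by omega)
    calc m ^ 2 ≤ M ^ 2 := by gcongr
      _ = (2:ℝ) ^ (i - 1) * (M ^ 2 * (2:ℝ) ^ (1 - i)) := by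
          rw [show (1 - i) = -(i - 1) by ring, zpow_neg]
          field_simp
      _ ≤ _ := by gcongr

theorem shellWeight_mul_le {w : ℝ} (hw : 0 < w) (hw1 : w ≤ 1) (d s : ℕ) (i : ℤ) :
    shellWeight w (d + 2) i * (((2:ℝ) ^ (i - s)) ^ 2 * (1 + (2:ℝ) ^ (i - s)) ^ (2 * d)) ≤
      16 ^ (d + 1) * (((2:ℝ) ^ s)⁻¹ ^ 2 * (w ^ (2 * (d + 2)))⁻¹) * (1 / 2) ^ i.natAbs := by
  set σ : ℝ := ((2:ℝ) ^ s)⁻¹ with hσ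
  have hσ0 : 0 < σ := by positivity
  have hσ1 : σ ≤ 1 := inv_le_one_of_one_le₀ (one_le_pow₀ one_le_two)
  have hW1 : 1 ≤ (w ^ (2 * (d + 2)))⁻¹ := (one_le_inv₀ (by positivity)).2 (pow_le_one₀ hw.le hw1)
  have hts : (2:ℝ) ^ (i - s) = (2:ℝ) ^ i * σ := by
    rw [zpow_sub₀ two_ne_zero, zpow_natCast, hσ, div_eq_mul_inv]
  rw [hts]
  unfold shellWeight
  split_ifs with h0
  · obtain ⟨n, rfl⟩ : ∃ n : ℕ, i = n + 1 := ⟨(i - 1).toNat, by omega⟩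
    have h1 : ((n:ℤ) + 1).natAbs = n + 1 := by omega
    rw [h1, add_sub_cancel_right, zpow_natCast, zpow_add₀ two_ne_zero, zpow_natCast, zpow_one]
    set P : ℝ := (2:ℝ) ^ n with hP
    have hP1 : 1 ≤ P := one_le_pow₀ one_le_two
    have h2 : (1 / 2 : ℝ) ^ (n + 1) = P⁻¹ / 2 := by
      rw [pow_succ, hP, one_div, inv_pow]; ring
    rw [h2]
    have h3 : 1 + P * 2 * σ ≤ 4 * P := by nlinarith
    calc P * 2 * ((w * P) ^ (2 * (d + 2)))⁻¹ * ((P * 2 * σ) ^ 2 * (1 + P * 2 * σ) ^ (2 * d))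
        ≤ P * 2 * ((w * P) ^ (2 * (d + 2)))⁻¹ * ((P * 2 * σ) ^ 2 * (4 * P) ^ (2 * d)) := by
          gcongr
      _ = 16 ^ (d + 1) * (σ ^ 2 * (w ^ (2 * (d + 2)))⁻¹) * (P⁻¹ / 2) := by
          rw [mul_pow w P, mul_pow 4 P, pow_mul 4 2 d, show (4:ℝ) ^ 2 = 16 by norm_num,
            pow_succ (16:ℝ) d, show 2 * (d + 2) = 2 * d + 4 by ring, pow_add P (2 * d) 4]
          field_simp
          norm_num
  · obtain ⟨n, rfl⟩ : ∃ n : ℕ, i = -n := ⟨(-i).toNat, by omega⟩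
    have h1 : (-(n:ℤ)).natAbs = n := by omega
    have h4 : (2:ℝ) ^ (1 - -(n:ℤ)) = 2 * 2 ^ n := by
      rw [sub_neg_eq_add, zpow_add₀ two_ne_zero, zpow_natCast, zpow_one]
    have h5 : (1 / 2 : ℝ) ^ n = ((2:ℝ) ^ n)⁻¹ := by rw [one_div, inv_pow]
    rw [h1, zpow_neg, zpow_natCast, h4, h5]
    set P : ℝ := (2:ℝ) ^ n with hP
    have hP1 : 1 ≤ P := one_le_pow₀ one_le_two
    have h3 : 1 + P⁻¹ * σ ≤ 4 := by
      have : P⁻¹ ≤ 1 := inv_le_one_of_one_le₀ hP1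
      have h5 : P⁻¹ * σ ≤ 1 := mul_le_one₀ this hσ0.le hσ1
      linarith
    calc 2 * P * ((P⁻¹ * σ) ^ 2 * (1 + P⁻¹ * σ) ^ (2 * d))
        ≤ 2 * P * ((P⁻¹ * σ) ^ 2 * 4 ^ (2 * d)) := by gcongr
      _ = 2 * 16 ^ d * (σ ^ 2 * 1) * P⁻¹ := by
          rw [pow_mul 4 2 d, show (4:ℝ) ^ 2 = 16 by norm_num]
          field_simp
      _ ≤ 16 ^ (d + 1) * (σ ^ 2 * (w ^ (2 * (d + 2)))⁻¹) * P⁻¹ := by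
          gcongr
          rw [pow_succ]
          nlinarith [pow_pos (by norm_num : (0:ℝ) < 16) d]

theorem summable_half_pow_natAbs : Summable fun i : ℤ => (1 / 2 : ℝ) ^ i.natAbs := by
  have h : Summable fun n : ℕ => (1 / 2 : ℝ) ^ n := summable_geometric_two
  refine Summable.of_nat_of_neg ?_ ?_ <;> simpa using h

theorem exists_sum_min_le : ∃ C : ℝ, 0 < C ∧ ∀ (S : Finset ℤ) (y : ℝ), 0 < y →
    ∑ j ∈ S, min ((2:ℝ) ^ j * y) ((2:ℝ) ^ j * y)⁻¹ ≤ C := by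
  set D := ∑' i : ℤ, (1 / 2 : ℝ) ^ i.natAbs with hD
  have hD0 : 0 < D := summable_half_pow_natAbs.tsum_pos (fun i => by positivity) 0 (by positivity)
  refine ⟨2 * D, by positivity, fun S y hy => ?_⟩
  obtain ⟨n, hn⟩ := exists_mem_Ioc_zpow hy (one_lt_two : (1:ℝ) < 2)
  have hterm : ∀ j : ℤ, min ((2:ℝ) ^ j * y) ((2:ℝ) ^ j * y)⁻¹ ≤
      2 * (1 / 2 : ℝ) ^ (j + n).natAbs := by
    intro j
    have h1 : (2:ℝ) ^ (j + n) ≤ (2:ℝ) ^ j * y := by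
      rw [zpow_add₀ two_ne_zero]
      have := hn.1.le
      gcongr
    have h2 : (2:ℝ) ^ j * y ≤ 2 * (2:ℝ) ^ (j + n) := by
      calc (2:ℝ) ^ j * y ≤ (2:ℝ) ^ j * (2:ℝ) ^ (n + 1) := by
            have := hn.2
            gcongr
        _ = _ := by rw [zpow_add₀ two_ne_zero, zpow_add₀ two_ne_zero, zpow_one]; ring
    rcases le_total 0 (j + n) with h | h
    · refine (min_le_right _ _).trans ((inv_anti₀ (by positivity) h1).trans ?_)
      obtain ⟨p, hp⟩ := Int.eq_ofNat_of_zero_le h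
      rw [hp, zpow_natCast, Int.natAbs_natCast, one_div, inv_pow]
      have : 0 ≤ ((2:ℝ) ^ p)⁻¹ := by positivity
      linarith
    · refine (min_le_left _ _).trans (h2.trans ?_)
      obtain ⟨p, hp⟩ := Int.eq_ofNat_of_zero_le (neg_nonneg.2 h)
      have hp' : j + n = -(p:ℤ) := by omega
      rw [hp', zpow_neg, zpow_natCast, Int.natAbs_neg, Int.natAbs_natCast, one_div, inv_pow]
  have hinj : Function.Injective fun j : ℤ => j + n := add_left_injective n
  calc ∑ j ∈ S, min ((2:ℝ) ^ j * y) ((2:ℝ) ^ j * y)⁻¹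
      ≤ ∑ j ∈ S, 2 * (1 / 2 : ℝ) ^ (j + n).natAbs := Finset.sum_le_sum fun j _ => hterm j
    _ = 2 * ∑ i ∈ S.map ⟨_, hinj⟩, (1 / 2 : ℝ) ^ i.natAbs := by
        rw [Finset.sum_map, Finset.mul_sum]
        rfl
    _ ≤ 2 * D := by
        gcongr
        exact summable_half_pow_natAbs.sum_le_tsum _ fun _ _ => by positivity

/-- The Cauchy-Schwarz inequality with weights. -/
theorem enorm_sum_sq_le {ι E : Type*} [NormedAddCommGroup E] (s : Finset ι) {z : ι → E}
    {ρ x : ι → ℝ}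
    (hρ : ∀ i ∈ s, 0 ≤ ρ i) (hx : ∀ i ∈ s, 0 ≤ x i) (h : ∀ i ∈ s, ‖z i‖ ^ 2 ≤ ρ i * x i) :
    ‖∑ i ∈ s, z i‖ₑ ^ 2 ≤ ENNReal.ofReal (∑ i ∈ s, ρ i) * ∑ i ∈ s, ENNReal.ofReal (x i) := by
  rw [← ENNReal.ofReal_sum_of_nonneg hx, ← ENNReal.ofReal_mul (Finset.sum_nonneg hρ),
    ← ofReal_norm, ← ENNReal.ofReal_pow (norm_nonneg _)]
  refine ENNReal.ofReal_le_ofReal (le_trans ?_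
    (Finset.sum_sq_le_sum_mul_sum_of_sq_le_mul s hρ hx h))
  gcongr
  exact norm_sum_le _ _

theorem lintegral_sum_mul_fourierR_le (d : ℕ) : ∃ C : ℝ, 0 < C ∧
    ∀ (𝒬 : Finset (ℤ × (Fin d → ℤ))) (b : ℤ × (Fin d → ℤ) → Rd d → ℝ) (A : ℝ),
      BadFamily d 𝒬 b A → 0 ≤ A → ∀ (s : ℕ) (w M : ℝ), 0 < w → w ≤ 1 → 0 ≤ M →
      ∀ m : ℤ → Rd d → ℂ, (∀ k ξ, ‖m k ξ‖ ≤ M) →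
      (∀ k ξ, ‖m k ξ‖ * (w * ((2:ℝ) ^ k * ‖ξ‖)) ^ (d + 2) ≤ M) →
      ∫⁻ ξ, ‖∑ q ∈ 𝒬, m (q.1 + s) ξ * fourierR d (b q) ξ‖ₑ ^ 2 ≤
        ENNReal.ofReal (C * M ^ 2 * A ^ 2 * (((2:ℝ) ^ s)⁻¹ ^ 2 * (w ^ (2 * (d + 2)))⁻¹)) *
          cubeSum d 𝒬 := by
  classical
  obtain ⟨C₁, hC₁, hmin⟩ := exists_sum_min_le
  obtain ⟨C₂, hC₂, hlow⟩ := lintegral_fourierR_low_le d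
  set D := ∑' i : ℤ, (1 / 2 : ℝ) ^ i.natAbs with hD
  have hD0 : 0 < D := summable_half_pow_natAbs.tsum_pos (fun i => by positivity) 0 (by positivity)
  refine ⟨C₁ * (C₂ * 16 ^ (d + 1) * D), by positivity, ?_⟩
  intro 𝒬 b A h hA s w M hw hw1 hM m hm1 hm2
  set J : Finset ℤ := 𝒬.image Prod.fst with hJ
  set 𝒬j : ℤ → Finset (ℤ × (Fin d → ℤ)) := fun j => 𝒬.filter fun q => q.1 = j with h𝒬j
  set β : ℤ → Rd d → ℝ := fun j x => ∑ q ∈ 𝒬j j, b q x with hβ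
  have hmaps : ∀ q ∈ 𝒬, q.1 ∈ J := fun q hq => Finset.mem_image_of_mem _ hq
  have hbad : ∀ j, BadFamily d (𝒬j j) b A := fun j => h.mono (Finset.filter_subset _ _)
  have hβF : ∀ j ξ, fourierR d (β j) ξ = ∑ q ∈ 𝒬j j, fourierR d (b q) ξ := fun j ξ =>
    fourierR_sum _ (fun q hq => (hbad j).integ q hq) ξ
  have hregroup : ∀ ξ, ∑ q ∈ 𝒬, m (q.1 + s) ξ * fourierR d (b q) ξ =
      ∑ j ∈ J, m (j + s) ξ * fourierR d (β j) ξ := by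
    intro ξ
    rw [← Finset.sum_fiberwise_of_maps_to hmaps]
    refine Finset.sum_congr rfl fun j _ => ?_
    rw [hβF, Finset.mul_sum]
    refine Finset.sum_congr rfl fun q hq => ?_
    rw [(Finset.mem_filter.1 hq).2]
  set c : ℤ → ℝ := fun i => M ^ 2 * shellWeight w (d + 2) i with hc
  have hc0 : ∀ i, 0 ≤ c i := fun i => mul_nonneg (sq_nonneg M) (shellWeight_nonneg hw _ i)
  set S : ℤ → ℤ → Set (Rd d) := fun j i => {ξ | ‖ξ‖ * (2:ℝ) ^ j ≤ (2:ℝ) ^ (i - s)} with hS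
  have hSm : ∀ j i, MeasurableSet (S j i) := fun j i =>
    measurableSet_le (measurable_norm.mul_const _) measurable_const
  have hpoint : ∀ ξ, ‖∑ j ∈ J, m (j + s) ξ * fourierR d (β j) ξ‖ₑ ^ 2 ≤
      ENNReal.ofReal C₁ * ∑ j ∈ J, ∑' i : ℤ, ENNReal.ofReal (c i) *
        (S j i).indicator (fun ξ => ‖fourierR d (β j) ξ‖ₑ ^ 2) ξ := by
    intro ξ
    rcases eq_or_ne ξ 0 with rfl | hξ
    · have h0 : ∀ j ∈ J, m (j + s) 0 * fourierR d (β j) 0 = 0 := by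
        intro j _
        rw [hβF, Finset.sum_eq_zero, mul_zero]
        intro q hq
        rw [fourierR_eq]
        simp [integral_complex_ofReal, (hbad j).mean q hq]
      rw [Finset.sum_eq_zero h0]
      simp
    have hξ0 : 0 < ‖ξ‖ := norm_pos_iff.2 hξ
    have hy : ∀ j : ℤ, (2:ℝ) ^ (j + (s:ℤ)) * ‖ξ‖ = (2:ℝ) ^ j * ((2:ℝ) ^ s * ‖ξ‖) := by
      intro j
      rw [zpow_add₀ two_ne_zero, zpow_natCast, mul_assoc]
    have hex : ∀ j : ℤ, ∃ i : ℤ, (2:ℝ) ^ j * ((2:ℝ) ^ s * ‖ξ‖) ≤ (2:ℝ) ^ i ∧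
        ‖m (j + s) ξ‖ ^ 2 ≤ min ((2:ℝ) ^ j * ((2:ℝ) ^ s * ‖ξ‖))
          ((2:ℝ) ^ j * ((2:ℝ) ^ s * ‖ξ‖))⁻¹ * c i := by
      intro j
      refine exists_shell hw (by positivity) (norm_nonneg _) (hm1 _ _) ?_
      rw [← hy]
      exact hm2 _ _
    choose i hi1 hi2 using hex
    refine (enorm_sum_sq_le J (z := fun j => m (j + s) ξ * fourierR d (β j) ξ)
      (ρ := fun j => min ((2:ℝ) ^ j * ((2:ℝ) ^ s * ‖ξ‖)) ((2:ℝ) ^ j * ((2:ℝ) ^ s * ‖ξ‖))⁻¹)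
      (x := fun j => c (i j) * ‖fourierR d (β j) ξ‖ ^ 2) (fun j _ => by positivity)
      (fun j _ => mul_nonneg (hc0 _) (sq_nonneg _)) fun j _ => ?_).trans ?_
    · rw [norm_mul, mul_pow, ← mul_assoc]
      exact mul_le_mul_of_nonneg_right (hi2 j) (sq_nonneg _)
    · refine mul_le_mul' (ENNReal.ofReal_le_ofReal (hmin J _ (by positivity)))
        (Finset.sum_le_sum fun j _ => ?_)
      refine le_trans (le_of_eq ?_) (ENNReal.le_tsum (i j))
      have hmem : ξ ∈ S j (i j) := by
        have h1 := hi1 j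
        simp only [hS, mem_ofPred_eq]
        rw [zpow_sub₀ two_ne_zero, zpow_natCast, le_div_iff₀ (by positivity)]
        linarith
      rw [indicator_of_mem hmem, ENNReal.ofReal_mul (hc0 _), ENNReal.ofReal_pow (norm_nonneg _),
        ofReal_norm]
  have hFm : ∀ j, Measurable fun ξ => ‖fourierR d (β j) ξ‖ₑ ^ 2 := fun j =>
    ((fourierR_continuous (hbad j).integrable_sum).measurable.enorm).pow_const 2
  set K : ℝ := C₂ * 16 ^ (d + 1) * M ^ 2 * A ^ 2 *
    (((2:ℝ) ^ s)⁻¹ ^ 2 * (w ^ (2 * (d + 2)))⁻¹) with hK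
  have hK0 : 0 ≤ K := by positivity
  have hshell : ∀ j i, ENNReal.ofReal (c i) * ∫⁻ ξ in S j i, ‖fourierR d (β j) ξ‖ₑ ^ 2 ≤
      ENNReal.ofReal (K * (1 / 2) ^ i.natAbs) * cubeSum d (𝒬j j) := by
    intro j i
    have h1 := hlow (𝒬j j) b A (hbad j) hA j (fun q hq => (Finset.mem_filter.1 hq).2)
      ((2:ℝ) ^ (i - (s:ℤ))) (by positivity)
    refine (mul_le_mul_right h1 _).trans ?_
    rw [← mul_assoc, ← ENNReal.ofReal_mul (hc0 i)]
    refine mul_le_mul_left (ENNReal.ofReal_le_ofReal ?_) _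
    have h2 := shellWeight_mul_le hw hw1 d s i
    calc c i * (C₂ * (((2:ℝ) ^ (i - (s:ℤ))) ^ 2 * (1 + (2:ℝ) ^ (i - (s:ℤ))) ^ (2 * d)) * A ^ 2)
        = C₂ * M ^ 2 * A ^ 2 * (shellWeight w (d + 2) i *
          (((2:ℝ) ^ (i - (s:ℤ))) ^ 2 * (1 + (2:ℝ) ^ (i - (s:ℤ))) ^ (2 * d))) := by
          simp only [hc]; ring
      _ ≤ C₂ * M ^ 2 * A ^ 2 * (16 ^ (d + 1) * (((2:ℝ) ^ s)⁻¹ ^ 2 *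
          (w ^ (2 * (d + 2)))⁻¹) * (1 / 2) ^ i.natAbs) := by gcongr
      _ = K * (1 / 2) ^ i.natAbs := by rw [hK]; ring
  calc ∫⁻ ξ, ‖∑ q ∈ 𝒬, m (q.1 + s) ξ * fourierR d (b q) ξ‖ₑ ^ 2
      ≤ ∫⁻ ξ, ENNReal.ofReal C₁ * ∑ j ∈ J, ∑' i : ℤ, ENNReal.ofReal (c i) *
        (S j i).indicator (fun ξ => ‖fourierR d (β j) ξ‖ₑ ^ 2) ξ := by
        refine lintegral_mono fun ξ => ?_
        rw [hregroup]
        exact hpoint ξ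
    _ = ENNReal.ofReal C₁ * ∑ j ∈ J, ∑' i : ℤ, ENNReal.ofReal (c i) *
        ∫⁻ ξ in S j i, ‖fourierR d (β j) ξ‖ₑ ^ 2 := by
        have hm' : ∀ j i, Measurable fun ξ => ENNReal.ofReal (c i) *
            (S j i).indicator (fun ξ => ‖fourierR d (β j) ξ‖ₑ ^ 2) ξ := fun j i =>
          ((hFm j).indicator (hSm j i)).const_mul _
        have hm'' : ∀ j ∈ J, Measurable fun ξ => ∑' i : ℤ, ENNReal.ofReal (c i) *
            (S j i).indicator (fun ξ => ‖fourierR d (β j) ξ‖ₑ ^ 2) ξ := fun j _ =>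
          Measurable.tsum (hm' j)
        rw [lintegral_const_mul _ (Finset.measurable_fun_sum _ hm''), lintegral_finsetSum _ hm'']
        congr 1
        refine Finset.sum_congr rfl fun j _ => ?_
        rw [lintegral_tsum fun i => (hm' j i).aemeasurable]
        refine tsum_congr fun i => ?_
        rw [lintegral_const_mul _ ((hFm j).indicator (hSm j i)), lintegral_indicator (hSm j i)]
    _ ≤ ENNReal.ofReal C₁ * ∑ j ∈ J, ∑' i : ℤ,
        ENNReal.ofReal (K * (1 / 2) ^ i.natAbs) * cubeSum d (𝒬j j) := by
        exact mul_le_mul_right (Finset.sum_le_sum fun j _ => ENNReal.tsum_le_tsum (hshell j)) _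
    _ = ENNReal.ofReal C₁ * (ENNReal.ofReal (K * D) * cubeSum d 𝒬) := by
        congr 1
        simp_rw [ENNReal.tsum_mul_right]
        rw [← Finset.mul_sum, ← ENNReal.ofReal_tsum_of_nonneg (fun i => by positivity)
          (summable_half_pow_natAbs.mul_left K), tsum_mul_left]
        congr 1
        exact Finset.sum_fiberwise_of_maps_to hmaps _
    _ = _ := by
        rw [← mul_assoc, ← ENNReal.ofReal_mul hC₁.le]
        congr 2
        rw [hK]
        ring

end Shells

section MultiScale

variable {d : ℕ}

/-- The restriction of `Ω` to a union of cones over cells. -/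
def coneRestrict (d : ℕ) (w : ℝ) (S : Set (Fin d → ℤ)) (Om : Rd d → ℝ) : Rd d → ℝ :=
  (cellidx d w ⁻¹' S).indicator Om

theorem coneRestrict_homogeneous {Om : Rd d → ℝ} (hOm : Homogeneous0 d Om) (w : ℝ)
    (S : Set (Fin d → ℤ)) : Homogeneous0 d (coneRestrict d w S Om) := by
  intro x hx r hr
  have h1 : r • x ∈ cellidx d w ⁻¹' S ↔ x ∈ cellidx d w ⁻¹' S := by
    rw [mem_preimage, mem_preimage, cellidx_smul w hr]
  by_cases h : x ∈ cellidx d w ⁻¹' S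
  · rw [coneRestrict, indicator_of_mem h, indicator_of_mem (h1.2 h), hOm x hx r hr]
  · rw [coneRestrict, indicator_of_notMem h, indicator_of_notMem (fun h' => h (h1.1 h'))]

theorem coneRestrict_aestronglyMeasurable {Om : Rd d → ℝ} (hOm : AEStronglyMeasurable Om volume)
    (w : ℝ) (S : Set (Fin d → ℤ)) : AEStronglyMeasurable (coneRestrict d w S Om) volume :=
  hOm.indicator (measurable_cellidx w S.to_countable.measurableSet)

theorem abs_coneRestrict_le {Om : Rd d → ℝ} {H : ℝ} (hH : ∀ x, |Om x| ≤ H) (w : ℝ)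
    (S : Set (Fin d → ℤ)) (x : Rd d) : |coneRestrict d w S Om x| ≤ H := by
  rw [coneRestrict, indicator]
  split_ifs
  · exact hH x
  · simpa using (abs_nonneg _).trans (hH x)

open Classical in
theorem Kker_eq_sum_coneRestrict {w : ℝ} (hw : 0 < w) (φ Om : Rd d → ℝ) (S : Set (Fin d → ℤ))
    (k : ℤ) (x : Rd d) :
    Kker d φ Om k x = ∑ v ∈ (cellSet d w).filter (· ∈ S), Kker d φ (coneRestrict d w {v} Om) k x +
      Kker d φ (coneRestrict d w Sᶜ Om) k x := by
  simp only [Kker, ← Finset.sum_mul, ← Finset.mul_sum]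
  rw [← add_mul, ← mul_add]
  congr 2
  simp only [coneRestrict, indicator, mem_preimage, mem_singleton_iff, mem_compl_iff]
  rw [Finset.sum_ite_eq]
  by_cases h : cellidx d w x ∈ S
  · simp [h, cellidx_mem_cellSet hw x]
  · simp [h]

theorem fourierR_zero_of_mean {β : Rd d → ℝ} (h : ∫ x, β x = 0) : fourierR d β 0 = 0 := by
  rw [fourierR_eq]
  simp only [inner_zero_right, mul_zero, Complex.ofReal_zero, zero_mul, Complex.exp_zero, one_mul]
  rw [integral_complex_ofReal, h, Complex.ofReal_zero]

theorem enorm_cv_Kker_coneRestrict_le {φ Om : Rd d → ℝ} {C H : ℝ} (hφ : AdmissiblePhi d φ)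
    (hC : ∀ x, |profile d φ x| ≤ C) (hH : ∀ x, |Om x| ≤ H) (w : ℝ) (v : Fin d → ℤ) (k : ℤ)
    (β : Rd d → ℝ) (x : Rd d) :
    ‖cv d (Kker d φ (coneRestrict d w {v} Om) k) β x‖ₑ ≤
      ENNReal.ofReal (C * H) * avgOver d (cellSector d w v) k β x := by
  have hC0 : 0 ≤ C := (abs_nonneg _).trans (hC 0)
  have hH0 : 0 ≤ H := (abs_nonneg _).trans (hH 0)
  refine (enorm_cv_le _ _ x).trans ?_
  rw [avgOver, ← lintegral_const_mul' _ _ ENNReal.ofReal_ne_top]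
  refine lintegral_mono fun y => ?_
  rw [← mul_assoc]
  refine mul_le_mul_left ?_ _
  by_cases h0 : Kker d φ (coneRestrict d w {v} Om) k (x - y) = 0
  · rw [h0]; simp
  · obtain ⟨h1, h2, h3⟩ := Kker_support hφ h0
    have hv : cellidx d w (x - y) = v := by
      by_contra hne
      exact h2 (indicator_of_notMem (by simpa using hne) _)
    have hmem : (2:ℝ) ^ (-k) • (x - y) ∈ cellSector d w v :=
      ⟨norm_pos_iff.2 (smul_ne_zero (by positivity) h1), by linarith,
        by rw [cellidx_smul w (by positivity), hv]⟩
    rw [avgKer, indicator_of_mem hmem, mul_one, ← ENNReal.ofReal_mul (by positivity),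
      ← ofReal_norm, Real.norm_eq_abs]
    exact ENNReal.ofReal_le_ofReal (abs_Kker_le hC (abs_coneRestrict_le hH w _) k _)

theorem lintegral_cone_sq_le {φ Om : Rd d → ℝ} {C H A : ℝ} {𝒬 : Finset (ℤ × (Fin d → ℤ))}
    {b : ℤ × (Fin d → ℤ) → Rd d → ℝ} (hd : 0 < d) (hφ : AdmissiblePhi d φ)
    (hC : ∀ x, |profile d φ x| ≤ C) (hOm : AEStronglyMeasurable Om volume)
    (hH : ∀ x, |Om x| ≤ H) (h : BadFamily d 𝒬 b A) (hA : 0 ≤ A) {s : ℕ} {w : ℝ} (hw : 0 < w)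
    (hws : ((2:ℝ) ^ s)⁻¹ ≤ w) (v : Fin d → ℤ) :
    ∫⁻ ξ, ‖∑ q ∈ 𝒬, fourierR d (Kker d φ (coneRestrict d w {v} Om) (q.1 + s)) ξ *
        fourierR d (b q) ξ‖ₑ ^ 2 ≤
      ENNReal.ofReal (2 * (C * H * A) ^ 2) *
        (volume (cellSector d w v) * volume (cellTube d w v)) * cubeSum d 𝒬 := by
  have hC0 : 0 ≤ C := (abs_nonneg _).trans (hC 0)
  have hH0 : 0 ≤ H := (abs_nonneg _).trans (hH 0)
  have hK : ∀ k, Integrable (Kker d φ (coneRestrict d w {v} Om) k) := fun k =>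
    Kker_integrable hφ (coneRestrict_aestronglyMeasurable hOm w _) (abs_coneRestrict_le hH w _) k
  have hKb : ∀ k x, |Kker d φ (coneRestrict d w {v} Om) k x| ≤ C * H * (2:ℝ) ^ (-(k * d)) :=
    abs_Kker_le hC (abs_coneRestrict_le hH w _)
  have hi : ∀ q ∈ 𝒬, Integrable (cv d (Kker d φ (coneRestrict d w {v} Om) (q.1 + s)) (b q)) :=
    fun q hq => cv_integrable (hK _) (h.integ q hq)
  have hF : ∀ ξ, ∑ q ∈ 𝒬, fourierR d (Kker d φ (coneRestrict d w {v} Om) (q.1 + s)) ξ *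
      fourierR d (b q) ξ = fourierR d (fun x => ∑ q ∈ 𝒬,
        cv d (Kker d φ (coneRestrict d w {v} Om) (q.1 + s)) (b q) x) ξ := by
    intro ξ
    rw [fourierR_sum _ hi]
    exact Finset.sum_congr rfl fun q hq => (fourierR_cv (hK _) (h.integ q hq) ξ).symm
  simp_rw [hF]
  rw [lintegral_fourierR_sq (integrable_finsetSum _ hi)
    (memLp_finsetSum _ fun q hq => cv_memLp (hK _) (hKb _) (h.integ q hq))]
  have hG := lintegral_avgOver_sq_le h hA s (measurableSet_cellSector w v)
    (T := cellTube d w v) (fun u hu u' hu' r hr hr1 z hz =>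
      cellSector_sub_mem_cellTube hd hw hu hu' hr hr1 (hz.trans (by
        rw [zpow_neg, zpow_natCast]; gcongr)))
  calc ∫⁻ x, ‖∑ q ∈ 𝒬, cv d (Kker d φ (coneRestrict d w {v} Om) (q.1 + s)) (b q) x‖ₑ ^ 2
      ≤ ∫⁻ x, ENNReal.ofReal (C * H) ^ 2 *
          (∑ q ∈ 𝒬, avgOver d (cellSector d w v) (q.1 + s) (b q) x) ^ 2 := by
        refine lintegral_mono fun x => ?_
        rw [← mul_pow, Finset.mul_sum]
        refine pow_le_pow_left₀ (zero_le) ((enorm_sum_le _ _).trans ?_) 2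
        exact Finset.sum_le_sum fun q _ => enorm_cv_Kker_coneRestrict_le hφ hC hH w v _ _ x
    _ ≤ ENNReal.ofReal (C * H) ^ 2 * (2 * ENNReal.ofReal A ^ 2 * volume (cellSector d w v) *
        volume (cellTube d w v) * cubeSum d 𝒬) := by
        rw [lintegral_const_mul' _ _ (by finiteness)]
        exact mul_le_mul_right hG _
    _ = _ := by
        rw [ENNReal.ofReal_mul zero_le_two, ENNReal.ofReal_pow (by positivity),
          ENNReal.ofReal_mul (by positivity : 0 ≤ C * H), ENNReal.ofReal_ofNat, mul_pow]
        ring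

theorem ofReal_inv_mul_le_one {μ : ℝ≥0∞} (hμ : μ ≠ ⊤) {r : ℝ} (hr : 0 < r) (h : μ.toReal ≤ r) :
    ENNReal.ofReal r⁻¹ * μ ≤ 1 := by
  rw [← ENNReal.ofReal_toReal hμ, ← ENNReal.ofReal_mul (by positivity), ← ENNReal.ofReal_one]
  refine ENNReal.ofReal_le_ofReal ?_
  rw [← div_eq_inv_mul]
  exact div_le_one_of_le₀ h hr.le

open Classical in
/-- An `L²` bound for sums over good cells. -/
theorem exists_lintegral_sum_goodCell_le (d : ℕ) : ∃ C : ℝ, 0 < C ∧ ∀ w : ℝ, 0 < w → w ≤ 1 →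
    ∀ (G : (Fin d → ℤ) → Rd d → ℂ) (B : ℝ≥0∞), (∀ v, Continuous (G v)) → (∀ v, G v 0 = 0) →
    (∀ v, ∫⁻ ξ, ‖G v ξ‖ₑ ^ 2 ≤ B * (volume (cellSector d w v) * volume (cellTube d w v))) →
    ∃ P : Rd d → ℝ≥0∞, Measurable P ∧
      (∀ ξ, ‖∑ v ∈ (cellSet d w).filter (· ∈ {v | goodCell d w ξ v}), G v ξ‖ₑ ^ 2 ≤ P ξ) ∧
      ∫⁻ ξ, P ξ ≤ ENNReal.ofReal (C * w) * B := by
  obtain ⟨Ct, hCt, ht⟩ := exists_sum_volume_cellTube_le d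
  set V5 : ℝ := (volume (ball (0 : Rd d) 5)).toReal with hV5
  have hV5' : volume (ball (0 : Rd d) 5) = ENNReal.ofReal V5 :=
    (ENNReal.ofReal_toReal measure_ball_lt_top.ne).symm
  have hV50 : 0 ≤ V5 := ENNReal.toReal_nonneg
  refine ⟨((1 + Real.sqrt d) * V5 + 1) * Ct, by positivity, fun w hw hw1 G B hGc hG0 hG => ?_⟩
  set V := cellSet d w with hV
  obtain ⟨n, hn⟩ : ∃ n : ℝ, n = (V.card : ℝ) + 1 := ⟨_, rfl⟩
  have hn0 : 0 < n := hn ▸ Nat.cast_add_one_pos _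
  set μ : (Fin d → ℤ) → ℝ := fun v => (volume (cellSector d w v)).toReal with hμ
  have hμ0 : ∀ v, 0 ≤ μ v := fun v => ENNReal.toReal_nonneg
  set ρ : (Fin d → ℤ) → ℝ := fun v => μ v + w / n with hρ
  have hρ0 : ∀ v, 0 < ρ v := fun v => by have := hμ0 v; positivity
  have hsumρ : ∀ ξ : Rd d, ξ ≠ 0 → ∑ v ∈ V.filter (· ∈ {v | goodCell d w ξ v}), ρ v ≤
      ((1 + Real.sqrt d) * V5 + 1) * w := by
    intro ξ hξ
    have h1 := sum_volume_goodCell_le hw hξ V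
    have h2 : ∑ v ∈ V.filter (· ∈ {v | goodCell d w ξ v}), μ v ≤ (1 + Real.sqrt d) * w * V5 := by
      rw [hV5', ← ENNReal.ofReal_mul (by positivity)] at h1
      have h3 := ENNReal.toReal_mono ENNReal.ofReal_ne_top h1
      rwa [ENNReal.toReal_ofReal (by positivity),
        ENNReal.toReal_sum fun v _ => volume_cellSector_ne_top w v] at h3
    have h3 : ∑ v ∈ V.filter (· ∈ {v | goodCell d w ξ v}), w / n ≤ w := by
      rw [Finset.sum_const, nsmul_eq_mul, mul_div_assoc', div_le_iff₀ (by positivity), mul_comm]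
      have : ((V.filter (· ∈ {v | goodCell d w ξ v})).card : ℝ) ≤ n := by
        have : (V.filter (· ∈ {v | goodCell d w ξ v})).card ≤ V.card := Finset.card_filter_le _ _
        rw [hn]
        exact_mod_cast this.trans (Nat.le_succ _)
      gcongr
    simp only [hρ, Finset.sum_add_distrib]
    linarith
  have hpoint : ∀ ξ, ‖∑ v ∈ V.filter (· ∈ {v | goodCell d w ξ v}), G v ξ‖ₑ ^ 2 ≤
      ENNReal.ofReal (((1 + Real.sqrt d) * V5 + 1) * w) *
        ∑ v ∈ V, ENNReal.ofReal (ρ v)⁻¹ * ‖G v ξ‖ₑ ^ 2 := by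
    intro ξ
    rcases eq_or_ne ξ 0 with rfl | hξ
    · simp [hG0]
    have h1 := enorm_sum_sq_le (V.filter (· ∈ {v | goodCell d w ξ v})) (z := fun v => G v ξ)
      (ρ := ρ) (x := fun v => (ρ v)⁻¹ * ‖G v ξ‖ ^ 2) (fun v _ => (hρ0 v).le)
      (fun v _ => by have := hρ0 v; positivity)
      (fun v _ => by rw [mul_inv_cancel_left₀ (hρ0 v).ne'])
    refine h1.trans (mul_le_mul' (ENNReal.ofReal_le_ofReal (hsumρ ξ hξ)) ?_)
    refine le_trans (Finset.sum_le_sum_of_subset (Finset.filter_subset _ _)) (le_of_eq ?_)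
    refine Finset.sum_congr rfl fun v _ => ?_
    rw [ENNReal.ofReal_mul (inv_nonneg.2 (hρ0 v).le), ENNReal.ofReal_pow (norm_nonneg _),
      ofReal_norm]
  have hm : ∀ v ∈ V, Measurable fun ξ => ENNReal.ofReal (ρ v)⁻¹ * ‖G v ξ‖ₑ ^ 2 := fun v _ =>
    (((hGc v).measurable.enorm).pow_const 2).const_mul _
  refine ⟨_, (Finset.measurable_fun_sum V hm).const_mul _, hpoint, ?_⟩
  rw [lintegral_const_mul' _ _ ENNReal.ofReal_ne_top, lintegral_finsetSum _ hm]
  have h2 : ∀ v ∈ V, ∫⁻ ξ, ENNReal.ofReal (ρ v)⁻¹ * ‖G v ξ‖ₑ ^ 2 ≤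
      B * volume (cellTube d w v) := by
    intro v _
    rw [lintegral_const_mul' _ _ ENNReal.ofReal_ne_top]
    refine (mul_le_mul_right (hG v) _).trans ?_
    have h3 := ofReal_inv_mul_le_one (volume_cellSector_ne_top w v) (hρ0 v)
      (by simp only [hρ, hμ]; linarith [(by positivity : 0 < w / n)])
    calc ENNReal.ofReal (ρ v)⁻¹ * (B * (volume (cellSector d w v) * volume (cellTube d w v)))
        = (ENNReal.ofReal (ρ v)⁻¹ * volume (cellSector d w v)) *
          (B * volume (cellTube d w v)) := by ring
      _ ≤ 1 * (B * volume (cellTube d w v)) := mul_le_mul_left h3 _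
      _ = _ := one_mul _
  refine (mul_le_mul_right (Finset.sum_le_sum h2) _).trans ?_
  rw [← Finset.mul_sum]
  refine (mul_le_mul_right (mul_le_mul_right (ht w hw hw1 V) _) _).trans (le_of_eq ?_)
  rw [show ((1 + Real.sqrt d) * V5 + 1) * Ct * w = ((1 + Real.sqrt d) * V5 + 1) * w * Ct by ring,
    ENNReal.ofReal_mul (by positivity : 0 ≤ ((1 + Real.sqrt d) * V5 + 1) * w)]
  ring

theorem enorm_add_sq_le (a b : ℂ) : ‖a + b‖ₑ ^ 2 ≤ 2 * (‖a‖ₑ ^ 2 + ‖b‖ₑ ^ 2) := by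
  simp only [← ofReal_norm, ← ENNReal.ofReal_pow (norm_nonneg _)]
  rw [← ENNReal.ofReal_add (by positivity) (by positivity), ← ENNReal.ofReal_ofNat,
    ← ENNReal.ofReal_mul zero_le_two]
  refine ENNReal.ofReal_le_ofReal ?_
  have := norm_add_le a b
  nlinarith [sq_nonneg (‖a‖ - ‖b‖), norm_nonneg (a + b)]

/-- The multi-scale `L²` bound. -/
theorem exists_lintegral_sum_cv_sq_le {φ : Rd d → ℝ} (hd : 0 < d) (hφ : AdmissiblePhi d φ) :
    ∃ C : ℝ, 0 < C ∧ ∀ Om : Rd d → ℝ, Homogeneous0 d Om → AEStronglyMeasurable Om volume →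
      ∀ H : ℝ, (∀ x, |Om x| ≤ H) →
      ∀ (𝒬 : Finset (ℤ × (Fin d → ℤ))) (b : ℤ × (Fin d → ℤ) → Rd d → ℝ) (A : ℝ),
      BadFamily d 𝒬 b A → 0 ≤ A → ∀ s : ℕ, ∀ w : ℝ, 0 < w → w ≤ 1 →
      w ^ (2 * (d + 2)) = ((2:ℝ) ^ s)⁻¹ →
      ∫⁻ x, ‖∑ q ∈ 𝒬, cv d (Kker d φ Om (q.1 + s)) (b q) x‖ₑ ^ 2 ≤
        ENNReal.ofReal (C * (H * A) ^ 2 * w) * cubeSum d 𝒬 := by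
  classical
  obtain ⟨Cp, hCp, hp⟩ := exists_profile_bound hφ
  obtain ⟨Cg, hCg, hgood⟩ := exists_lintegral_sum_goodCell_le d
  obtain ⟨Cl, hCl, hlp⟩ := lintegral_sum_mul_fourierR_le d
  obtain ⟨C0, hC0, hdec0⟩ := exists_kernel_decay hφ 0
  obtain ⟨C1, hC1, hdec⟩ := exists_kernel_decay hφ (d + 2)
  refine ⟨2 * (Cg * (2 * Cp ^ 2) + Cl * (C0 + C1) ^ 2), by positivity,
    fun Om hOm hOmm H hH 𝒬 b A h hA s w hw hw1 hws => ?_⟩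
  have hH0 : 0 ≤ H := (abs_nonneg _).trans (hH 0)
  have hpw : w ^ (2 * (d + 2)) ≤ w := pow_le_of_le_one hw.le hw1 (by omega)
  have hR : ∀ S k, Integrable (Kker d φ (coneRestrict d w S Om) k) := fun S k =>
    Kker_integrable hφ (coneRestrict_aestronglyMeasurable hOmm w _) (abs_coneRestrict_le hH w _) k
  have hK : ∀ k, Integrable (Kker d φ Om k) := Kker_integrable hφ hOmm hH
  have hi : ∀ q ∈ 𝒬, Integrable (cv d (Kker d φ Om (q.1 + s)) (b q)) := fun q hq =>
    cv_integrable (hK _) (h.integ q hq)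
  rw [← lintegral_fourierR_sq (integrable_finsetSum _ hi)
    (memLp_finsetSum _ fun q hq => cv_memLp (hK _) (abs_Kker_le hp hH _) (h.integ q hq))]
  set G : (Fin d → ℤ) → Rd d → ℂ := fun v ξ => ∑ q ∈ 𝒬,
    fourierR d (Kker d φ (coneRestrict d w {v} Om) (q.1 + s)) ξ * fourierR d (b q) ξ with hG
  set m : ℤ → Rd d → ℂ := fun k ξ =>
    fourierR d (Kker d φ (coneRestrict d w {v | goodCell d w ξ v}ᶜ Om) k) ξ with hm
  have hdecomp : ∀ ξ, fourierR d (fun x => ∑ q ∈ 𝒬, cv d (Kker d φ Om (q.1 + s)) (b q) x) ξ =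
      ∑ v ∈ (cellSet d w).filter (· ∈ {v | goodCell d w ξ v}), G v ξ +
        ∑ q ∈ 𝒬, m (q.1 + s) ξ * fourierR d (b q) ξ := by
    intro ξ
    rw [fourierR_sum _ hi, hG]
    simp only
    rw [Finset.sum_comm, ← Finset.sum_add_distrib]
    refine Finset.sum_congr rfl fun q hq => ?_
    rw [fourierR_cv (hK _) (h.integ q hq), ← Finset.sum_mul, ← add_mul]
    congr 1
    rw [← fourierR_sum _ fun v _ => hR {v} _, hm]
    simp only
    rw [← fourierR_add (integrable_finsetSum _ fun v _ => hR {v} _) (hR _ _)]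
    congr 1
    funext x
    exact Kker_eq_sum_coneRestrict hw φ Om {v | goodCell d w ξ v} _ x
  have hGc : ∀ v, Continuous (G v) := fun v => continuous_finsetSum _ fun q hq =>
    (fourierR_continuous (hR _ _)).mul (fourierR_continuous (h.integ q hq))
  have hG0 : ∀ v, G v 0 = 0 := fun v => Finset.sum_eq_zero fun q hq => by
    rw [fourierR_zero_of_mean (h.mean q hq), mul_zero]
  have hGb : ∀ v, ∫⁻ ξ, ‖G v ξ‖ₑ ^ 2 ≤ ENNReal.ofReal (2 * (Cp * H * A) ^ 2) * cubeSum d 𝒬 *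
      (volume (cellSector d w v) * volume (cellTube d w v)) := fun v =>
    (lintegral_cone_sq_le hd hφ hp hOmm hH h hA hw (hws ▸ hpw) v).trans_eq (by ring)
  obtain ⟨P, hPm, hP, hPi⟩ := hgood w hw hw1 G _ hGc hG0 hGb
  have hcond : ∀ k ξ x, coneRestrict d w {v | goodCell d w ξ v}ᶜ Om x ≠ 0 →
      w * ‖x‖ * ‖(2:ℝ) ^ (k:ℤ) • ξ‖ ≤ |⟪x, (2:ℝ) ^ (k:ℤ) • ξ⟫| := by
    intro k ξ x hx
    rcases eq_or_ne x 0 with rfl | hx0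
    · simp
    have hnot : ¬ goodCell d w ξ (cellidx d w x) := by
      intro hgd
      exact hx (indicator_of_notMem (by simpa using hgd) _)
    have hlt : w * ‖x‖ * ‖ξ‖ ≤ |⟪x, ξ⟫| := by
      by_contra hlt
      exact hnot ⟨x, hx0, rfl, (not_le.1 hlt).le⟩
    rw [norm_smul, inner_smul_right, abs_mul, Real.norm_eq_abs]
    calc w * ‖x‖ * (|(2:ℝ) ^ k| * ‖ξ‖) = |(2:ℝ) ^ k| * (w * ‖x‖ * ‖ξ‖) := by ring
      _ ≤ _ := by gcongr
  have hmb : ∀ k ξ, ‖m k ξ‖ ≤ (C0 + C1) * H := by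
    intro k ξ
    have h2 := hdec0 _ (coneRestrict_homogeneous hOm w {v | goodCell d w ξ v}ᶜ)
      (coneRestrict_aestronglyMeasurable hOmm w _) H (abs_coneRestrict_le hH w _)
      ((2:ℝ) ^ k • ξ) w hw.le (hcond k ξ)
    rw [pow_zero, mul_one, ← fourierR_Kker hφ (coneRestrict_homogeneous hOm w _)] at h2
    refine h2.trans ?_
    gcongr
    linarith
  have hmd : ∀ k ξ, ‖m k ξ‖ * (w * ((2:ℝ) ^ k * ‖ξ‖)) ^ (d + 2) ≤ (C0 + C1) * H := by
    intro k ξ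
    have h2 := hdec _ (coneRestrict_homogeneous hOm w {v | goodCell d w ξ v}ᶜ)
      (coneRestrict_aestronglyMeasurable hOmm w _) H (abs_coneRestrict_le hH w _)
      ((2:ℝ) ^ k • ξ) w hw.le (hcond k ξ)
    rw [← fourierR_Kker hφ (coneRestrict_homogeneous hOm w _), norm_smul,
      Real.norm_of_nonneg (by positivity)] at h2
    refine h2.trans ?_
    gcongr
    linarith
  have h2 := hlp 𝒬 b A h hA s w ((C0 + C1) * H) hw hw1 (by positivity) m hmb hmd
  have hpt : ∀ ξ, ‖fourierR d (fun x => ∑ q ∈ 𝒬, cv d (Kker d φ Om (q.1 + s)) (b q) x) ξ‖ₑ ^ 2 ≤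
      2 * (P ξ + ‖∑ q ∈ 𝒬, m (q.1 + s) ξ * fourierR d (b q) ξ‖ₑ ^ 2) := by
    intro ξ
    rw [hdecomp ξ]
    exact (enorm_add_sq_le _ _).trans (mul_le_mul_right (add_le_add (hP ξ) le_rfl) _)
  have h3 : ((2:ℝ) ^ s)⁻¹ ^ 2 * (w ^ (2 * (d + 2)))⁻¹ ≤ w := by
    have hpos : 0 < w ^ (2 * (d + 2)) := by positivity
    rw [← hws, sq, mul_assoc, mul_inv_cancel₀ hpos.ne', mul_one]
    exact hpw
  calc ∫⁻ ξ, ‖fourierR d (fun x => ∑ q ∈ 𝒬, cv d (Kker d φ Om (q.1 + s)) (b q) x) ξ‖ₑ ^ 2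
      ≤ ∫⁻ ξ, 2 * (P ξ + ‖∑ q ∈ 𝒬, m (q.1 + s) ξ * fourierR d (b q) ξ‖ₑ ^ 2) := lintegral_mono hpt
    _ = 2 * ((∫⁻ ξ, P ξ) + ∫⁻ ξ, ‖∑ q ∈ 𝒬, m (q.1 + s) ξ * fourierR d (b q) ξ‖ₑ ^ 2) := by
        rw [lintegral_const_mul' _ _ ENNReal.ofNat_ne_top, lintegral_add_left hPm]
    _ ≤ 2 * (ENNReal.ofReal (Cg * w) * (ENNReal.ofReal (2 * (Cp * H * A) ^ 2) * cubeSum d 𝒬) +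
        ENNReal.ofReal (Cl * ((C0 + C1) * H) ^ 2 * A ^ 2 * w) * cubeSum d 𝒬) := by
        refine mul_le_mul_right (add_le_add hPi (h2.trans ?_)) _
        refine mul_le_mul_left (ENNReal.ofReal_le_ofReal ?_) _
        gcongr
    _ = _ := by
        rw [← mul_assoc, ← ENNReal.ofReal_mul (by positivity), ← add_mul,
          ← ENNReal.ofReal_add (by positivity) (by positivity), ← ENNReal.ofReal_ofNat, ← mul_assoc,
          ← ENNReal.ofReal_mul zero_le_two]
        congr 2
        ring

end MultiScale

section RademacherMenshov

variable {ι X : Type*} [MeasurableSpace X] {μ : Measure X}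

theorem enorm_add_sq_le_weighted (a b : ℝ) (n : ℕ) :
    ‖a + b‖ₑ ^ 2 ≤ ENNReal.ofReal (n + 2) * ‖a‖ₑ ^ 2 +
      ENNReal.ofReal ((n + 2) / (n + 1)) * ‖b‖ₑ ^ 2 := by
  simp only [← ofReal_norm, ← ENNReal.ofReal_pow (norm_nonneg _)]
  rw [← ENNReal.ofReal_mul (by positivity), ← ENNReal.ofReal_mul (by positivity),
    ← ENNReal.ofReal_add (by positivity) (by positivity)]
  refine ENNReal.ofReal_le_ofReal ?_
  simp only [Real.norm_eq_abs, sq_abs]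
  have h1 : ((n:ℝ) + 2) * a ^ 2 + ((n:ℝ) + 2) / (n + 1) * b ^ 2 - (a + b) ^ 2 =
      ((n + 1) * a - b) ^ 2 / (n + 1) := by
    field_simp
    ring
  have h2 : 0 ≤ (((n:ℝ) + 1) * a - b) ^ 2 / (n + 1) := by positivity
  linarith

open Classical in
/-- The Rademacher–Menshov inequality for a family labelled by `2 ^ n` consecutive integers. -/
theorem exists_maximal_of_label {g : ι → X → ℝ} {v : ι → ℝ≥0∞} {B : ℝ≥0∞} (N : ι → ℕ) (n : ℕ) :
    ∀ (c : ℕ) (S : Finset ι), (∀ q ∈ S, AEMeasurable (g q) μ) →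
      (∀ S' ⊆ S, ∫⁻ x, ‖∑ q ∈ S', g q x‖ₑ ^ 2 ∂μ ≤ B * ∑ q ∈ S', v q) →
      (∀ q ∈ S, c ≤ N q ∧ N q < c + 2 ^ n) →
      ∃ M : X → ℝ≥0∞, AEMeasurable M μ ∧
        (∀ a x, ‖∑ q ∈ S.filter (fun q => N q < a), g q x‖ₑ ^ 2 ≤ M x) ∧
        ∫⁻ x, M x ∂μ ≤ ENNReal.ofReal ((n + 1) ^ 2) * (B * ∑ q ∈ S, v q) := by
  induction n with
  | zero =>
    intro c S hg hB hN
    refine ⟨fun x => ‖∑ q ∈ S, g q x‖ₑ ^ 2,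
      ((Finset.aemeasurable_fun_sum _ hg).enorm).pow_const 2, fun a x => ?_, ?_⟩
    · rcases lt_or_ge c a with h | h
      · rw [Finset.filter_true_of_mem fun q hq => by have := hN q hq; omega]
      · rw [Finset.filter_false_of_mem fun q hq => by have := hN q hq; omega]
        simp
    · simpa using hB S subset_rfl
  | succ n ih =>
    intro c S hg hB hN
    set S₁ := S.filter (fun q => N q < c + 2 ^ n) with hS₁
    set S₂ := S.filter (fun q => ¬ N q < c + 2 ^ n) with hS₂
    have hs₁ : S₁ ⊆ S := Finset.filter_subset _ _
    have hs₂ : S₂ ⊆ S := Finset.filter_subset _ _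
    obtain ⟨M₁, hM₁, hp₁, hi₁⟩ := ih c S₁ (fun q hq => hg q (hs₁ hq))
      (fun S' hS' => hB S' (hS'.trans hs₁))
      (fun q hq => ⟨(hN q (hs₁ hq)).1, (Finset.mem_filter.1 hq).2⟩)
    obtain ⟨M₂, hM₂, hp₂, hi₂⟩ := ih (c + 2 ^ n) S₂ (fun q hq => hg q (hs₂ hq))
      (fun S' hS' => hB S' (hS'.trans hs₂))
      (fun q hq => ⟨not_lt.1 (Finset.mem_filter.1 hq).2, by
        have := (hN q (hs₂ hq)).2
        rw [pow_succ] at this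
        omega⟩)
    have hmid : AEMeasurable (fun x => ENNReal.ofReal (n + 2) * ‖∑ q ∈ S₁, g q x‖ₑ ^ 2) μ :=
      (((Finset.aemeasurable_fun_sum _ fun q hq => hg q (hs₁ hq)).enorm).pow_const 2).const_mul _
    refine ⟨fun x => M₁ x + (ENNReal.ofReal (n + 2) * ‖∑ q ∈ S₁, g q x‖ₑ ^ 2 +
      ENNReal.ofReal ((n + 2) / (n + 1)) * M₂ x), hM₁.add (hmid.add (hM₂.const_mul _)),
      fun a x => ?_, ?_⟩
    · rcases le_or_gt a (c + 2 ^ n) with h | h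
      · have h1 : S.filter (fun q => N q < a) = S₁.filter (fun q => N q < a) := by
          rw [hS₁, Finset.filter_filter]
          exact Finset.filter_congr fun q _ => ⟨fun h' => ⟨by omega, h'⟩, fun h' => h'.2⟩
        rw [h1]
        exact (hp₁ a x).trans le_self_add
      · have h1 : ∑ q ∈ S.filter (fun q => N q < a), g q x =
            ∑ q ∈ S₁, g q x + ∑ q ∈ S₂.filter (fun q => N q < a), g q x := by
          rw [← Finset.sum_filter_add_sum_filter_not (S.filter (fun q => N q < a))
            (fun q => N q < c + 2 ^ n), hS₁, hS₂, Finset.filter_filter, Finset.filter_filter,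
            Finset.filter_filter]
          congr 1
          · refine Finset.sum_congr (Finset.filter_congr fun q _ =>
              ⟨fun h' => h'.2, fun h' => ⟨by omega, h'⟩⟩) fun _ _ => rfl
          · exact Finset.sum_congr (Finset.filter_congr fun q _ => and_comm) fun _ _ => rfl
        rw [h1]
        refine (enorm_add_sq_le_weighted _ _ n).trans ?_
        refine le_trans ?_ le_add_self
        gcongr
        exact hp₂ a x
    · rw [lintegral_add_left' hM₁, lintegral_add_left' hmid,
        lintegral_const_mul' _ _ ENNReal.ofReal_ne_top,
        lintegral_const_mul' _ _ ENNReal.ofReal_ne_top,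
        ← Finset.sum_filter_add_sum_filter_not S (fun q => N q < c + 2 ^ n)]
      refine (add_le_add hi₁ (add_le_add (mul_le_mul_right (hB S₁ hs₁) _)
        (mul_le_mul_right hi₂ _))).trans ?_
      rw [← hS₁, ← hS₂, ← add_assoc, ← add_mul, ← mul_assoc (ENNReal.ofReal _),
        ← ENNReal.ofReal_add (by positivity) (by positivity), ← ENNReal.ofReal_mul (by positivity),
        mul_add B, mul_add (ENNReal.ofReal _)]
      refine add_le_add (mul_le_mul_left (ENNReal.ofReal_le_ofReal ?_) _)
        (mul_le_mul_left (ENNReal.ofReal_le_ofReal ?_) _)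
      · push_cast
        nlinarith [(Nat.cast_nonneg n : (0:ℝ) ≤ n)]
      · have : ((n:ℝ) + 2) / (n + 1) * ((n + 1) ^ 2) = (n + 2) * (n + 1) := by
          field_simp
        rw [this]
        push_cast
        nlinarith [(Nat.cast_nonneg n : (0:ℝ) ≤ n)]

end RademacherMenshov

section Tower

variable {ι X γ : Type*}

open Classical in
/-- The members of `S` of strictly higher level whose cell contains the base point of `q`. -/
def above (cell : ℤ → X → γ) (lev : ι → ℤ) (pt : ι → X) (S : Finset ι) (q : ι) : Finset ι :=
  S.filter fun q' => lev q < lev q' ∧ cell (lev q') (pt q') = cell (lev q') (pt q)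

/-- The number of members of `S` above `q`. -/
def depth (cell : ℤ → X → γ) (lev : ι → ℤ) (pt : ι → X) (S : Finset ι) (q : ι) : ℕ :=
  (above cell lev pt S q).card

/-- A sequence of partitions getting coarser. -/
def NestedCells (cell : ℤ → X → γ) : Prop :=
  ∀ n n' x y, n ≤ n' → cell n x = cell n y → cell n' x = cell n' y

variable {cell : ℤ → X → γ} {lev : ι → ℤ} {pt : ι → X} {S : Finset ι}

theorem exists_depth_threshold (hnest : NestedCells cell) (x : X) (l : ℤ) :
    ∃ a : ℕ, ∀ q ∈ S, cell (lev q) x = cell (lev q) (pt q) →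
      (l ≤ lev q ↔ depth cell lev pt S q < a) := by
  classical
  set R := S.filter fun q => cell (lev q) x = cell (lev q) (pt q) with hR
  refine ⟨(R.filter fun q => l ≤ lev q).card, fun q hq hqx => ?_⟩
  have habove : above cell lev pt S q = R.filter fun q' => lev q < lev q' := by
    rw [above, hR, Finset.filter_filter]
    refine Finset.filter_congr fun q' _ => ?_
    constructor
    · rintro ⟨h1, h2⟩
      exact ⟨(hnest _ _ _ _ h1.le hqx).trans h2.symm, h1⟩
    · rintro ⟨h1, h2⟩
      exact ⟨h2, h1.symm.trans (hnest _ _ _ _ h2.le hqx)⟩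
  rw [depth, habove]
  constructor
  · intro hl
    refine Finset.card_lt_card (Finset.ssubset_iff_of_subset ?_ |>.2 ⟨q, ?_, ?_⟩)
    · intro q' hq'
      rw [Finset.mem_filter] at hq' ⊢
      exact ⟨hq'.1, hl.trans hq'.2.le⟩
    · exact Finset.mem_filter.2 ⟨Finset.mem_filter.2 ⟨hq, hqx⟩, hl⟩
    · exact fun h => lt_irrefl _ (Finset.mem_filter.1 h).2
  · intro hlt
    by_contra hl
    refine absurd hlt (not_lt.2 (Finset.card_le_card fun q' hq' => ?_))
    rw [Finset.mem_filter] at hq' ⊢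
    exact ⟨hq'.1, (not_le.1 hl).trans_le hq'.2⟩

open Classical in
theorem le_card_filter_above (hnest : NestedCells cell) {W : ℕ}
    (hW : ∀ (m : ℤ) (c : γ), (S.filter fun q => lev q = m ∧ cell m (pt q) = c).card ≤ W)
    {t : ℕ} {q : ι} (hq : t + 8 * W ≤ depth cell lev pt S q) :
    7 * W ≤ ((above cell lev pt S q).filter fun q' => t ≤ depth cell lev pt S q').card := by
  set L := (above cell lev pt S q).filter fun q' => ¬ t ≤ depth cell lev pt S q' with hL
  have hcard := Finset.card_filter_add_card_filter_not (s := above cell lev pt S q)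
    (fun q' => t ≤ depth cell lev pt S q')
  have hLcard : L.card ≤ t + W := by
    rcases L.eq_empty_or_nonempty with h0 | hne
    · rw [h0]; simp
    obtain ⟨p, hp, hmin⟩ := L.exists_min_image lev hne
    have hp' := Finset.mem_filter.1 hp
    have hpa := (Finset.mem_filter.1 hp'.1).2
    have hsub : L ⊆ above cell lev pt S p ∪
        S.filter fun q' => lev q' = lev p ∧ cell (lev p) (pt q') = cell (lev p) (pt q) := by
      intro q' hq'
      have ha := Finset.mem_filter.1 (Finset.mem_filter.1 hq').1
      rcases (hmin q' hq').eq_or_lt with heq | hlt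
      · refine Finset.mem_union_right _ (Finset.mem_filter.2 ⟨ha.1, heq.symm, ?_⟩)
        rw [heq]
        exact ha.2.2
      · refine Finset.mem_union_left _ (Finset.mem_filter.2 ⟨ha.1, hlt, ?_⟩)
        exact ha.2.2.trans (hnest _ _ _ _ hlt.le hpa.2).symm
    refine (Finset.card_le_card hsub).trans ((Finset.card_union_le _ _).trans ?_)
    exact Nat.add_le_add (not_le.1 hp'.2).le (hW _ _)
  rw [depth] at hq
  rw [← hL] at hcard
  omega

open Classical in
theorem sum_depth_ge_le (hnest : NestedCells cell) {W : ℕ} (hW0 : 0 < W) {v : ι → ℝ≥0∞}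
    (hW : ∀ (m : ℤ) (c : γ), (S.filter fun q => lev q = m ∧ cell m (pt q) = c).card ≤ W)
    (hv : ∀ p ∈ S, ∑ q ∈ S.filter (fun q => p ∈ above cell lev pt S q), v q ≤ W * v p) (t : ℕ) :
    4 * ∑ q ∈ S.filter (fun q => t + 8 * W ≤ depth cell lev pt S q), v q ≤
      ∑ q ∈ S.filter (fun q => t ≤ depth cell lev pt S q), v q := by
  set E := S.filter (fun q => t ≤ depth cell lev pt S q) with hE
  set E' := S.filter (fun q => t + 8 * W ≤ depth cell lev pt S q) with hE'
  have h1 : (7 * W : ℕ) * ∑ q ∈ E', v q ≤ W * ∑ q ∈ E, v q := by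
    calc ((7 * W : ℕ) : ℝ≥0∞) * ∑ q ∈ E', v q
        ≤ ∑ q ∈ E', ∑ p ∈ E.filter (fun p => p ∈ above cell lev pt S q), v q := by
          rw [Finset.mul_sum]
          refine Finset.sum_le_sum fun q hq => ?_
          rw [Finset.sum_const, nsmul_eq_mul]
          refine mul_le_mul_left (Nat.cast_le.2 ?_) _
          refine (le_card_filter_above hnest hW (Finset.mem_filter.1 hq).2).trans
            (Finset.card_le_card fun p hp => ?_)
          have hp' := Finset.mem_filter.1 hp
          exact Finset.mem_filter.2
            ⟨Finset.mem_filter.2 ⟨(Finset.mem_filter.1 hp'.1).1, hp'.2⟩, hp'.1⟩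
      _ = ∑ p ∈ E, ∑ q ∈ E'.filter (fun q => p ∈ above cell lev pt S q), v q := by
          simp only [Finset.sum_filter]
          exact Finset.sum_comm
      _ ≤ ∑ p ∈ E, W * v p := by
          refine Finset.sum_le_sum fun p hp => le_trans ?_ (hv p (Finset.mem_filter.1 hp).1)
          exact Finset.sum_le_sum_of_subset
            (Finset.filter_subset_filter _ (Finset.filter_subset _ _))
      _ = _ := by rw [Finset.mul_sum]
  have h2 : (W : ℝ≥0∞) * (7 * ∑ q ∈ E', v q) ≤ W * ∑ q ∈ E, v q := by
    refine le_trans (le_of_eq ?_) h1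
    push_cast
    ring
  have h3 := (ENNReal.mul_le_mul_iff_right (Nat.cast_ne_zero.2 hW0.ne')
    (ENNReal.natCast_ne_top W)).1 h2
  refine le_trans (mul_le_mul_left ?_ _) h3
  norm_num

open Classical in
theorem pow_mul_sum_depth_ge_le (hnest : NestedCells cell) {W : ℕ} (hW0 : 0 < W) {v : ι → ℝ≥0∞}
    (hW : ∀ (m : ℤ) (c : γ), (S.filter fun q => lev q = m ∧ cell m (pt q) = c).card ≤ W)
    (hv : ∀ p ∈ S, ∑ q ∈ S.filter (fun q => p ∈ above cell lev pt S q), v q ≤ W * v p) (j : ℕ) :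
    4 ^ j * ∑ q ∈ S.filter (fun q => j * (8 * W) ≤ depth cell lev pt S q), v q ≤
      ∑ q ∈ S, v q := by
  induction j with
  | zero => simp
  | succ j ih =>
    refine le_trans ?_ ih
    rw [pow_succ, mul_assoc, add_mul, one_mul]
    exact mul_le_mul_right (sum_depth_ge_le hnest hW0 hW hv _) _

open Classical in
/-- A maximal inequality for a family of functions localised to nested cells. -/
theorem exists_maximal_of_nested [MeasurableSpace X] {μ : Measure X} (hnest : NestedCells cell)
    {p : ℕ} {v : ι → ℝ≥0∞} {B : ℝ≥0∞} {g : ι → X → ℝ}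
    (hW : ∀ (m : ℤ) (c : γ), (S.filter fun q => lev q = m ∧ cell m (pt q) = c).card ≤ 2 ^ p)
    (hv : ∀ p' ∈ S, ∑ q ∈ S.filter (fun q => p' ∈ above cell lev pt S q), v q ≤ 2 ^ p * v p')
    (hg : ∀ q ∈ S, AEMeasurable (g q) μ)
    (hB : ∀ S' ⊆ S, ∫⁻ x, ‖∑ q ∈ S', g q x‖ₑ ^ 2 ∂μ ≤ B * ∑ q ∈ S', v q)
    (hsupp : ∀ q ∈ S, ∀ x, g q x ≠ 0 → cell (lev q) x = cell (lev q) (pt q)) :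
    ∃ M : X → ℝ≥0∞, AEMeasurable M μ ∧
      (∀ l x, ‖∑ q ∈ S.filter (fun q => l ≤ lev q), g q x‖ₑ ^ 2 ≤ M x) ∧
      ∫⁻ x, M x ∂μ ≤ ENNReal.ofReal (4 * (p + 4) ^ 2) * (B * ∑ q ∈ S, v q) := by
  set D := depth cell lev pt S with hD
  set K : ℕ := 8 * 2 ^ p with hK
  have hK0 : 0 < K := by positivity
  have hK2 : K = 2 ^ (p + 3) := by rw [hK, pow_add]; ring
  set J := Finset.range (S.card + 1) with hJ
  have hmaps : ∀ q ∈ S, D q / K ∈ J := fun q _ => Finset.mem_range.2 (by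
    have h1 : D q ≤ S.card := Finset.card_le_card (Finset.filter_subset _ _)
    exact Nat.lt_succ_of_le ((Nat.div_le_self _ _).trans h1))
  set L : ℕ → Finset ι := fun j => S.filter fun q => D q / K = j with hL
  have hLS : ∀ j, L j ⊆ S := fun j => Finset.filter_subset _ _
  have hlayer := fun j : ℕ => exists_maximal_of_label (μ := μ) (g := g) (v := v) (B := B) D (p + 3)
    (j * K) (L j) (fun q hq => hg q (hLS j hq)) (fun S' hS' => hB S' (hS'.trans (hLS j)))
    (fun q hq => by
      have h1 := (Finset.mem_filter.1 hq).2
      rw [← hK2, ← h1]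
      exact ⟨Nat.div_mul_le_self _ _, by rw [mul_comm]; exact Nat.lt_mul_div_succ _ hK0⟩)
  choose M hMm hMp hMi using hlayer
  have hgeo : ∑ j ∈ J, (1 / 2 : ℝ) ^ j ≤ 2 := by
    have h := summable_geometric_two.sum_le_tsum J (fun _ _ => by positivity)
    rwa [tsum_geometric_two] at h
  have hMm' : ∀ j ∈ J, AEMeasurable (fun x => ENNReal.ofReal (2 ^ j) * M j x) μ := fun j _ =>
    (hMm j).const_mul _
  refine ⟨fun x => ENNReal.ofReal 2 * ∑ j ∈ J, ENNReal.ofReal (2 ^ j) * M j x,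
    (Finset.aemeasurable_fun_sum _ hMm').const_mul _, fun l x => ?_, ?_⟩
  · obtain ⟨a, ha⟩ := exists_depth_threshold (S := S) (lev := lev) (pt := pt) hnest x l
    have h1 : ∑ q ∈ S.filter (fun q => l ≤ lev q), g q x =
        ∑ q ∈ S.filter (fun q => D q < a), g q x := by
      rw [Finset.sum_filter, Finset.sum_filter]
      refine Finset.sum_congr rfl fun q hq => ?_
      by_cases h0 : g q x = 0
      · simp [h0]
      · simp only [ha q hq (hsupp q hq x h0), hD]
    have h2 : ∑ q ∈ S.filter (fun q => D q < a), g q x =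
        ∑ j ∈ J, ∑ q ∈ (L j).filter (fun q => D q < a), g q x := by
      rw [← Finset.sum_fiberwise_of_maps_to
        (fun q hq => hmaps q (Finset.mem_filter.1 hq).1 : ∀ q ∈ S.filter (fun q => D q < a), _)]
      refine Finset.sum_congr rfl fun j _ => ?_
      rw [hL, Finset.filter_comm]
    rw [h1, h2]
    refine (enorm_sum_sq_le J (ρ := fun j => (1 / 2 : ℝ) ^ j)
      (x := fun j => 2 ^ j * ‖∑ q ∈ (L j).filter (fun q => D q < a), g q x‖ ^ 2)
      (fun j _ => by positivity) (fun j _ => by positivity) (fun j _ => le_of_eq ?_)).trans ?_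
    · rw [← mul_assoc, ← mul_pow]
      norm_num
    · refine mul_le_mul' (ENNReal.ofReal_le_ofReal hgeo) (Finset.sum_le_sum fun j _ => ?_)
      rw [ENNReal.ofReal_mul (by positivity), ENNReal.ofReal_pow (norm_nonneg _), ofReal_norm]
      exact mul_le_mul_right (hMp j a x) _
  · rw [lintegral_const_mul' _ _ ENNReal.ofReal_ne_top, lintegral_finsetSum' _ hMm']
    set V := ∑ q ∈ S, v q with hV
    have hVj : ∀ j : ℕ, ENNReal.ofReal (2 ^ j) * ∑ q ∈ L j, v q ≤
        ENNReal.ofReal ((1 / 2) ^ j) * V := by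
      intro j
      have h1 : 4 ^ j * ∑ q ∈ L j, v q ≤ V := by
        refine le_trans (mul_le_mul_right (Finset.sum_le_sum_of_subset fun q hq => ?_) _)
          (pow_mul_sum_depth_ge_le hnest (W := 2 ^ p) (by positivity) hW
            (by simpa using hv) j)
        have hq' := Finset.mem_filter.1 hq
        refine Finset.mem_filter.2 ⟨hq'.1, ?_⟩
        rw [← hq'.2]
        exact Nat.div_mul_le_self _ _
      refine le_trans (le_of_eq ?_) (mul_le_mul_right h1 _)
      have h4 : (4 : ℝ≥0∞) ^ j = ENNReal.ofReal (4 ^ j) := by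
        rw [ENNReal.ofReal_pow (by norm_num), ENNReal.ofReal_ofNat]
      rw [← mul_assoc, h4, ← ENNReal.ofReal_mul (by positivity), ← mul_pow]
      norm_num
    calc ENNReal.ofReal 2 * ∑ j ∈ J, ∫⁻ x, ENNReal.ofReal (2 ^ j) * M j x ∂μ
        ≤ ENNReal.ofReal 2 * ∑ j ∈ J, ENNReal.ofReal ((p + 4) ^ 2) * B *
            (ENNReal.ofReal ((1 / 2) ^ j) * V) := by
          refine mul_le_mul_right (Finset.sum_le_sum fun j _ => ?_) _
          rw [lintegral_const_mul' _ _ ENNReal.ofReal_ne_top]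
          refine le_trans (mul_le_mul_right (hMi j) _) ?_
          refine le_trans (le_of_eq ?_) (mul_le_mul_right (hVj j) _)
          have : (((p + 3 : ℕ) : ℝ) + 1) = p + 4 := by push_cast; ring
          rw [this]
          ring
      _ = ENNReal.ofReal 2 * (ENNReal.ofReal ((p + 4) ^ 2) * B *
            (ENNReal.ofReal (∑ j ∈ J, (1 / 2) ^ j) * V)) := by
          rw [← Finset.mul_sum, ← Finset.sum_mul, ENNReal.ofReal_sum_of_nonneg
            fun _ _ => by positivity]
      _ ≤ ENNReal.ofReal 2 * (ENNReal.ofReal ((p + 4) ^ 2) * B * (ENNReal.ofReal 2 * V)) := by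
          gcongr
      _ = _ := by
          rw [show (4:ℝ) * (p + 4) ^ 2 = 2 * (p + 4) ^ 2 * 2 by ring,
            ENNReal.ofReal_mul (by positivity), ENNReal.ofReal_mul (by norm_num)]
          ring

end Tower

section AdjacentGrids

/-- The displacement of the `n`-th generation in the one-third-trick grids. -/
def thirdShift (u : Bool) (n : ℤ) : ℝ := if u then (-1) ^ n / 3 else 0

/-- The index of the cell of generation `n` containing `x` in the grid with label `u`. -/
def gridCell (d : ℕ) (u : Fin d → Bool) (n : ℤ) (x : Rd d) : Fin d → ℤ :=
  fun i => ⌊(2:ℝ) ^ (-n) * x i - thirdShift (u i) n⌋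

theorem exists_int_add_three_mul_thirdShift (u : Bool) (n : ℤ) :
    ∃ c : ℤ, (c : ℝ) = -thirdShift u n - 2 * thirdShift u (n + 1) + 2 * thirdShift u n ∧
      thirdShift u (n + 1) = -thirdShift u n := by
  cases u with
  | false => exact ⟨0, by simp [thirdShift], by simp [thirdShift]⟩
  | true =>
    have h1 : thirdShift true (n + 1) = -thirdShift true n := by
      simp only [thirdShift, if_true]
      rw [zpow_add₀ (by norm_num)]
      ring
    rcases Int.even_or_odd n with h | h
    · refine ⟨1, ?_, h1⟩
      rw [h1]
      simp only [thirdShift, if_true, h.neg_one_zpow]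
      norm_num
    · refine ⟨-1, ?_, h1⟩
      rw [h1]
      simp only [thirdShift, if_true, h.neg_one_zpow]
      norm_num

theorem nestedCells_gridCell (d : ℕ) (u : Fin d → Bool) : NestedCells (gridCell d u) := by
  intro n n' x y hn
  induction n', hn using Int.leInduction with
  | base => exact id
  | succ m hm ih =>
    intro h
    have h1 := ih h
    funext i
    have hi : ⌊(2:ℝ) ^ (-m) * x i - thirdShift (u i) m⌋ =
        ⌊(2:ℝ) ^ (-m) * y i - thirdShift (u i) m⌋ := congrFun h1 i
    obtain ⟨c, hc, hs⟩ := exists_int_add_three_mul_thirdShift (u i) m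
    have key : ∀ z : Rd d, ⌊(2:ℝ) ^ (-(m + 1)) * z i - thirdShift (u i) (m + 1)⌋ =
        (⌊(2:ℝ) ^ (-m) * z i - thirdShift (u i) m⌋ + c) / 2 := by
      intro z
      have h2 : (2:ℝ) ^ (-(m + 1)) * z i - thirdShift (u i) (m + 1) =
          ((2:ℝ) ^ (-m) * z i - thirdShift (u i) m + c) / (2 : ℕ) := by
        rw [hc, hs, neg_add, zpow_add₀ (by norm_num)]
        push_cast
        norm_num
        ring
      rw [h2, Int.floor_div_natCast, Int.floor_add_intCast]
      rfl
    simp only [gridCell]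
    rw [key, key, hi]

theorem gridCell_eq_iff {d : ℕ} {u : Fin d → Bool} {n : ℤ} {x : Rd d} {c : Fin d → ℤ} :
    gridCell d u n x = c ↔ x ∈ dcube d (fun i => thirdShift (u i) n) n c := by
  have h2 : (0:ℝ) < (2:ℝ) ^ n := by positivity
  simp only [gridCell, dcube, mem_ofPred_eq, funext_iff, Int.floor_eq_iff]
  refine forall_congr' fun i => ?_
  have h3 : (2:ℝ) ^ (-n) * x i = x i / 2 ^ n := by rw [zpow_neg]; ring
  rw [h3, le_sub_iff_add_le, sub_lt_iff_lt_add, le_div_iff₀ h2, div_lt_iff₀ h2]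
  constructor
  · rintro ⟨h4, h5⟩
    exact ⟨by linarith, by linarith⟩
  · rintro ⟨h4, h5⟩
    exact ⟨by linarith, by linarith⟩

theorem exists_int_of_floor_ne {a b e : ℝ} (h : ¬ ∀ t ∈ Icc a b, ∀ t' ∈ Icc a b,
    ⌊t - e⌋ = ⌊t' - e⌋) : ∃ m : ℤ, a < m + e ∧ m + e ≤ b := by
  push Not at h
  obtain ⟨t, ht, t', ht', hne⟩ := h
  wlog hlt : ⌊t - e⌋ < ⌊t' - e⌋ generalizing t t'
  · exact this t' ht' t ht hne.symm (lt_of_le_of_ne (not_lt.1 hlt) hne.symm)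
  refine ⟨⌊t' - e⌋, ?_, ?_⟩
  · have := Int.lt_floor_add_one (t - e)
    have h1 : ((⌊t - e⌋ + 1 : ℤ) : ℝ) ≤ ⌊t' - e⌋ := Int.cast_le.2 hlt
    push_cast at h1
    linarith [ht.1]
  · linarith [Int.floor_le (t' - e), ht'.2]

theorem exists_floor_eq_of_short {a b : ℝ} (hab : b - a < 1 / 3) (n : ℤ) :
    ∃ u : Bool, ∀ t ∈ Icc a b, ∀ t' ∈ Icc a b,
      ⌊t - thirdShift u n⌋ = ⌊t' - thirdShift u n⌋ := by
  by_contra h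
  obtain ⟨m, hm1, hm2⟩ := exists_int_of_floor_ne (not_exists.1 h false)
  obtain ⟨m', hm1', hm2'⟩ := exists_int_of_floor_ne (not_exists.1 h true)
  have h1 : thirdShift false n = 0 := by simp [thirdShift]
  rw [h1] at hm1 hm2
  rcases Int.even_or_odd n with hn | hn
  · have h2 : thirdShift true n = 1 / 3 := by simp [thirdShift, hn.neg_one_zpow]
    rw [h2] at hm1' hm2'
    have h3 : ((3 * (m - m') : ℤ) : ℝ) < (2 : ℤ) := by push_cast; linarith
    have h4 : ((0 : ℤ) : ℝ) < (3 * (m - m') : ℤ) := by push_cast; linarith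
    have h3 := Int.cast_lt.1 h3
    have h4 := Int.cast_lt.1 h4
    omega
  · have h2 : thirdShift true n = -1 / 3 := by simp [thirdShift, hn.neg_one_zpow]
    rw [h2] at hm1' hm2'
    have h3 : ((3 * (m - m') : ℤ) : ℝ) < (0 : ℤ) := by push_cast; linarith
    have h4 : ((-2 : ℤ) : ℝ) < (3 * (m - m') : ℤ) := by push_cast; linarith
    have h3 := Int.cast_lt.1 h3
    have h4 := Int.cast_lt.1 h4
    omega

/-- A small neighbourhood of a dyadic cube lies in a single cell of one of the grids. -/
theorem exists_gridCell_eq {d : ℕ} {s : ℕ} (hs : 3 ≤ s) (j : ℤ) (m : Fin d → ℤ) :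
    ∃ u : Fin d → Bool, ∀ x y : Rd d,
      (∃ x' ∈ dcube d 0 j m, ∀ i, |x i - x' i| ≤ (2:ℝ) ^ (j + s) / 4) →
      (∃ y' ∈ dcube d 0 j m, ∀ i, |y i - y' i| ≤ (2:ℝ) ^ (j + s) / 4) →
      gridCell d u (j + s + 1) x = gridCell d u (j + s + 1) y := by
  have hs' : ((2:ℝ) ^ (s + 1))⁻¹ ≤ 1 / 16 := by
    rw [one_div]
    refine inv_anti₀ (by norm_num) ?_
    calc (16:ℝ) = 2 ^ 4 := by norm_num
      _ ≤ 2 ^ (s + 1) := pow_le_pow_right₀ (by norm_num) (by omega)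
  set r : ℝ := ((2:ℝ) ^ (s + 1))⁻¹ with hr
  have hex := fun i => exists_floor_eq_of_short (a := r * m i - 1 / 8) (b := r * (m i + 1) + 1 / 8)
    (by linarith) (j + s + 1)
  choose u hu using hex
  have hmem : ∀ x : Rd d, (∃ x' ∈ dcube d 0 j m, ∀ i, |x i - x' i| ≤ (2:ℝ) ^ (j + s) / 4) →
      ∀ i, (2:ℝ) ^ (-(j + s + 1)) * x i ∈ Icc (r * m i - 1 / 8) (r * (m i + 1) + 1 / 8) := by
    rintro x ⟨x', hx', hxx⟩ i
    have h1 := hx' i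
    simp only [Pi.zero_apply, zero_add] at h1
    have h2 := abs_le.1 (hxx i)
    have h3 : (2:ℝ) ^ (-(j + s + 1)) * 2 ^ j = r := by
      rw [hr, ← zpow_natCast, ← zpow_neg, ← zpow_add₀ (by norm_num)]
      congr 1
      push_cast
      ring
    have h4 : (2:ℝ) ^ (-(j + s + 1)) * (2 ^ (j + s) / 4) = 1 / 8 := by
      rw [← mul_div_assoc, ← zpow_add₀ (by norm_num)]
      have : -(j + s + 1) + (j + s) = -1 := by ring
      rw [this]
      norm_num
    have h5 : (0:ℝ) < (2:ℝ) ^ (-(j + s + 1)) := by positivity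
    constructor
    · have := mul_le_mul_of_nonneg_left
        (show (2:ℝ) ^ j * m i - 2 ^ (j + s) / 4 ≤ x i by linarith [h1.1, h2.1]) h5.le
      rw [mul_sub, ← mul_assoc, h3, h4] at this
      exact this
    · have := mul_le_mul_of_nonneg_left
        (show x i ≤ (2:ℝ) ^ j * (m i + 1) + 2 ^ (j + s) / 4 by linarith [h1.2, h2.2]) h5.le
      rw [mul_add _ _ (_ / 4), ← mul_assoc, h3, h4] at this
      exact this
  refine ⟨u, fun x y hx hy => funext fun i => ?_⟩
  exact hu i _ (hmem x hx i) _ (hmem y hy i)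

end AdjacentGrids

theorem exists_mem_dcube_of_cv_ne_zero {d : ℕ} {φ : Rd d → ℝ} (hφ : AdmissiblePhi d φ)
    {Om β : Rd d → ℝ} {D : Set (Rd d)} {k : ℤ} (hβ : ∀ y, β y ≠ 0 → y ∈ D) {x : Rd d}
    (hx : cv d (Kker d φ Om k) β x ≠ 0) : ∃ y ∈ D, ∀ i, |x i - y i| ≤ (2:ℝ) ^ k / 4 := by
  have hex : ∃ y, Kker d φ Om k (x - y) * β y ≠ 0 := by
    by_contra! h
    exact hx (by simp [cv, h])
  obtain ⟨y, hy⟩ := hex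
  refine ⟨y, hβ y (right_ne_zero_of_mul hy), fun i => ?_⟩
  have h1 := (Kker_support hφ (left_ne_zero_of_mul hy)).2.2
  rw [norm_smul, Real.norm_of_nonneg (by positivity), zpow_neg, inv_mul_lt_iff₀ (by positivity)]
    at h1
  have h2 := PiLp.norm_apply_le (x - y) i
  rw [Real.norm_eq_abs, PiLp.sub_apply] at h2
  linarith

theorem BadFamily.sum_volume_le_of_gridCell {d : ℕ} {𝒬 : Finset (ℤ × (Fin d → ℤ))}
    {b : ℤ × (Fin d → ℤ) → Rd d → ℝ} {A : ℝ} (h : BadFamily d 𝒬 b A) {u : Fin d → Bool} {n : ℤ}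
    {c : Fin d → ℤ} (hc : ∀ q ∈ 𝒬, ∀ y ∈ dcube d 0 q.1 q.2, gridCell d u n y = c) :
    cubeSum d 𝒬 ≤ ENNReal.ofReal ((2:ℝ) ^ (n * d)) := by
  rw [← volume_dcube (fun i => thirdShift (u i) n) n c]
  exact h.sum_volume_le fun q hq y hy => gridCell_eq_iff.1 (hc q hq y hy)

/-- The lower left corner of a dyadic cube. -/
def dcorner (d : ℕ) (q : ℤ × (Fin d → ℤ)) : Rd d := WithLp.toLp 2 fun i => (2:ℝ) ^ q.1 * q.2 i

theorem dcorner_mem (d : ℕ) (q : ℤ × (Fin d → ℤ)) : dcorner d q ∈ dcube d 0 q.1 q.2 := by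
  intro i
  have : (0:ℝ) < 2 ^ q.1 := by positivity
  simp only [dcorner, Pi.zero_apply, zero_add]
  constructor <;> nlinarith

theorem ofReal_zpow_add_succ_mul (d s : ℕ) (j : ℤ) :
    ENNReal.ofReal ((2:ℝ) ^ ((j + s + 1) * (d:ℤ))) =
      2 ^ ((s + 1) * d) * ENNReal.ofReal ((2:ℝ) ^ (j * (d:ℤ))) := by
  have h1 : (2:ℝ) ^ ((j + s + 1) * (d:ℤ)) = 2 ^ ((s + 1) * d) * 2 ^ (j * (d:ℤ)) := by
    rw [← zpow_natCast, ← zpow_add₀ (by norm_num)]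
    congr 1
    push_cast
    ring
  rw [h1, ENNReal.ofReal_mul (by positivity), ENNReal.ofReal_pow (by norm_num)]
  norm_num

open Classical in
/-- The maximal inequality for finite families of bad functions. -/
theorem exists_maximal_cv_of_finset {d : ℕ} {φ : Rd d → ℝ} (hd : 0 < d) (hφ : AdmissiblePhi d φ) :
    ∃ C : ℝ, 0 < C ∧ ∀ Om : Rd d → ℝ, Homogeneous0 d Om → AEStronglyMeasurable Om volume →
      ∀ H : ℝ, (∀ x, |Om x| ≤ H) →
      ∀ (𝒬 : Finset (ℤ × (Fin d → ℤ))) (b : ℤ × (Fin d → ℤ) → Rd d → ℝ) (A : ℝ),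
      BadFamily d 𝒬 b A → 0 ≤ A → ∀ s : ℕ, 3 ≤ s → ∀ w : ℝ, 0 < w → w ≤ 1 →
      w ^ (2 * (d + 2)) = ((2:ℝ) ^ s)⁻¹ →
      ∃ M : Rd d → ℝ≥0∞, AEMeasurable M ∧
        (∀ (l : ℤ) x, ‖∑ q ∈ 𝒬.filter (fun q => l ≤ q.1 + s),
          cv d (Kker d φ Om (q.1 + s)) (b q) x‖ₑ ^ 2 ≤ M x) ∧
        ∫⁻ x, M x ≤ ENNReal.ofReal (C * s ^ 2 * (H * A) ^ 2 * w) * cubeSum d 𝒬 := by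
  obtain ⟨C, hC, hmain⟩ := exists_lintegral_sum_cv_sq_le hd hφ
  refine ⟨2 ^ d * (4 * (2 * d + 4) ^ 2) * C, by positivity, ?_⟩
  intro Om hhom hmeas H hH 𝒬 b A hbad hA s hs w hw hw1 hws
  have hcls := fun q : ℤ × (Fin d → ℤ) => exists_gridCell_eq hs q.1 q.2
  choose cls hcls using hcls
  set g : ℤ × (Fin d → ℤ) → Rd d → ℝ := fun q => cv d (Kker d φ Om (q.1 + s)) (b q) with hg
  set lev : ℤ × (Fin d → ℤ) → ℤ := fun q => q.1 + s + 1 with hlev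
  set S : (Fin d → Bool) → Finset (ℤ × (Fin d → ℤ)) := fun u => 𝒬.filter fun q => cls q = u
    with hS
  have hSQ : ∀ u, S u ⊆ 𝒬 := fun u => Finset.filter_subset _ _
  have hself : ∀ (j : ℤ) (D : Set (Rd d)) (y : Rd d), y ∈ D →
      ∃ y' ∈ D, ∀ i, |y i - y' i| ≤ (2:ℝ) ^ (j + s) / 4 := fun j D y hy =>
    ⟨y, hy, fun i => by rw [sub_self, abs_zero]; positivity⟩
  have hcell : ∀ u, ∀ q ∈ S u, ∀ y ∈ dcube d 0 q.1 q.2,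
      gridCell d u (lev q) y = gridCell d u (lev q) (dcorner d q) := by
    intro u q hq y hy
    have h1 := hcls q y (dcorner d q) (hself _ _ _ hy) (hself _ _ _ (dcorner_mem d q))
    rw [(Finset.mem_filter.1 hq).2] at h1
    exact h1
  have hW : ∀ u (m : ℤ) (c : Fin d → ℤ), ((S u).filter fun q => lev q = m ∧
      gridCell d u m (dcorner d q) = c).card ≤ 2 ^ ((s + 1) * d) := by
    intro u m c
    set R := (S u).filter fun q => lev q = m ∧ gridCell d u m (dcorner d q) = c with hR
    have hRQ : R ⊆ 𝒬 := (Finset.filter_subset _ _).trans (hSQ u)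
    have h1 : cubeSum d R ≤ ENNReal.ofReal ((2:ℝ) ^ (m * d)) := by
      refine (hbad.mono hRQ).sum_volume_le_of_gridCell (u := u) (c := c) fun q hq y hy => ?_
      obtain ⟨h2, h3, h4⟩ := Finset.mem_filter.1 hq
      rw [← h4, ← h3]
      exact hcell u q h2 y hy
    have h5 : cubeSum d R = R.card * ENNReal.ofReal ((2:ℝ) ^ ((m - s - 1) * (d:ℤ))) := by
      rw [cubeSum, ← nsmul_eq_mul, ← Finset.sum_const]
      refine Finset.sum_congr rfl fun q hq => ?_
      rw [volume_dcube, ← (Finset.mem_filter.1 hq).2.1, hlev]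
      congr 3
      ring
    have h6 := ofReal_zpow_add_succ_mul d s (m - s - 1)
    have h7 : m - s - 1 + s + 1 = m := by ring
    rw [h7] at h6
    rw [h5, h6] at h1
    have h8 := (ENNReal.mul_le_mul_iff_left (by
      rw [ne_eq, ENNReal.ofReal_eq_zero, not_le]; positivity) ENNReal.ofReal_ne_top).1 h1
    exact_mod_cast h8
  have hv : ∀ u, ∀ p' ∈ S u, ∑ q ∈ (S u).filter
      (fun q => p' ∈ above (gridCell d u) lev (dcorner d) (S u) q), volume (dcube d 0 q.1 q.2) ≤
      2 ^ ((s + 1) * d) * volume (dcube d 0 p'.1 p'.2) := by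
    intro u p' hp'
    rw [volume_dcube, ← ofReal_zpow_add_succ_mul]
    refine (hbad.mono ((Finset.filter_subset _ _).trans (hSQ u))).sum_volume_le_of_gridCell
      (u := u) (c := gridCell d u (lev p') (dcorner d p')) fun q hq y hy => ?_
    obtain ⟨h2, h3⟩ := Finset.mem_filter.1 hq
    simp only [above, Finset.mem_filter] at h3
    obtain ⟨-, h4, h5⟩ := h3
    exact (nestedCells_gridCell d u _ _ _ _ h4.le (hcell u q h2 y hy)).trans h5.symm
  have hsupp : ∀ u, ∀ q ∈ S u, ∀ x, g q x ≠ 0 →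
      gridCell d u (lev q) x = gridCell d u (lev q) (dcorner d q) := by
    intro u q hq x hx
    have h1 := hcls q x (dcorner d q)
      (exists_mem_dcube_of_cv_ne_zero hφ (hbad.supp q (hSQ u hq)) hx)
      (hself _ _ _ (dcorner_mem d q))
    rw [(Finset.mem_filter.1 hq).2] at h1
    exact h1
  have hmax := fun u => exists_maximal_of_nested (μ := (volume : Measure (Rd d))) (S := S u)
    (lev := lev) (pt := dcorner d) (g := g) (B := ENNReal.ofReal (C * (H * A) ^ 2 * w))
    (p := (s + 1) * d) (nestedCells_gridCell d u) (fun m c => by convert hW u m c)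
    (fun p hp => by convert hv u p hp)
    (fun q hq => (cv_integrable (Kker_integrable hφ hmeas hH _)
      (hbad.integ q (hSQ u hq))).aestronglyMeasurable.aemeasurable)
    (fun S' hS' => hmain Om hhom hmeas H hH S' b A (hbad.mono (hS'.trans (hSQ u))) hA s w hw hw1
      hws) (hsupp u)
  choose M hMm hMp hMi using hmax
  refine ⟨fun x => ENNReal.ofReal (2 ^ d) * ∑ u, M u x,
    (Finset.aemeasurable_fun_sum _ fun u _ => hMm u).const_mul _, fun l x => ?_, ?_⟩
  · have h1 : ∑ q ∈ 𝒬.filter (fun q => l ≤ q.1 + s), g q x =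
        ∑ u, ∑ q ∈ (S u).filter (fun q => l + 1 ≤ lev q), g q x := by
      rw [← Finset.sum_fiberwise_of_maps_to (g := cls) (t := Finset.univ)
        (fun q _ => Finset.mem_univ _)]
      refine Finset.sum_congr rfl fun u _ => ?_
      rw [hS, Finset.filter_comm]
      refine Finset.sum_congr (Finset.filter_congr fun q _ => ?_) fun _ _ => rfl
      simp only [hlev]
      omega
    rw [h1]
    refine (enorm_sum_sq_le Finset.univ (ρ := fun _ => 1)
      (x := fun u => ‖∑ q ∈ (S u).filter (fun q => l + 1 ≤ lev q), g q x‖ ^ 2)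
      (fun _ _ => zero_le_one) (fun u _ => by positivity) fun u _ => (one_mul _).ge).trans ?_
    refine mul_le_mul' (le_of_eq ?_) (Finset.sum_le_sum fun u _ => ?_)
    · simp
    · rw [ENNReal.ofReal_pow (norm_nonneg _), ofReal_norm]
      exact hMp u (l + 1) x
  · rw [lintegral_const_mul' _ _ ENNReal.ofReal_ne_top,
      lintegral_finsetSum' _ fun u _ => hMm u]
    have h1 : ∑ u, ∑ q ∈ S u, volume (dcube d 0 q.1 q.2) = cubeSum d 𝒬 :=
      Finset.sum_fiberwise_of_maps_to (g := cls) (t := Finset.univ)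
        (fun q _ => Finset.mem_univ _) _
    refine (mul_le_mul_right (Finset.sum_le_sum fun u _ => hMi u) _).trans ?_
    rw [← Finset.mul_sum, ← Finset.mul_sum, h1, ← mul_assoc, ← mul_assoc,
      ← ENNReal.ofReal_mul (by positivity), ← ENNReal.ofReal_mul (by positivity)]
    refine mul_le_mul_left (ENNReal.ofReal_le_ofReal ?_) _
    have hs1 : (1:ℝ) ≤ s := by exact_mod_cast (by omega : 1 ≤ s)
    have h2 : (((s + 1) * d : ℕ) : ℝ) + 4 ≤ s * (2 * d + 4) := by
      push_cast
      nlinarith [(Nat.cast_nonneg d : (0:ℝ) ≤ d)]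
    calc (2:ℝ) ^ d * (4 * ((((s + 1) * d : ℕ) : ℝ) + 4) ^ 2) * (C * (H * A) ^ 2 * w)
        ≤ 2 ^ d * (4 * (s * (2 * d + 4)) ^ 2) * (C * (H * A) ^ 2 * w) := by gcongr
      _ = _ := by ring

section Omega

variable {d : ℕ} {Om : Rd d → ℝ}

theorem Homogeneous0.aestronglyMeasurable (hd : 0 < d) (h : Homogeneous0 d Om)
    (hm : AEStronglyMeasurable (fun θ : sphere (0 : Rd d) 1 => Om θ) (sphereMeasure d)) :
    AEStronglyMeasurable Om volume := by
  have : Nontrivial (Rd d) := Module.nontrivial_of_finrank_pos (R := ℝ) (by simpa using hd)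
  have h1 := (hm.comp_fst (ν := Measure.volumeIoiPow (Module.finrank ℝ (Rd d) - 1)))
    |>.comp_measurePreserving (volume : Measure (Rd d)).measurePreserving_homeomorphUnitSphereProd
  have h2 : (fun x : ({0}ᶜ : Set (Rd d)) => Om x) =
      (fun p : sphere (0 : Rd d) 1 × Ioi (0:ℝ) => Om p.1) ∘ homeomorphUnitSphereProd (Rd d) := by
    funext x
    simp only [Function.comp_apply, homeomorphUnitSphereProd_apply_fst_coe]
    rw [h x x.2 _ (inv_pos.2 (norm_pos_iff.2 x.2))]
  have h4 : MeasurableSet ({0}ᶜ : Set (Rd d)) := (measurableSet_singleton 0).compl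
  have h3 := (MeasurableEmbedding.subtype_coe h4).aestronglyMeasurable_map_iff (g := Om)
    (μ := (volume : Measure (Rd d)).comap Subtype.val)
  rw [map_comap_subtype_coe h4, restrict_compl_singleton] at h3
  refine h3.2 ?_
  change AEStronglyMeasurable (fun x : ({0}ᶜ : Set (Rd d)) => Om x) _
  rw [h2]
  exact h1

theorem Homogeneous0.omega2 (h : Homogeneous0 d Om) (η : ℝ) (s : ℕ) :
    Homogeneous0 d (Omega2 d Om η s) := by
  intro x hx r hr
  simp only [Omega2, h x hx r hr]

theorem aestronglyMeasurable_omega2 (h : AEStronglyMeasurable Om volume) (η : ℝ) (s : ℕ) :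
    AEStronglyMeasurable (Omega2 d Om η s) volume := by
  have hm : Measurable fun t : ℝ => if |t| < (2:ℝ) ^ (η * s) * omegaL1 d Om then t else 0 :=
    Measurable.ite (measurableSet_lt continuous_abs.measurable measurable_const) measurable_id
      measurable_const
  exact (hm.comp_aemeasurable h.aemeasurable).aestronglyMeasurable

theorem omegaL1_nonneg : 0 ≤ omegaL1 d Om := integral_nonneg fun _ => abs_nonneg _

theorem abs_omega2_le (η : ℝ) (s : ℕ) (x : Rd d) :
    |Omega2 d Om η s x| ≤ (2:ℝ) ^ (η * s) * omegaL1 d Om := by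
  rw [Omega2]
  split_ifs with h
  · exact h.le
  · rw [abs_zero]
    exact mul_nonneg (by positivity) omegaL1_nonneg

theorem max_log_div_le {a t : ℝ} (ha : 0 < a) (ht : 0 ≤ t) :
    max (Real.log (t / a)) 0 ≤ Real.log (2 + t) + |Real.log a| := by
  have h0 : 0 ≤ Real.log (2 + t) := Real.log_nonneg (by linarith)
  refine max_le ?_ (by positivity)
  rcases ht.eq_or_lt with rfl | ht'
  · simp only [zero_div, Real.log_zero]
    positivity
  · rw [Real.log_div ht'.ne' ha.ne']
    have h1 := Real.log_le_log ht' (by linarith : t ≤ 2 + t)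
    have h2 := neg_abs_le (Real.log a)
    linarith

theorem omegaL1_le_constCOmega (h : OmegaHyp d Om) (hpos : 0 < omegaL1 d Om) :
    omegaL1 d Om ≤ constCOmega d Om := by
  obtain ⟨-, hInt, -, hlog⟩ := h
  have h1 : 0 ≤ omegaLlogL d Om := integral_nonneg fun θ =>
    mul_nonneg (abs_nonneg _) (Real.log_nonneg (by linarith [abs_nonneg (Om θ)]))
  have hmeas : Measurable fun t : ℝ => |t| * (1 + max (Real.log (|t| / omegaL1 d Om)) 0) := by
    have ha : Measurable fun t : ℝ => |t| := continuous_abs.measurable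
    exact ha.mul (measurable_const.add
      ((Real.measurable_log.comp (ha.div_const _)).max measurable_const))
  have h2 : Integrable (fun θ : sphere (0 : Rd d) 1 =>
      |Om θ| * (1 + max (Real.log (|Om θ| / omegaL1 d Om)) 0)) (sphereMeasure d) := by
    refine ((hInt.abs.mul_const (1 + |Real.log (omegaL1 d Om)|)).add hlog).mono'
      (hmeas.comp_aemeasurable hInt.aemeasurable).aestronglyMeasurable
      (Filter.Eventually.of_forall fun θ => ?_)
    rw [Real.norm_of_nonneg (by positivity)]
    have := mul_le_mul_of_nonneg_left (max_log_div_le hpos (abs_nonneg (Om θ)))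
      (abs_nonneg (Om θ))
    simp only [Pi.add_apply]
    linarith
  have h3 : omegaL1 d Om ≤
      sphInt d fun x => |Om x| * (1 + max (Real.log (|Om x| / omegaL1 d Om)) 0) := by
    refine integral_mono hInt.abs h2 fun θ => ?_
    refine le_mul_of_one_le_right (abs_nonneg _) ?_
    linarith [le_max_right (Real.log (|Om θ| / omegaL1 d Om)) 0]
  rw [constCOmega]
  linarith

end Omega

section Decomposition

variable {d : ℕ} {COm Cc c₁ c₂ lam : ℝ} {f : Rd d → ℝ} {Qset : Set (ℤ × (Fin d → ℤ))}
  {b : ℤ × (Fin d → ℤ) → Rd d → ℝ}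

open Classical in
/-- A measurable modification of the bad functions, supported in the same cubes. -/
def measurableModification (d : ℕ) (b : ℤ × (Fin d → ℤ) → Rd d → ℝ) (q : ℤ × (Fin d → ℤ)) :
    Rd d → ℝ :=
  if h : AEStronglyMeasurable (b q) volume then (dcube d 0 q.1 q.2).indicator (h.mk (b q)) else 0

theorem measurable_measurableModification (q : ℤ × (Fin d → ℤ)) :
    Measurable (measurableModification d b q) := by
  rw [measurableModification]
  split_ifs with h
  · exact h.stronglyMeasurable_mk.measurable.indicator (measurableSet_dcube _ _ _)
  · exact measurable_zero

theorem mem_dcube_of_measurableModification_ne_zero {q : ℤ × (Fin d → ℤ)} {x : Rd d}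
    (h : measurableModification d b q x ≠ 0) : x ∈ dcube d 0 q.1 q.2 := by
  rw [measurableModification] at h
  split_ifs at h with h1
  · exact mem_of_indicator_ne_zero h
  · exact absurd rfl h

theorem measurableModification_ae_eq (h : CZData d COm Cc c₁ c₂ f lam Qset b)
    {q : ℤ × (Fin d → ℤ)} (hq : q ∈ Qset) : b q =ᵐ[volume] measurableModification d b q := by
  have hm := (h.integrable q hq).aestronglyMeasurable
  rw [measurableModification, dif_pos hm]
  filter_upwards [hm.ae_eq_mk] with x hx
  by_cases hxQ : x ∈ dcube d 0 q.1 q.2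
  · rw [indicator_of_mem hxQ, hx]
  · rw [indicator_of_notMem hxQ]
    by_contra h0
    exact hxQ (h.support_subset q hq h0)

theorem cv_congr_ae {K β β' : Rd d → ℝ} (h : β =ᵐ[volume] β') : cv d K β = cv d K β' := by
  funext x
  refine integral_congr_ae ?_
  filter_upwards [h] with y hy
  rw [hy]

theorem toReal_volume_dcube (w : Fin d → ℝ) (k : ℤ) (m : Fin d → ℤ) :
    (volume (dcube d w k m)).toReal = (2:ℝ) ^ (k * (d:ℤ)) := by
  rw [volume_dcube, ENNReal.toReal_ofReal (by positivity)]

theorem CZData.badFamily (h : CZData d COm Cc c₁ c₂ f lam Qset b) (hCc : 0 < Cc)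
    {𝒬 : Finset (ℤ × (Fin d → ℤ))} (h𝒬 : ∀ q ∈ 𝒬, q ∈ Qset) :
    BadFamily d 𝒬 (measurableModification d b) (Cc * (c₂ * lam / COm)) where
  disj q hq q' hq' hne := h.pairwise_disjoint (h𝒬 q hq) (h𝒬 q' hq') hne
  meas q _ := measurable_measurableModification q
  supp _ _ _ hx := mem_dcube_of_measurableModification_ne_zero hx
  integ q hq := (h.integrable q (h𝒬 q hq)).congr (measurableModification_ae_eq h (h𝒬 q hq))
  mean q hq := by
    rw [← integral_congr_ae (measurableModification_ae_eq h (h𝒬 q hq))]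
    exact h.integral_zero q (h𝒬 q hq)
  l1 q hq := by
    have h1 : ∫ x, |measurableModification d b q x| = ∫ x, |b q x| := by
      refine integral_congr_ae ?_
      filter_upwards [measurableModification_ae_eq h (h𝒬 q hq)] with x hx
      rw [hx]
    have h2 := h.avg_upper q (h𝒬 q hq)
    rw [toReal_volume_dcube, div_le_iff₀ (by positivity)] at h2
    rw [h1, mul_assoc]
    exact (h.l1_bound q (h𝒬 q hq)).trans (mul_le_mul_of_nonneg_left h2 hCc.le)

theorem CZData.sum_le (h : CZData d COm Cc c₁ c₂ f lam Qset b) (hf : Integrable f)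
    (hc : 0 < c₁ * lam / COm) {𝒬 : Finset (ℤ × (Fin d → ℤ))} (h𝒬 : ∀ q ∈ 𝒬, q ∈ Qset) :
    ∑ q ∈ 𝒬, (2:ℝ) ^ (q.1 * (d:ℤ)) ≤ (∫ x, |f x|) / (c₁ * lam / COm) := by
  rw [le_div_iff₀ hc, Finset.sum_mul]
  calc ∑ q ∈ 𝒬, (2:ℝ) ^ (q.1 * (d:ℤ)) * (c₁ * lam / COm)
      ≤ ∑ q ∈ 𝒬, ∫ x in dcube d 0 q.1 q.2, |f x| := by
        refine Finset.sum_le_sum fun q hq => ?_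
        have h1 := h.avg_lower q (h𝒬 q hq)
        rwa [toReal_volume_dcube, le_div_iff₀ (by positivity), mul_comm] at h1
    _ = ∫ x in ⋃ q ∈ 𝒬, dcube d 0 q.1 q.2, |f x| := by
        refine (integral_biUnion_finset 𝒬 (fun q _ => measurableSet_dcube _ _ _)
          (fun q hq q' hq' hne => h.pairwise_disjoint (h𝒬 q hq) (h𝒬 q' hq') hne)
          fun q _ => hf.abs.integrableOn).symm
    _ ≤ ∫ x, |f x| :=
        setIntegral_le_integral hf.abs (Filter.Eventually.of_forall fun _ => abs_nonneg _)

theorem CZData.cubeSum_le (h : CZData d COm Cc c₁ c₂ f lam Qset b) (hf : Integrable f)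
    (hc : 0 < c₁ * lam / COm) {𝒬 : Finset (ℤ × (Fin d → ℤ))} (h𝒬 : ∀ q ∈ 𝒬, q ∈ Qset) :
    cubeSum d 𝒬 ≤ ENNReal.ofReal ((∫ x, |f x|) / (c₁ * lam / COm)) := by
  simp only [cubeSum, volume_dcube]
  rw [← ENNReal.ofReal_sum_of_nonneg fun _ _ => by positivity]
  exact ENNReal.ofReal_le_ofReal (h.sum_le hf hc h𝒬)

theorem CZData.finite_setOf_le (h : CZData d COm Cc c₁ c₂ f lam Qset b) (hf : Integrable f)
    (hc : 0 < c₁ * lam / COm) (l : ℤ) : {q ∈ Qset | l ≤ q.1}.Finite := by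
  by_contra hinf
  obtain ⟨n, hn⟩ := exists_nat_gt ((∫ x, |f x|) / (c₁ * lam / COm) / 2 ^ (l * (d:ℤ)))
  obtain ⟨t, ht, htn⟩ := Set.Infinite.exists_subset_card_eq hinf n
  have h1 := h.sum_le hf hc fun q hq => (ht hq).1
  have h2 : (n:ℝ) * 2 ^ (l * (d:ℤ)) ≤ ∑ q ∈ t, (2:ℝ) ^ (q.1 * (d:ℤ)) := by
    rw [← htn, ← nsmul_eq_mul]
    refine Finset.card_nsmul_le_sum _ _ _ fun q hq => ?_
    exact zpow_le_zpow_right₀ (by norm_num)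
      (mul_le_mul_of_nonneg_right (ht hq).2 (Nat.cast_nonneg d))
  rw [div_lt_iff₀ (by positivity)] at hn
  linarith

end Decomposition

section Assembly

variable {d : ℕ}

theorem two_zpow_add_mul_eq (s : ℕ) (j : ℤ) (hs : 2 ≤ s) {w : ℝ} (hw : w = 0 ∨ w = 1 / 2)
    (m : ℤ) {t : ℝ} (ht : t = 1 / 4 ∨ t = 3 / 4) :
    ∃ n : ℤ, (2:ℝ) ^ (j + s) * (w + m + t) = 2 ^ j * n := by
  obtain ⟨r, rfl⟩ : ∃ r, s = r + 2 := ⟨s - 2, by omega⟩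
  have h1 : (2:ℝ) ^ (j + (r + 2 : ℕ)) = 2 ^ j * (4 * 2 ^ r) := by
    rw [zpow_add₀ (by norm_num), zpow_natCast, pow_add]
    ring
  have key : ∃ n : ℤ, 4 * (w + m + t) = n := by
    rcases hw with rfl | rfl <;> rcases ht with rfl | rfl
    · exact ⟨4 * m + 1, by push_cast; ring⟩
    · exact ⟨4 * m + 3, by push_cast; ring⟩
    · exact ⟨4 * m + 3, by push_cast; ring⟩
    · exact ⟨4 * m + 5, by push_cast; ring⟩
  obtain ⟨n, hn⟩ := key
  refine ⟨2 ^ r * n, ?_⟩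
  rw [h1]
  push_cast
  rw [← hn]
  ring

/-- A dyadic cube is either contained in or disjoint from the half of a much larger cube. -/
theorem mem_dhalf_iff_dcorner_mem {w : Fin d → ℝ} (hw : GridShift d w) {s : ℕ} (hs : 2 ≤ s)
    {q : ℤ × (Fin d → ℤ)} (m : Fin d → ℤ) {y : Rd d} (hy : y ∈ dcube d 0 q.1 q.2) :
    y ∈ dhalf d w (q.1 + s) m ↔ dcorner d q ∈ dhalf d w (q.1 + s) m := by
  refine forall_congr' fun i => ?_
  obtain ⟨a, ha⟩ := two_zpow_add_mul_eq s q.1 hs (hw i) (m i) (t := 1 / 4) (Or.inl rfl)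
  obtain ⟨a', ha'⟩ := two_zpow_add_mul_eq s q.1 hs (hw i) (m i) (t := 3 / 4) (Or.inr rfl)
  have hp : (0:ℝ) < 2 ^ q.1 := by positivity
  have h1 := hy i
  simp only [Pi.zero_apply, zero_add] at h1
  have h2 : dcorner d q i = 2 ^ q.1 * q.2 i := rfl
  rw [ha, ha', h2, mul_le_mul_iff_right₀ hp, mul_lt_mul_iff_right₀ hp]
  refine and_congr ⟨fun h => ?_, fun h => ?_⟩ ⟨fun h => ?_, fun h => ?_⟩
  · have h3 : (a:ℝ) < q.2 i + 1 := (mul_lt_mul_iff_right₀ hp).1 (h.trans_lt h1.2)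
    have h4 : a < q.2 i + 1 := by exact_mod_cast h3
    exact_mod_cast Int.lt_add_one_iff.1 h4
  · exact (mul_le_mul_of_nonneg_left h hp.le).trans h1.1
  · exact (mul_lt_mul_iff_right₀ hp).1 (h1.1.trans_lt h)
  · have h3 : q.2 i + 1 ≤ a' := by
      have : q.2 i < a' := by exact_mod_cast h
      omega
    have h4 : (q.2 i : ℝ) + 1 ≤ a' := by exact_mod_cast h3
    exact h1.2.trans_le (mul_le_mul_of_nonneg_left h4 hp.le)

theorem eq_of_mem_dhalf {w : Fin d → ℝ} {k : ℤ} {m m' : Fin d → ℤ} {y : Rd d}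
    (h : y ∈ dhalf d w k m) (h' : y ∈ dhalf d w k m') : m = m' := by
  have hp : (0:ℝ) < 2 ^ k := by positivity
  funext i
  have h1 : (m i : ℝ) < m' i + 1 := by
    linarith [(mul_lt_mul_iff_right₀ hp).1 ((h i).1.trans_lt (h' i).2)]
  have h2 : (m' i : ℝ) < m i + 1 := by
    linarith [(mul_lt_mul_iff_right₀ hp).1 ((h' i).1.trans_lt (h i).2)]
  have h3 : m i < m' i + 1 := by exact_mod_cast h1
  have h4 : m' i < m i + 1 := by exact_mod_cast h2
  omega

open Classical in
theorem bsum_eq_sum {Qset : Set (ℤ × (Fin d → ℤ))} {b : ℤ × (Fin d → ℤ) → Rd d → ℝ}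
    {𝒬 : Finset (ℤ × (Fin d → ℤ))} {j : ℤ} (h𝒬 : ∀ q ∈ 𝒬, q ∈ Qset)
    (hj : ∀ q ∈ Qset, q.1 = j → q ∈ 𝒬) (y : Rd d) :
    bsum d Qset b j y = ∑ q ∈ 𝒬.filter (fun q => q.1 = j), b q y := by
  have hinj : ∀ q ∈ 𝒬.filter (fun q => q.1 = j), ∀ q' ∈ 𝒬.filter (fun q => q.1 = j),
      q.2 = q'.2 → q = q' := fun q hq q' hq' h =>
    Prod.ext ((Finset.mem_filter.1 hq).2.trans (Finset.mem_filter.1 hq').2.symm) h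
  rw [bsum, tsum_eq_sum (s := (𝒬.filter fun q => q.1 = j).image Prod.snd),
    Finset.sum_image fun q hq q' hq' => hinj q hq q' hq']
  · refine Finset.sum_congr rfl fun q hq => ?_
    obtain ⟨h1, h2⟩ := Finset.mem_filter.1 hq
    rw [← h2, indicator_of_mem (h𝒬 q h1)]
  · intro mv hmv
    refine indicator_of_notMem (fun h => hmv ?_) _
    exact Finset.mem_image.2 ⟨(j, mv), Finset.mem_filter.2 ⟨hj _ h rfl, rfl⟩, rfl⟩

open Classical in
theorem TKop_bsum_eq_sum {φ Om : Rd d → ℝ} {w : Fin d → ℝ} (hw : GridShift d w) {s : ℕ}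
    (hs : 2 ≤ s) {Qset : Set (ℤ × (Fin d → ℤ))} {b : ℤ × (Fin d → ℤ) → Rd d → ℝ}
    {𝒬 : Finset (ℤ × (Fin d → ℤ))} {j : ℤ} (h𝒬 : ∀ q ∈ 𝒬, q ∈ Qset)
    (hj : ∀ q ∈ Qset, q.1 = j - s → q ∈ 𝒬)
    (hsupp : ∀ q ∈ Qset, Function.support (b q) ⊆ dcube d 0 q.1 q.2) (m : Fin d → ℤ) (x : Rd d)
    (hInt : ∀ q ∈ 𝒬, Integrable fun y => Kker d φ Om j (x - y) * b q y) :
    TKop d φ Om w j m (bsum d Qset b (j - s)) x =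
      ∑ q ∈ 𝒬, if q.1 + s = j ∧ dcorner d q ∈ dhalf d w j m then
        cv d (Kker d φ Om (q.1 + s)) (b q) x else 0 := by
  set R := 𝒬.filter fun q => q.1 + s = j ∧ dcorner d q ∈ dhalf d w j m with hR
  have h1 : ∀ y, Kker d φ Om j (x - y) * (dhalf d w j m).indicator (bsum d Qset b (j - s)) y =
      ∑ q ∈ R, Kker d φ Om j (x - y) * b q y := by
    intro y
    rw [← Finset.mul_sum]
    congr 1
    rw [indicator_apply, bsum_eq_sum h𝒬 hj, hR]
    simp only [Finset.sum_filter]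
    have hterm : ∀ q ∈ 𝒬, (if y ∈ dhalf d w j m then (if q.1 = j - s then b q y else 0) else 0) =
        if q.1 + s = j ∧ dcorner d q ∈ dhalf d w j m then b q y else 0 := by
      intro q hq
      by_cases h0 : b q y = 0
      · simp [h0]
      by_cases hqj : q.1 + s = j
      · have hiff := mem_dhalf_iff_dcorner_mem hw hs m (hsupp q (h𝒬 q hq) h0)
        rw [hqj] at hiff
        rw [if_pos (eq_sub_of_add_eq hqj)]
        simp only [hiff, hqj, true_and]
      · have hqj' : q.1 ≠ j - s := fun h => hqj (by omega)
        simp [hqj, hqj']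
    rw [← Finset.sum_congr rfl hterm]
    split_ifs
    · rfl
    · simp
  have h2 : TKop d φ Om w j m (bsum d Qset b (j - s)) x =
      ∑ q ∈ R, ∫ y, Kker d φ Om j (x - y) * b q y := by
    rw [TKop, ← integral_finsetSum _ fun q hq => hInt q (Finset.mem_filter.1 hq).1]
    exact integral_congr_ae (Filter.Eventually.of_forall h1)
  rw [h2, hR, Finset.sum_filter]
  refine Finset.sum_congr rfl fun q _ => ?_
  split_ifs with h
  · rw [cv, h.1]
  · rfl

open Classical in
/-- The sum over all large cubes of a shifted grid, written as a sum over the bad functions. -/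
theorem tsum_TKop_eq_sum {φ Om : Rd d → ℝ} {w : Fin d → ℝ} (hw : GridShift d w) {s : ℕ}
    (hs : 2 ≤ s) {Qset : Set (ℤ × (Fin d → ℤ))} {b : ℤ × (Fin d → ℤ) → Rd d → ℝ}
    {𝒬 : Finset (ℤ × (Fin d → ℤ))} {l : ℤ} (h𝒬 : ∀ q, q ∈ 𝒬 ↔ q ∈ Qset ∧ l ≤ q.1 + s)
    (hsupp : ∀ q ∈ Qset, Function.support (b q) ⊆ dcube d 0 q.1 q.2) (x : Rd d)
    (hInt : ∀ q ∈ 𝒬, ∀ j, Integrable fun y => Kker d φ Om j (x - y) * b q y) :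
    ∑' km : ℤ × (Fin d → ℤ), Set.indicator {j : ℤ | l ≤ j}
        (fun j => TKop d φ Om w j km.2 (bsum d Qset b (j - (s : ℤ))) x) km.1 =
      ∑ q ∈ 𝒬.filter (fun q => ∃ m, dcorner d q ∈ dhalf d w (q.1 + s) m),
        cv d (Kker d φ Om (q.1 + s)) (b q) x := by
  have h1 : ∀ km : ℤ × (Fin d → ℤ), Set.indicator {j : ℤ | l ≤ j}
      (fun j => TKop d φ Om w j km.2 (bsum d Qset b (j - (s : ℤ))) x) km.1 =
      ∑ q ∈ 𝒬, if q.1 + s = km.1 ∧ dcorner d q ∈ dhalf d w km.1 km.2 then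
        cv d (Kker d φ Om (q.1 + s)) (b q) x else 0 := by
    rintro ⟨j, m⟩
    by_cases hlj : l ≤ j
    · rw [indicator_of_mem (show j ∈ {j : ℤ | l ≤ j} from hlj)]
      refine TKop_bsum_eq_sum hw hs (fun q hq => ((h𝒬 q).1 hq).1)
        (fun q hq hqj => (h𝒬 q).2 ⟨hq, by omega⟩) hsupp m x fun q hq => hInt q hq j
    · rw [indicator_of_notMem (show j ∉ {j : ℤ | l ≤ j} from hlj)]
      refine (Finset.sum_eq_zero fun q hq => if_neg fun h => hlj ?_).symm
      exact ((h𝒬 q).1 hq).2.trans h.1.le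
  simp only [h1]
  rw [Finset.sum_filter]
  refine (hasSum_sum fun q _ => ?_).tsum_eq
  by_cases hq : ∃ m, dcorner d q ∈ dhalf d w (q.1 + s) m
  · obtain ⟨m, hm⟩ := hq
    have h2 := hasSum_single (f := fun km : ℤ × (Fin d → ℤ) =>
      if q.1 + s = km.1 ∧ dcorner d q ∈ dhalf d w km.1 km.2 then
        cv d (Kker d φ Om (q.1 + s)) (b q) x else 0) (q.1 + s, m) (by
      rintro ⟨j, m'⟩ hne
      refine if_neg ?_
      rintro ⟨rfl, h⟩
      exact hne (by rw [eq_of_mem_dhalf hm h]))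
    rw [if_pos (⟨rfl, hm⟩ : _ ∧ _)] at h2
    rw [if_pos ⟨m, hm⟩]
    exact h2
  · rw [if_neg hq]
    have h2 : (fun km : ℤ × (Fin d → ℤ) =>
        if q.1 + s = km.1 ∧ dcorner d q ∈ dhalf d w km.1 km.2 then
          cv d (Kker d φ Om (q.1 + s)) (b q) x else 0) = fun _ => 0 := by
      funext km
      refine if_neg ?_
      rintro ⟨h, h'⟩
      rw [← h] at h'
      exact hq ⟨_, h'⟩
    rw [h2]
    exact hasSum_zero

end Assembly

theorem lintegral_iSup_rpow_two_le {X : Type*} [MeasurableSpace X] {μ : Measure X}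
    {a : ℤ → X → ℝ≥0∞} {B : ℝ≥0∞} (ha : ∀ l, AEMeasurable (a l) μ)
    (h : ∀ n : ℕ, ∃ M : X → ℝ≥0∞, (∀ l : ℤ, -(n:ℤ) ≤ l → ∀ x, a l x ^ 2 ≤ M x) ∧ ∫⁻ x, M x ∂μ ≤ B) :
    ∫⁻ x, (⨆ l, a l x) ^ (2:ℝ) ∂μ ≤ B := by
  have h1 : ∀ x, (⨆ l, a l x) ^ (2:ℝ) =
      ⨆ n : ℕ, (⨆ l : {l : ℤ // -(n:ℤ) ≤ l}, a l x) ^ (2:ℝ) := by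
    intro x
    have h2 : ⨆ l, a l x = ⨆ n : ℕ, ⨆ l : {l : ℤ // -(n:ℤ) ≤ l}, a l x := by
      refine le_antisymm (iSup_le fun l => ?_) (iSup_le fun n => iSup_le fun l => le_iSup (fun l => a l x) l)
      refine le_iSup_of_le l.natAbs ?_
      exact le_iSup (fun l' : {l' : ℤ // -((l.natAbs : ℕ) : ℤ) ≤ l'} => a l' x) ⟨l, by omega⟩
    rw [h2]
    exact (ENNReal.orderIsoRpow 2 (by norm_num)).map_iSup _
  have hmeas : ∀ n : ℕ, AEMeasurable
      (fun x => (⨆ l : {l : ℤ // -(n:ℤ) ≤ l}, a l x) ^ (2:ℝ)) μ := fun n =>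
    (AEMeasurable.iSup fun l : {l : ℤ // -(n:ℤ) ≤ l} => ha l).pow_const _
  simp only [h1]
  rw [lintegral_iSup' hmeas (Filter.Eventually.of_forall fun x n n' hn => ?_)]
  · refine iSup_le fun n => ?_
    obtain ⟨M, hM, hMB⟩ := h n
    refine (lintegral_mono fun x => ?_).trans hMB
    have h3 : ⨆ l : {l : ℤ // -(n:ℤ) ≤ l}, a l x ≤ M x ^ (1 / 2 : ℝ) := by
      refine iSup_le fun l => ?_
      have h4 := ENNReal.rpow_le_rpow (hM l l.2 x) (by norm_num : (0:ℝ) ≤ 1 / 2)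
      rw [← ENNReal.rpow_natCast, ← ENNReal.rpow_mul] at h4
      norm_num at h4 ⊢
      exact h4
    calc (⨆ l : {l : ℤ // -(n:ℤ) ≤ l}, a l x) ^ (2:ℝ) ≤ (M x ^ (1 / 2 : ℝ)) ^ (2:ℝ) :=
          ENNReal.rpow_le_rpow h3 (by norm_num)
      _ = M x := by rw [← ENNReal.rpow_mul]; norm_num
  · refine ENNReal.rpow_le_rpow (iSup_le fun l => ?_) (by norm_num)
    exact le_iSup (fun l' : {l' : ℤ // -(n':ℤ) ≤ l'} => a l' x)
      ⟨l, (neg_le_neg (Nat.cast_le.2 hn)).trans l.2⟩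

theorem omega2_eq_zero_of_omegaL1_eq_zero {d : ℕ} {Om : Rd d → ℝ} (h : omegaL1 d Om = 0) (η : ℝ)
    (s : ℕ) : Omega2 d Om η s = 0 := by
  funext x
  rw [Omega2, h, mul_zero, if_neg (not_lt.2 (abs_nonneg _))]
  rfl

theorem integrable_Kker_sub_mul {d : ℕ} {φ Om β : Rd d → ℝ} {H : ℝ} (hφ : AdmissiblePhi d φ)
    (hOm : AEStronglyMeasurable Om volume) (hH : ∀ x, |Om x| ≤ H) (hβ : Integrable β) (k : ℤ)
    (x : Rd d) : Integrable fun y => Kker d φ Om k (x - y) * β y := by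
  obtain ⟨C, -, hC⟩ := exists_profile_bound hφ
  exact hβ.bdd_mul ((Kker_integrable hφ hOm hH k).comp_sub_left x).aestronglyMeasurable
    (Filter.Eventually.of_forall fun y => abs_Kker_le hC hH k (x - y))

theorem sq_bound_le_of_mass {C s a COm lam I K c γ : ℝ} (hC : 0 ≤ C) (ha : 0 ≤ a)
    (haC : a ≤ COm) (hCOm : 0 < COm) (hlam : 0 < lam) (hI : 0 ≤ I) (hc : 0 < c) :
    C * s ^ 2 * ((2:ℝ) ^ (γ / 4 * s) * a * (K * lam / COm)) ^ 2 * (2:ℝ) ^ (-(γ * s)) *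
      (I / (c * lam / COm)) ≤
      C * K ^ 2 / c * (s ^ 2 * (2:ℝ) ^ (-(γ / 2) * s) * COm * lam * I) := by
  have h1 : ((2:ℝ) ^ (γ / 4 * s)) ^ 2 * (2:ℝ) ^ (-(γ * s)) = (2:ℝ) ^ (-(γ / 2) * s) := by
    rw [← Real.rpow_natCast, ← Real.rpow_mul (by norm_num), ← Real.rpow_add (by norm_num)]
    congr 1
    push_cast
    ring
  have h2 : C * s ^ 2 * ((2:ℝ) ^ (γ / 4 * s) * a * (K * lam / COm)) ^ 2 * (2:ℝ) ^ (-(γ * s)) *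
      (I / (c * lam / COm)) =
      C * K ^ 2 / c * (s ^ 2 * (((2:ℝ) ^ (γ / 4 * s)) ^ 2 * (2:ℝ) ^ (-(γ * s))) *
        (COm * (a / COm) ^ 2) * lam * I) := by
    field_simp
  rw [h2, h1]
  have h3 : (a / COm) ^ 2 ≤ 1 := pow_le_one₀ (by positivity) ((div_le_one hCOm).2 haC)
  have h4 : COm * (a / COm) ^ 2 ≤ COm := mul_le_of_le_one_right hCOm.le h3
  gcongr

open Classical in
theorem lintegral_iSup_tsum_TKop_le {d : ℕ} (hd : 0 < d) {φ : Rd d → ℝ} (hφ : AdmissiblePhi d φ) :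
    ∃ C : ℝ, 0 < C ∧ ∀ Om : Rd d → ℝ, Homogeneous0 d Om → AEStronglyMeasurable Om volume →
      ∀ H : ℝ, (∀ x, |Om x| ≤ H) →
      ∀ (COm Cc c₁ c₂ lam : ℝ) (f : Rd d → ℝ) (Qset : Set (ℤ × (Fin d → ℤ)))
        (b : ℤ × (Fin d → ℤ) → Rd d → ℝ), 0 < COm → 0 < Cc → 0 < c₁ → 0 < c₂ → 0 < lam →
      Integrable f → CZData d COm Cc c₁ c₂ f lam Qset b → ∀ s : ℕ, 3 ≤ s →
      ∀ w : Fin d → ℝ, GridShift d w → ∀ v : ℝ, 0 < v → v ≤ 1 →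
      v ^ (2 * (d + 2)) = ((2:ℝ) ^ s)⁻¹ →
      ∫⁻ x, (⨆ l : ℤ, ENNReal.ofReal |∑' km : ℤ × (Fin d → ℤ), Set.indicator {j : ℤ | l ≤ j}
          (fun j => TKop d φ Om w j km.2 (bsum d Qset b (j - (s : ℤ))) x) km.1|) ^ (2:ℝ) ≤
        ENNReal.ofReal (C * s ^ 2 * (H * (Cc * (c₂ * lam / COm))) ^ 2 * v *
          ((∫ x, |f x|) / (c₁ * lam / COm))) := by
  obtain ⟨C, hC, hmax⟩ := exists_maximal_cv_of_finset hd hφ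
  refine ⟨C, hC, ?_⟩
  intro Om hhom hmeas H hH COm Cc c₁ c₂ lam f Qset b hCOm hCc hc₁ hc₂ hlam hf hCZ s hs w hw v hv
    hv1 hvs
  have hc : 0 < c₁ * lam / COm := by positivity
  have hfin : ∀ l : ℤ, {q ∈ Qset | l ≤ q.1 + s}.Finite := fun l =>
    (hCZ.finite_setOf_le hf hc (l - s)).subset fun q hq => ⟨hq.1, by have := hq.2; omega⟩
  set F : ℤ → Finset (ℤ × (Fin d → ℤ)) := fun l => (hfin l).toFinset with hF
  have hmemF : ∀ l q, q ∈ F l ↔ q ∈ Qset ∧ l ≤ q.1 + s := fun l q => (hfin l).mem_toFinset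
  set R : ℤ → Finset (ℤ × (Fin d → ℤ)) := fun l => (F l).filter fun q =>
    ∃ m, dcorner d q ∈ dhalf d w (q.1 + s) m with hR
  have hRQ : ∀ l, ∀ q ∈ R l, q ∈ Qset := fun l q hq =>
    ((hmemF l q).1 (Finset.mem_filter.1 hq).1).1
  set g : ℤ × (Fin d → ℤ) → Rd d → ℝ := fun q =>
    cv d (Kker d φ Om (q.1 + s)) (measurableModification d b q) with hg
  have hsum : ∀ l x, ∑' km : ℤ × (Fin d → ℤ), Set.indicator {j : ℤ | l ≤ j}
      (fun j => TKop d φ Om w j km.2 (bsum d Qset b (j - (s : ℤ))) x) km.1 =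
      ∑ q ∈ R l, g q x := by
    intro l x
    rw [tsum_TKop_eq_sum hw (by omega) (hmemF l) hCZ.support_subset x fun q hq j =>
      integrable_Kker_sub_mul hφ hmeas hH (hCZ.integrable q ((hmemF l q).1 hq).1) j x]
    refine Finset.sum_congr rfl fun q hq => ?_
    rw [cv_congr_ae (measurableModification_ae_eq hCZ (hRQ l q hq))]
  simp only [hsum]
  have hbad := fun l => hCZ.badFamily hCc (hRQ l)
  refine lintegral_iSup_rpow_two_le (fun l => ?_) fun n => ?_
  · have h1 : AEMeasurable (fun x => ∑ q ∈ R l, g q x) volume :=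
      Finset.aemeasurable_fun_sum _ fun q hq => (cv_integrable (Kker_integrable hφ hmeas hH _)
        ((hbad l).integ q hq)).aestronglyMeasurable.aemeasurable
    exact (continuous_abs.measurable.comp_aemeasurable h1).ennreal_ofReal
  · obtain ⟨M, -, hMp, hMi⟩ := hmax Om hhom hmeas H hH (R (-n)) (measurableModification d b) _
      (hbad (-n)) (by positivity) s hs v hv hv1 hvs
    refine ⟨M, fun l hl x => ?_, hMi.trans ?_⟩
    · have h1 : R l = (R (-n)).filter fun q => l ≤ q.1 + s := by
        ext q
        simp only [hR, Finset.mem_filter, hmemF]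
        constructor
        · rintro ⟨⟨h2, h3⟩, h4⟩
          exact ⟨⟨⟨h2, hl.trans h3⟩, h4⟩, h3⟩
        · rintro ⟨⟨⟨h2, -⟩, h4⟩, h3⟩
          exact ⟨⟨h2, h3⟩, h4⟩
      rw [h1, ← Real.enorm_eq_ofReal_abs]
      exact hMp l x
    · rw [ENNReal.ofReal_mul (p := C * s ^ 2 * (H * (Cc * (c₂ * lam / COm))) ^ 2 * v)
        (by positivity)]
      exact mul_le_mul_right (hCZ.cubeSum_le hf hc (hRQ _)) _

/-- The key `L²` decay estimate for the maximal sums of `T_{K,2} b_{k-s}`. -/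
theorem TK2_maximal_l2_bound :
    ∀ d : ℕ, 2 ≤ d →
    ∀ Cc c₁ c₂ : ℝ, 0 < Cc → 0 < c₁ → 0 < c₂ →
    ∀ φ : Rd d → ℝ, AdmissiblePhi d φ →
    ∃ η : ℝ, 0 < η ∧ ∃ δ : ℝ, 0 < δ ∧ ∃ C' : ℝ, 0 < C' ∧
      ∀ Ω : Rd d → ℝ, OmegaHyp d Ω →
      ∀ f : Rd d → ℝ, Integrable f →
      ∀ lam : ℝ, 0 < lam →
      ∀ (Qset : Set (ℤ × (Fin d → ℤ))) (b : ℤ × (Fin d → ℤ) → Rd d → ℝ),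
        CZData d (constCOmega d Ω) Cc c₁ c₂ f lam Qset b →
      ∀ s : ℕ, 200 ≤ s →
      ∀ w : Fin d → ℝ, GridShift d w →
        (∫⁻ x : Rd d,
            (⨆ l : ℤ, ENNReal.ofReal
              |∑' km : ℤ × (Fin d → ℤ),
                  Set.indicator {j : ℤ | l ≤ j}
                    (fun j => TKop d φ (Omega2 d Ω η s) w j km.2
                      (bsum d Qset b (j - (s : ℤ))) x) km.1|) ^ (2:ℝ)) ^ (1/2 : ℝ) ≤
          ENNReal.ofReal (C' * Real.sqrt ((s:ℝ)^2 * (2:ℝ) ^ (-δ * s) *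
            constCOmega d Ω * lam * ∫ x : Rd d, |f x|)) := by
  intro d hd Cc c₁ c₂ hCc hc₁ hc₂ φ hφ
  have hd0 : 0 < d := by omega
  obtain ⟨C, hC, hmain⟩ := lintegral_iSup_tsum_TKop_le hd0 hφ
  set γ : ℝ := 1 / (2 * (d + 2)) with hγ
  have hγ0 : 0 < γ := by positivity
  refine ⟨γ / 4, by positivity, γ / 2, by positivity, Real.sqrt (C * (Cc * c₂) ^ 2 / c₁),
    by positivity, ?_⟩
  intro Om hOm f hf lam hlam Qset b hCZ s hs w hw
  rcases (omegaL1_nonneg (d := d) (Om := Om)).eq_or_lt with h0 | hpos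
  · have h1 := omega2_eq_zero_of_omegaL1_eq_zero h0.symm (γ / 4) s
    have h2 : ∀ k x, Kker d φ (Omega2 d Om (γ / 4) s) k x = 0 := fun k x => by
      rw [h1, Kker]; simp
    simp [TKop, h2]
  have hle := omegaL1_le_constCOmega hOm hpos
  have hCOm : 0 < constCOmega d Om := hpos.trans_le hle
  have hmeas := aestronglyMeasurable_omega2
    (hOm.1.aestronglyMeasurable hd0 hOm.2.1.aestronglyMeasurable) (γ / 4) s
  have hv : ((2:ℝ) ^ (-(γ * s))) ^ (2 * (d + 2)) = ((2:ℝ) ^ s)⁻¹ := by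
    rw [← Real.rpow_natCast, ← Real.rpow_mul (by norm_num), ← Real.rpow_natCast 2 s,
      ← Real.rpow_neg (by norm_num)]
    congr 1
    rw [hγ]
    push_cast
    field_simp
  have h1 := hmain _ (hOm.1.omega2 (γ / 4) s) hmeas _ (abs_omega2_le (γ / 4) s) _ Cc c₁ c₂ lam f
    Qset b hCOm hCc hc₁ hc₂ hlam hf hCZ s (by omega) w hw ((2:ℝ) ^ (-(γ * s))) (by positivity)
    (Real.rpow_le_one_of_one_le_of_nonpos (by norm_num) (neg_nonpos.2 (by positivity))) hv
  have hI : 0 ≤ ∫ x, |f x| := integral_nonneg fun _ => abs_nonneg _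
  have h2 := sq_bound_le_of_mass (s := (s:ℝ)) (K := Cc * c₂) (γ := γ) hC.le hpos.le hle hCOm hlam
    hI hc₁
  have h3 : Cc * (c₂ * lam / constCOmega d Om) = Cc * c₂ * lam / constCOmega d Om := by ring
  rw [h3] at h1
  rw [← Real.sqrt_mul (by positivity), Real.sqrt_eq_rpow,
    ← ENNReal.ofReal_rpow_of_nonneg (by positivity) (by norm_num)]
  exact ENNReal.rpow_le_rpow (h1.trans (ENNReal.ofReal_le_ofReal h2)) (by norm_num)
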